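/- arXiv:2111.05749 — 2 statements merged into one kernel-verified Lean document; each statement's English description precedes it below -/
import Mathlib

section
/- Let G = (V,E) be a finite graph with |V| even. Then the set M(G) := {χ_M : M a perfect matching of G} of characteristic vectors of perfect matchings of G is a dyadic generating set for a cone: every integral vector in cone(M(G)) can be written as a conic combination of vectors of M(G) all of whose coefficients are dyadic rationals. -/
open Finset

attribute [local instance] Classical.propDecidable

/-- A real number is `p`-adic if it has the form `a / p^k` for integers `a, k`, `k ≥ 0`;
for `p = 2` these are the dyadic rationals. -/
def IsPadic (p : ℕ) (r : ℝ) : Prop := ∃ (a : ℤ) (k : ℕ), r = (a : ℝ) / (p : ℝ) ^ k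

/-- A finite family of integral vectors is a `p`-adic generating set for a cone if every
integral vector in its conic hull is a conic combination of the vectors with `p`-adic
coefficients; for `p = 2` this is a dyadic generating set for a cone (DGSC). -/
def IsPGSC (p : ℕ) {ι d : Type} [Fintype ι] [Fintype d] (a : ι → d → ℤ) : Prop :=
  ∀ w : d → ℤ,
    (∃ lam : ι → ℝ, (∀ i, 0 ≤ lam i) ∧ ∀ j, ∑ i, lam i * (a i j : ℝ) = (w j : ℝ)) →
    ∃ lam : ι → ℝ, (∀ i, 0 ≤ lam i) ∧ (∀ i, IsPadic p (lam i)) ∧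
      ∀ j, ∑ i, lam i * (a i j : ℝ) = (w j : ℝ)

/-- In the multigraph with edge set `E` and endpoint map `ends`, `M` is a perfect matching
if every vertex is incident with exactly one edge of `M`. -/
def IsPerfectMatchingSet {V E : Type} [Fintype V] [Fintype E] (ends : E → Sym2 V)
    (M : Finset E) : Prop :=
  ∀ v : V, (Finset.univ.filter (fun e => e ∈ M ∧ v ∈ ends e)).card = 1

set_option linter.unusedSectionVars false
set_option linter.unusedVariables false
set_option linter.style.longLine false

namespace DG

/-- Loopless multigraph on vertex type `V`, edge type `E`. -/
structure Gr (V E : Type) where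
  s : E → V
  t : E → V
  ne : ∀ e, s e ≠ t e

/-- crossing indicator -/
noncomputable def Gr.cr {V E : Type} (G : Gr V E) (U : Finset V) (e : E) : ℤ :=
  if (G.s e ∈ U ↔ G.t e ∈ U) then 0 else 1

noncomputable def Gr.cut {V E : Type} [Fintype E] (G : Gr V E) (x : E → ℤ) (U : Finset V) : ℤ :=
  ∑ e, x e * G.cr U e

structure Gr.InK {V E : Type} [Fintype E] (G : Gr V E) (x : E → ℤ) (r : ℤ) : Prop where
  nn : ∀ e, 0 ≤ x e
  st : ∀ v, G.cut x {v} = r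
  od : ∀ U : Finset V, Odd U.card → r ≤ G.cut x U

/-- perfect matchings as integer vectors -/
structure Gr.PM {V E : Type} [Fintype E] (G : Gr V E) (m : E → ℤ) : Prop where
  nn : ∀ e, 0 ≤ m e
  st : ∀ v, G.cut m {v} = 1

/-- sums of perfect matchings -/
def Gr.C {V E : Type} [Fintype E] (G : Gr V E) : AddSubmonoid (E → ℤ) :=
  AddSubmonoid.closure {m | G.PM m}

def Gr.Dy {V E : Type} [Fintype E] (G : Gr V E) (x : E → ℤ) : Prop :=
  ∃ k : ℕ, (2 ^ k : ℕ) • x ∈ G.C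

section basic
variable {V E : Type} [Fintype E] (G : Gr V E)

lemma cr_nonneg (U : Finset V) (e : E) : 0 ≤ G.cr U e := by
  unfold Gr.cr; split_ifs <;> simp

lemma cr_le_one (U : Finset V) (e : E) : G.cr U e ≤ 1 := by
  unfold Gr.cr; split_ifs <;> simp

lemma cr_eq (U : Finset V) (e : E) : G.cr U e = 0 ∨ G.cr U e = 1 := by
  unfold Gr.cr; split_ifs <;> simp

lemma cr_single (v : V) (e : E) :
    G.cr {v} e = (if G.s e = v then 1 else 0) + (if G.t e = v then 1 else 0) := by
  have := G.ne e
  unfold Gr.cr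
  simp only [mem_singleton]
  split_ifs <;> grind

lemma cr_compl [Fintype V] (U : Finset V) (e : E) : G.cr Uᶜ e = G.cr U e := by
  unfold Gr.cr; simp only [mem_compl, not_iff_not]

lemma cut_add (x y : E → ℤ) (U : Finset V) : G.cut (x + y) U = G.cut x U + G.cut y U := by
  simp [Gr.cut, add_mul, sum_add_distrib]

lemma cut_sub (x y : E → ℤ) (U : Finset V) : G.cut (x - y) U = G.cut x U - G.cut y U := by
  simp [Gr.cut, sub_mul, sum_sub_distrib]

lemma cut_smul (n : ℤ) (y : E → ℤ) (U : Finset V) : G.cut (n • y) U = n * G.cut y U := by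
  simp [Gr.cut, mul_sum, mul_assoc]

lemma cut_nsmul (n : ℕ) (y : E → ℤ) (U : Finset V) : G.cut (n • y) U = n * G.cut y U := by
  simp [Gr.cut, mul_sum, mul_assoc]

lemma cut_zero (U : Finset V) : G.cut 0 U = 0 := by
  simp [Gr.cut]

lemma cut_compl [Fintype V] (x : E → ℤ) (U : Finset V) : G.cut x Uᶜ = G.cut x U := by
  simp [Gr.cut, cr_compl]

lemma cut_nonneg {x : E → ℤ} (h : ∀ e, 0 ≤ x e) (U : Finset V) : 0 ≤ G.cut x U :=
  sum_nonneg fun e _ => mul_nonneg (h e) (cr_nonneg G U e)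

/-- the pairing identity -/
lemma pair [Fintype V] {R : Type} [CommRing R] (x : E → ℤ) (ρ : V → R) :
    ∑ v, ρ v * (G.cut x {v} : R) = ∑ e, (x e : R) * (ρ (G.s e) + ρ (G.t e)) := by
  have h : ∀ v, ρ v * (G.cut x {v} : R)
      = ∑ e, (x e : R) * ((if G.s e = v then ρ v else 0) + (if G.t e = v then ρ v else 0)) := by
    intro v
    simp only [Gr.cut, cr_single, Int.cast_sum, Int.cast_mul, Int.cast_add, mul_sum, Int.cast_ite,
      Int.cast_one, Int.cast_zero]
    refine sum_congr rfl fun e _ => ?_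
    split_ifs <;> ring
  simp only [h]
  rw [sum_comm]
  refine sum_congr rfl fun e _ => ?_
  rw [← mul_sum, sum_add_distrib]
  simp

lemma pair_reg [Fintype V] {R : Type} [CommRing R] {x : E → ℤ} {r : ℤ}
    (h : ∀ v, G.cut x {v} = r) (ρ : V → R) :
    (r : R) * ∑ v, ρ v = ∑ e, (x e : R) * (ρ (G.s e) + ρ (G.t e)) := by
  rw [← pair, mul_sum]
  exact sum_congr rfl fun v _ => by rw [h, mul_comm]

/-- cut parity -/
lemma cut_parity [Fintype V] {x : E → ℤ} {r : ℤ}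
    (h : ∀ v, G.cut x {v} = r) (U : Finset V) : ∃ k : ℤ, G.cut x U = r * U.card - 2 * k := by
  refine ⟨∑ e, x e * (if G.s e ∈ U ∧ G.t e ∈ U then 1 else 0), ?_⟩
  have := pair_reg G h (fun v => if v ∈ U then (1 : ℤ) else 0)
  simp only [Int.cast_id, sum_boole, Finset.filter_mem_eq_inter, univ_inter] at this
  rw [this, Gr.cut, mul_sum, ← sum_sub_distrib]
  refine sum_congr rfl fun e _ => ?_
  unfold Gr.cr
  by_cases hs : G.s e ∈ U <;> by_cases ht : G.t e ∈ U <;> simp [hs, ht] <;> ring1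

lemma PM.inC {m : E → ℤ} (h : G.PM m) : m ∈ G.C := AddSubmonoid.subset_closure h

lemma C_iff {x : E → ℤ} : x ∈ G.C ↔ ∃ L : Multiset (E → ℤ), (∀ m ∈ L, G.PM m) ∧ L.sum = x := by
  constructor
  · intro h
    exact AddSubmonoid.exists_multiset_of_mem_closure h
  · rintro ⟨L, hL, rfl⟩
    exact AddSubmonoid.multiset_sum_mem _ _ fun m hm => PM.inC G (hL m hm)

lemma Dy.of_smul {x : E → ℤ} {k : ℕ} (h : G.Dy ((2 ^ k : ℕ) • x)) : G.Dy x := by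
  obtain ⟨l, hl⟩ := h
  refine ⟨l + k, ?_⟩
  rwa [pow_add, mul_smul]

/-- PMs satisfy odd cut -/
lemma PM.inK [Fintype V] {m : E → ℤ} (h : G.PM m) : G.InK m 1 := by
  refine ⟨h.nn, h.st, fun U hU => ?_⟩
  obtain ⟨k, hk⟩ := cut_parity G h.st U
  have := cut_nonneg G h.nn U
  have : (Odd (U.card : ℤ)) := by exact_mod_cast hU
  obtain ⟨j, hj⟩ := this
  omega

lemma InK.add {x y : E → ℤ} {a b : ℤ} (hx : G.InK x a) (hy : G.InK y b) : G.InK (x + y) (a + b) :=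
  ⟨fun e => add_nonneg (hx.nn e) (hy.nn e), fun v => by rw [cut_add, hx.st, hy.st],
   fun U hU => by rw [cut_add]; exact add_le_add (hx.od U hU) (hy.od U hU)⟩

lemma InK.nsmul {x : E → ℤ} {a : ℤ} (n : ℕ) (hx : G.InK x a) : G.InK (n • x) (n * a) :=
  ⟨fun e => by simpa using mul_nonneg (Int.natCast_nonneg n) (hx.nn e),
   fun v => by rw [cut_nsmul, hx.st],
   fun U hU => by
    rw [cut_nsmul]; exact mul_le_mul_of_nonneg_left (hx.od U hU) (Int.natCast_nonneg n)⟩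

lemma InK.smul {x : E → ℤ} {a : ℤ} {n : ℤ} (hn : 0 ≤ n) (hx : G.InK x a) : G.InK (n • x) (n * a) :=
  ⟨fun e => by simpa using mul_nonneg hn (hx.nn e),
   fun v => by rw [cut_smul, hx.st],
   fun U hU => by
    rw [cut_smul]; exact mul_le_mul_of_nonneg_left (hx.od U hU) hn⟩

lemma InK.r_nonneg {x : E → ℤ} {a : ℤ} [Nonempty V] (hx : G.InK x a) : 0 ≤ a := by
  obtain ⟨v⟩ := (inferInstance : Nonempty V)
  rw [← hx.st v]; exact cut_nonneg G hx.nn _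

lemma zero_of_r_zero {x : E → ℤ} (hn : ∀ e, 0 ≤ x e) (hx : ∀ v, G.cut x {v} = 0) : x = 0 := by
  funext e
  have h1 := hx (G.s e)
  have h2 := (sum_eq_zero_iff_of_nonneg (s := univ)
    (fun i _ => mul_nonneg (hn i) (cr_nonneg G {G.s e} i))).1 h1 e (mem_univ _)
  rw [cr_single] at h2
  have := G.ne e
  simpa [this.symm] using h2

end basic

/-- Reduction: map `c : V → V1`, keep the edges `q`. -/
def Gr.red {V E V1 : Type} (G : Gr V E) (c : V → V1) (q : E → Prop)
    (hq : ∀ e, q e → c (G.s e) ≠ c (G.t e)) : Gr V1 {e // q e} :=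
  ⟨fun e => c (G.s e), fun e => c (G.t e), fun e => hq e e.2⟩

lemma red_cut {V E V1 : Type} [Fintype V] [Fintype E] (G : Gr V E) (c : V → V1) (q : E → Prop)
    [Fintype {e // q e}]
    (hq : ∀ e, q e → c (G.s e) ≠ c (G.t e)) (x : E → ℤ)
    (hx : ∀ e, ¬ q e → c (G.s e) ≠ c (G.t e) → x e = 0) (W : Finset V1) (F : Finset V)
    (hF : ∀ v, v ∈ F ↔ c v ∈ W) :
    (G.red c q hq).cut (fun e => x e) W = G.cut x F := by
  unfold Gr.cut
  have h1 : ∀ e : {e // q e}, x e * (G.red c q hq).cr W e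
      = (fun e => x e * G.cr F e) e := by
    intro e; simp only [Gr.red, Gr.cr, hF]; congr!
  rw [sum_congr rfl (fun e _ => h1 e)]
  rw [← Finset.sum_subtype (p := q) (univ.filter q) (by simp)
    (fun e => x e * G.cr F e)]
  apply Finset.sum_filter_of_ne
  intro e _ h
  by_contra hqe
  apply h
  by_cases hc : c (G.s e) = c (G.t e)
  · simp [Gr.cr, hF, hc]
  · simp [hx e hqe hc]

lemma odd_preimage {V V1 : Type} [Fintype V] (c : V → V1)
    (hc : ∀ w, ∃ F : Finset V, (∀ v, v ∈ F ↔ c v = w) ∧ Odd F.card)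
    (W : Finset V1) (hW : Odd W.card) (F : Finset V) (hF : ∀ v, v ∈ F ↔ c v ∈ W) :
    Odd F.card := by
  have : F.card = ∑ w ∈ W, (F.filter fun v => c v = w).card := by
    rw [Finset.card_eq_sum_card_fiberwise (f := c) (t := W)]
    intro v hv; exact (hF v).1 hv
  rw [this, Finset.odd_sum_iff_odd_card_odd]
  rwa [Finset.filter_true_of_mem]
  intro w hw
  obtain ⟨F', h1, h2⟩ := hc w
  convert h2 using 2
  ext v
  simp only [mem_filter, h1, hF, and_iff_right_iff_imp]
  rintro rfl; exact hw

lemma red_inK {V E V1 : Type} [Fintype V] [Fintype E] (G : Gr V E) (c : V → V1) (q : E → Prop)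
    [Fintype {e // q e}]
    (hq : ∀ e, q e → c (G.s e) ≠ c (G.t e)) {x : E → ℤ} {r : ℤ}
    (hx : ∀ e, ¬ q e → c (G.s e) ≠ c (G.t e) → x e = 0) (hK : G.InK x r)
    (hc : ∀ w, ∃ F : Finset V, (∀ v, v ∈ F ↔ c v = w) ∧ Odd F.card ∧ G.cut x F = r) :
    (G.red c q hq).InK (fun e => x e) r := by
  refine ⟨fun e => hK.nn e, fun w => ?_, fun W hW => ?_⟩
  · obtain ⟨F, h1, h2, h3⟩ := hc w
    rw [red_cut G c q hq x hx {w} F (by simpa using h1), h3]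
  · have hF : ∀ v, v ∈ (univ.filter fun v => c v ∈ W) ↔ c v ∈ W := by simp
    rw [red_cut G c q hq x hx W _ hF]
    exact hK.od _ (odd_preimage c (fun w => by
      obtain ⟨F, h1, h2, h3⟩ := hc w; exact ⟨F, h1, h2⟩) W hW _ hF)

lemma red_pull {V E V1 : Type} [Fintype V] [Fintype E] (G : Gr V E) (c : V → V1) (q : E → Prop)
    [Fintype {e // q e}]
    (hq : ∀ e, q e → c (G.s e) ≠ c (G.t e)) {y : {e // q e} → ℤ} (hy : y ∈ (G.red c q hq).C) :
    ∃ L : Multiset (E → ℤ), (∀ m ∈ L, (∀ e, 0 ≤ m e) ∧ (∀ e, ¬ q e → m e = 0) ∧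
      ∀ w (F : Finset V), (∀ v, v ∈ F ↔ c v = w) → G.cut m F = 1) ∧
      (∀ e, ¬ q e → L.sum e = 0) ∧ ∀ e : {e // q e}, L.sum e = y e := by
  obtain ⟨L, hL, rfl⟩ := (C_iff _).1 hy
  let ext : ({e // q e} → ℤ) →+ (E → ℤ) :=
    { toFun := fun m e => if h : q e then m ⟨e, h⟩ else 0
      map_zero' := by funext e; simp
      map_add' := by intro a b; funext e; simp only [Pi.add_apply]; split_ifs <;> simp }
  have hext1 : ∀ m e, ¬ q e → ext m e = 0 := by
    intro m e he
    change (if h : q e then m ⟨e, h⟩ else 0) = 0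
    simp [he]
  have hext2 : ∀ m (e : {e // q e}), ext m e = m e := by
    intro m e
    change (if h : q e then m ⟨e, h⟩ else 0) = m e
    simp [e.2]
  refine ⟨L.map ext, ?_, ?_, ?_⟩
  · intro m hm
    obtain ⟨m1, hm1, rfl⟩ := Multiset.mem_map.1 hm
    have h1 := hL m1 hm1
    refine ⟨fun e => ?_, fun e he => hext1 _ e he, fun w F hF => ?_⟩
    · by_cases he : q e
      · rw [hext2 m1 ⟨e, he⟩]; exact h1.nn _
      · rw [hext1 m1 e he]
    · have h2 := red_cut G c q hq (ext m1) (by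
        intro e he _; exact hext1 _ e he) {w} F (by simpa using hF)
      have h3 : (fun e : {e // q e} => ext m1 e) = m1 := by
        funext e
        exact hext2 m1 e
      rw [h3, h1.st] at h2
      exact h2.symm
  · intro e he
    rw [← map_multiset_sum]
    exact hext1 _ e he
  · intro e
    rw [← map_multiset_sum]
    exact hext2 _ e

end DG

set_option linter.unusedSectionVars false
set_option linter.unusedVariables false
set_option linter.style.longLine false
set_option linter.unnecessarySeqFocus false
namespace DG

/-- induction hypothesis below size `n` -/
def IHyp (n : ℕ) : Prop := ∀ (V E : Type) [Fintype V] [Fintype E] (G : Gr V E),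
  Fintype.card V + Fintype.card E < n → ∀ x r, G.InK x r → G.Dy x

section
variable {V E : Type} [Fintype V] [Fintype E] (G : Gr V E)

lemma msum_apply (e : E) (L : Multiset (E → ℤ)) : L.sum e = (L.map fun m => m e).sum :=
  map_multiset_sum (Pi.evalAddMonoidHom (fun _ : E => ℤ) e) L

lemma zero_Dy : G.Dy 0 := ⟨0, by simpa using G.C.zero_mem⟩

lemma zero_case (IH : IHyp (Fintype.card V + Fintype.card E)) {x : E → ℤ} {r : ℤ}
    (hK : G.InK x r) (e0 : E) (he0 : x e0 = 0) : G.Dy x := by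
  have hq : ∀ e, x e ≠ 0 → (id : V → V) (G.s e) ≠ id (G.t e) := fun e _ => G.ne e
  have h1 := red_inK G (id : V → V) (fun e => x e ≠ 0) hq (x := x) (r := r)
    (by intro e he _; simpa using he) hK
    (fun w => ⟨{w}, by simp, by simp, hK.st w⟩)
  have hlt : Fintype.card V + Fintype.card {e // x e ≠ 0} < Fintype.card V + Fintype.card E := by
    have := Fintype.card_subtype_lt (p := fun e => x e ≠ 0) (x := e0) (by simpa using he0)
    omega
  obtain ⟨k, hk⟩ := IH V {e // x e ≠ 0} _ hlt _ _ h1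
  obtain ⟨L, hL, hs0, hs⟩ := red_pull G _ _ _ hk
  refine ⟨k, (C_iff G).2 ⟨L, ?_, ?_⟩⟩
  · intro m hm
    obtain ⟨a, b, c⟩ := hL m hm
    exact ⟨a, fun v => c v {v} (by simp)⟩
  · funext e
    by_cases h : x e = 0
    · rw [hs0 e (by simpa using h)]; simp [h]
    · rw [hs ⟨e, h⟩]; rfl

lemma side_case (IH : IHyp (Fintype.card V + Fintype.card E)) {x : E → ℤ} {r : ℤ}
    (hK : G.InK x r) (U : Finset V) (hU' : Odd Uᶜ.card) (h2 : 1 < Uᶜ.card)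
    (ht : G.cut x U = r) :
    ∃ k : ℕ, ∃ L : Multiset (E → ℤ), (∀ m ∈ L, (∀ e, 0 ≤ m e) ∧
      (∀ v ∈ U, G.cut m {v} = 1) ∧ G.cut m U = 1) ∧
      ∀ e, (G.s e ∈ U ∨ G.t e ∈ U) → L.sum e = 2 ^ k * x e := by
  let c : V → Option {v // v ∈ U} := fun v => if h : v ∈ U then some ⟨v, h⟩ else none
  have hc1 : ∀ v (h : v ∈ U), c v = some ⟨v, h⟩ := fun v h => by simp [c, h]
  have hc2 : ∀ v, v ∉ U → c v = none := fun v h => by simp [c, h]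
  have hq : ∀ e, (G.s e ∈ U ∨ G.t e ∈ U) → c (G.s e) ≠ c (G.t e) := by
    intro e he
    have := G.ne e
    by_cases hs : G.s e ∈ U <;> by_cases ht : G.t e ∈ U
    · simp [hc1 _ hs, hc1 _ ht, this]
    · simp [hc1 _ hs, hc2 _ ht]
    · simp [hc2 _ hs, hc1 _ ht]
    · tauto
  have hf1 : ∀ w : {v // v ∈ U}, ∀ v, v ∈ ({w.1} : Finset V) ↔ c v = some w := by
    intro w v
    by_cases h : v ∈ U
    · simp [hc1 v h, Subtype.ext_iff]
    · simp [hc2 v h]; rintro rfl; exact h w.2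
  have hf2 : ∀ v, v ∈ Uᶜ ↔ c v = none := by
    intro v
    by_cases h : v ∈ U
    · simp [hc1 v h, h]
    · simp [hc2 v h, h]
  have h1 := red_inK G c (fun e => (G.s e ∈ U ∨ G.t e ∈ U)) hq (x := x) (r := r)
    (by
      intro e he hne
      exfalso
      push Not at he
      simp [hc2 _ he.1, hc2 _ he.2] at hne) hK
    (by
      rintro (_ | w)
      · exact ⟨Uᶜ, hf2, hU', by rw [cut_compl, ht]⟩
      · exact ⟨_, hf1 w, by simp, hK.st _⟩)
  have hlt : Fintype.card (Option {v // v ∈ U}) + Fintype.card {e // (G.s e ∈ U ∨ G.t e ∈ U)}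
      < Fintype.card V + Fintype.card E := by
    have a1 := Fintype.card_subtype_le (fun e => (G.s e ∈ U ∨ G.t e ∈ U))
    have a2 : Fintype.card (Option {v // v ∈ U}) = U.card + 1 := by simp
    have a3 := Finset.card_add_card_compl U
    omega
  obtain ⟨k, hk⟩ := IH _ _ _ hlt _ _ h1
  obtain ⟨L, hL, hs0, hs⟩ := red_pull G _ _ _ hk
  refine ⟨k, L, ?_, ?_⟩
  · intro m hm
    obtain ⟨a, b, d⟩ := hL m hm
    refine ⟨a, fun v hv => ?_, ?_⟩
    · exact d _ _ (hf1 ⟨v, hv⟩)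
    · have := d _ _ hf2
      rwa [cut_compl] at this
  · intro e he
    rw [hs ⟨e, he⟩]
    simp

/-- a vector of nonneg integers with cut 1 has a unique cut edge -/
lemma cut_one {m : E → ℤ} (h0 : ∀ e, 0 ≤ m e) {U : Finset V} (h : G.cut m U = 1) :
    ∃ e0, G.cr U e0 = 1 ∧ m e0 = 1 ∧ ∀ e, G.cr U e = 1 → e ≠ e0 → m e = 0 := by
  have hex : ∃ e0, m e0 * G.cr U e0 ≠ 0 := by
    by_contra hcon
    push Not at hcon
    rw [Gr.cut, sum_eq_zero (fun e _ => hcon e)] at h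
    simp at h
  obtain ⟨e0, he0⟩ := hex
  have hc : G.cr U e0 = 1 := by
    rcases cr_eq G U e0 with h | h
    · simp [h] at he0
    · exact h
  rw [hc, mul_one] at he0
  have hs : m e0 * G.cr U e0 + ∑ e ∈ univ.erase e0, m e * G.cr U e = 1 := by
    rw [add_sum_erase _ (fun e => m e * G.cr U e) (mem_univ e0)]; exact h
  have hn : ∀ e ∈ univ.erase e0, 0 ≤ m e * G.cr U e :=
    fun e _ => mul_nonneg (h0 e) (cr_nonneg G U e)
  have hn' := sum_nonneg hn
  have := h0 e0
  rw [hc, mul_one] at hs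
  have h1 : m e0 = 1 := by omega
  have h2 : ∑ e ∈ univ.erase e0, m e * G.cr U e = 0 := by omega
  refine ⟨e0, hc, h1, fun e he hne => ?_⟩
  have := (sum_eq_zero_iff_of_nonneg hn).1 h2 e (by simp [hne])
  simpa [he] using this

noncomputable def glue (U : Finset V) (a b : E → ℤ) : E → ℤ := fun e =>
  if (G.s e ∈ U ∨ G.t e ∈ U) then a e else b e

lemma glue_PM (U : Finset V) {a b : E → ℤ} (ha : ∀ e, 0 ≤ a e) (hb : ∀ e, 0 ≤ b e)
    (ha' : ∀ v ∈ U, G.cut a {v} = 1) (hb' : ∀ v ∉ U, G.cut b {v} = 1)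
    (hab : ∀ e, G.cr U e = 1 → a e = b e) : G.PM (glue G U a b) := by
  refine ⟨fun e => ?_, fun v => ?_⟩
  · unfold glue; split_ifs
    · exact ha e
    · exact hb e
  · by_cases hv : v ∈ U
    · rw [← ha' v hv]
      refine sum_congr rfl fun e _ => ?_
      unfold glue
      rw [cr_single]
      split_ifs with h1 h2 h3 <;> simp <;> grind
    · rw [← hb' v hv]
      refine sum_congr rfl fun e _ => ?_
      have h0 := hab e
      unfold glue
      unfold Gr.cr at h0
      rw [cr_single]
      by_cases h1 : G.s e ∈ U <;> by_cases h2 : G.t e ∈ U <;>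
        by_cases h3 : G.s e = v <;> by_cases h4 : G.t e = v <;> simp [h1, h2, h3, h4] at h0 ⊢ <;> grind

lemma glue_sum (U : Finset V) : ∀ (L1 L2 : Multiset (E → ℤ)),
    (∀ m ∈ L1, (∀ e, 0 ≤ m e) ∧ (∀ v ∈ U, G.cut m {v} = 1) ∧ G.cut m U = 1) →
    (∀ m ∈ L2, (∀ e, 0 ≤ m e) ∧ (∀ v ∉ U, G.cut m {v} = 1) ∧ G.cut m U = 1) →
    (∀ e, G.cr U e = 1 → L1.sum e = L2.sum e) → glue G U L1.sum L2.sum ∈ G.C := by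
  intro L1
  induction L1 using Multiset.induction_on with
  | empty =>
    intro L2 _ h2 h
    rcases Multiset.empty_or_exists_mem L2 with rfl | ⟨m, hm⟩
    · have : glue G U (Multiset.sum 0) (Multiset.sum 0) = 0 := by
        funext e; simp [glue]
      rw [this]; exact G.C.zero_mem
    · exfalso
      obtain ⟨L, rfl⟩ := Multiset.exists_cons_of_mem hm
      obtain ⟨a, b, c⟩ := h2 m hm
      obtain ⟨e0, h3, h4, _⟩ := cut_one G a c
      have h5 := h e0 h3
      have : 0 ≤ L.sum e0 := by
        rw [msum_apply]
        apply Multiset.sum_nonneg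
        intro y hy
        obtain ⟨m', hm', rfl⟩ := Multiset.mem_map.1 hy
        exact (h2 m' (Multiset.mem_cons_of_mem hm')).1 e0
      simp at h5
      omega
  | cons m L ih =>
    intro L2 h1 h2 h
    obtain ⟨a, b, c⟩ := h1 m (Multiset.mem_cons_self m L)
    obtain ⟨e0, h3, h4, h5⟩ := cut_one G a c
    have hL : 0 ≤ L.sum e0 := by
      rw [msum_apply]
      apply Multiset.sum_nonneg
      intro y hy
      obtain ⟨m', hm', rfl⟩ := Multiset.mem_map.1 hy
      exact (h1 m' (Multiset.mem_cons_of_mem hm')).1 e0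
    have h6 : ∃ m2 ∈ L2, m2 e0 ≠ 0 := by
      by_contra hcon
      push Not at hcon
      have h7 := h e0 h3
      have h8 : L2.sum e0 = 0 := by
        rw [msum_apply e0 L2, Multiset.sum_eq_zero]
        intro y hy
        obtain ⟨m', hm', rfl⟩ := Multiset.mem_map.1 hy
        exact hcon m' hm'
      simp [h8] at h7; omega
    obtain ⟨m2, hm2, h7⟩ := h6
    obtain ⟨L2', rfl⟩ := Multiset.exists_cons_of_mem hm2
    obtain ⟨a2, b2, c2⟩ := h2 m2 hm2
    obtain ⟨e1, h8, h9, h10⟩ := cut_one G a2 c2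
    have he : e1 = e0 := by
      by_contra hne
      exact h7 (h10 e0 h3 (Ne.symm hne))
    subst he
    have hag : ∀ e, G.cr U e = 1 → m e = m2 e := by
      intro e he
      by_cases h : e = e1
      · rw [h, h4, h9]
      · rw [h5 e he h, h10 e he h]
    have hp := glue_PM G U a a2 b b2 hag
    have := ih L2' (fun m' hm' => h1 m' (Multiset.mem_cons_of_mem hm'))
      (fun m' hm' => h2 m' (Multiset.mem_cons_of_mem hm')) (by
        intro e he
        have := h e he
        have := hag e he
        simp at *
        omega)
    have heq : glue G U (m ::ₘ L).sum (m2 ::ₘ L2').sum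
        = glue G U m m2 + glue G U L.sum L2'.sum := by
      funext e
      simp only [glue, Multiset.sum_cons, Pi.add_apply]
      split_ifs <;> rfl
    rw [heq]
    exact G.C.add_mem (PM.inC G hp) this

lemma InK.even {x : E → ℤ} {r : ℤ} (hK : G.InK x r) (hr : 0 < r) : Even (Fintype.card V) := by
  by_contra h
  rw [Nat.not_even_iff_odd] at h
  have := hK.od univ (by simpa using h)
  have h2 : G.cut x univ = 0 := by simp [Gr.cut, Gr.cr]
  omega

lemma tight_case (IH : IHyp (Fintype.card V + Fintype.card E)) {x : E → ℤ} {r : ℤ}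
    (hK : G.InK x r) (U : Finset V) (hU : Odd U.card) (h1 : 1 < U.card) (h2 : 1 < Uᶜ.card)
    (ht : G.cut x U = r) : G.Dy x := by
  have hne : Nonempty V := by
    obtain ⟨v, _⟩ := Finset.card_pos.1 (lt_trans Nat.zero_lt_one h1)
    exact ⟨v⟩
  rcases (InK.r_nonneg G hK).eq_or_lt with hr | hr
  · rw [zero_of_r_zero G hK.nn (by rw [hr]; exact hK.st)]
    exact zero_Dy G
  · have hev := InK.even G hK hr
    have a3 := Finset.card_add_card_compl U
    have hU' : Odd Uᶜ.card := by grind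
    obtain ⟨k1, L1, hL1, hs1⟩ := side_case G IH hK U hU' h2 ht
    obtain ⟨k2, L2, hL2, hs2⟩ := side_case G IH hK Uᶜ (by simpa using hU) (by simpa using h1)
      (by rw [cut_compl, ht])
    have key := glue_sum G U (2 ^ k2 • L1) (2 ^ k1 • L2)
      (fun m hm => hL1 m (Multiset.mem_of_mem_nsmul hm))
      (fun m hm => by
        obtain ⟨a, b, c⟩ := hL2 m (Multiset.mem_of_mem_nsmul hm)
        exact ⟨a, fun v hv => b v (by simpa using hv), by rwa [cut_compl] at c⟩)
      (by
        intro e he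
        have h3 : G.s e ∈ U ∨ G.t e ∈ U := by
          by_contra hcon
          push Not at hcon
          simp [Gr.cr, hcon] at he
        have h4 : G.s e ∈ Uᶜ ∨ G.t e ∈ Uᶜ := by
          by_contra hcon
          simp only [mem_compl] at hcon
          push Not at hcon
          simp [Gr.cr, hcon] at he
        simp only [Multiset.sum_nsmul, Pi.smul_apply, hs1 e h3, hs2 e h4, nsmul_eq_mul]
        push_cast; ring)
    refine ⟨k1 + k2, ?_⟩
    convert key using 1
    funext e
    unfold glue
    simp only [Multiset.sum_nsmul, Pi.smul_apply, nsmul_eq_mul]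
    split_ifs with h3
    · rw [hs1 e h3]; push_cast; ring
    · rw [hs2 e (by simp only [mem_compl]; tauto)]; push_cast; ring

end
end DG

set_option linter.unusedSectionVars false
set_option linter.unusedVariables false
set_option linter.style.longLine false
set_option linter.unnecessarySeqFocus false
namespace DG
section
variable {V E : Type} [Fintype V] [Fintype E] (G : Gr V E)

/-- support simple graph -/
def suppG (x : E → ℤ) : SimpleGraph V where
  Adj u v := u ≠ v ∧ ∃ e, 0 < x e ∧ s(G.s e, G.t e) = s(u, v)
  symm := ⟨by
    rintro u v ⟨h, e, h1, h2⟩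
    exact ⟨h.symm, e, h1, by rw [h2, Sym2.eq_swap]⟩⟩
  loopless := ⟨fun v h => h.1 rfl⟩

lemma not_violator {x : E → ℤ} {r : ℤ} (hK : G.InK x r) (hr : 0 < r) (S : Set V) :
    ¬ (suppG G x).IsTutteViolator S := by
  unfold SimpleGraph.IsTutteViolator
  set H' := ((⊤ : (suppG G x).Subgraph).deleteVerts S) with hH'
  have hfin : (H'.coe.oddComponents).Finite := Set.toFinite _
  have hv : ∀ v, v ∈ H'.verts ↔ v ∉ S := by intro v; simp [hH']
  set O := hfin.toFinset with hO
  rw [Set.ncard_eq_toFinset_card _ hfin, ← hO]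
  let UU : H'.coe.ConnectedComponent → Finset V :=
    fun c => univ.filter fun v => ∃ h : v ∈ H'.verts, (⟨v, h⟩ : H'.verts) ∈ c.supp
  have hUodd : ∀ c ∈ O, Odd (UU c).card := by
    intro c hc
    have hc' : Odd c.supp.ncard := by simpa [hO] using hc
    have : (UU c : Set V) = Subtype.val '' c.supp := by
      ext v; simp [UU]
    rw [← Set.ncard_coe_finset, this, Set.ncard_image_of_injective _ Subtype.val_injective]
    exact hc'
  have hone : ∀ v, ∑ c ∈ O, (if v ∈ UU c then (1 : ℤ) else 0) ≤ 1 := by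
    intro v
    rw [sum_boole]
    have : (O.filter fun c => v ∈ UU c).card ≤ 1 := by
      rw [card_le_one]
      intro c hc d hd
      simp only [UU, mem_filter, mem_univ, true_and] at hc hd
      obtain ⟨_, h1, h2⟩ := hc
      obtain ⟨_, h3, h4⟩ := hd
      exact SimpleGraph.ConnectedComponent.eq_of_common_vertex h2 h4
    exact_mod_cast this
  set SF : Finset V := univ.filter (· ∈ S) with hSF
  have hScard : S.ncard = SF.card := by
    rw [← Set.ncard_coe_finset]; congr; ext v; simp [SF]
  rw [hScard, not_lt]
  have e1 : r * O.card ≤ ∑ c ∈ O, G.cut x (UU c) := by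
    rw [mul_comm, ← nsmul_eq_mul, ← sum_const]
    exact sum_le_sum fun c hc => hK.od _ (hUodd c hc)
  have e2 : ∑ c ∈ O, G.cut x (UU c) ≤
      ∑ e, x e * ((if G.s e ∈ SF then 1 else 0) + (if G.t e ∈ SF then 1 else 0)) := by
    unfold Gr.cut
    rw [sum_comm]
    refine sum_le_sum fun e _ => ?_
    rw [← mul_sum]
    rcases (hK.nn e).eq_or_lt with h0 | h0
    · rw [← h0]; simp
    apply mul_le_mul_of_nonneg_left _ h0.le
    have hp : ∀ c, G.cr (UU c) e ≤ (if G.t e ∈ UU c then 1 else 0) * (if G.s e ∈ SF then 1 else 0)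
        + (if G.s e ∈ UU c then 1 else 0) * (if G.t e ∈ SF then 1 else 0) := by
      intro c
      have hnS : ∀ v, v ∈ UU c → v ∉ SF := by
        intro v hv'
        simp only [UU, mem_filter, mem_univ, true_and] at hv'
        obtain ⟨h, _⟩ := hv'
        simpa [SF] using (hv v).1 h
      have hboth : G.s e ∉ SF → G.t e ∉ SF → (G.s e ∈ UU c ↔ G.t e ∈ UU c) := by
        intro h1 h2
        have h1' := (hv _).2 (by simpa [SF] using h1)
        have h2' := (hv _).2 (by simpa [SF] using h2)
        have hadj : H'.coe.Adj ⟨G.s e, h1'⟩ ⟨G.t e, h2'⟩ := by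
          have : (suppG G x).Adj (G.s e) (G.t e) := ⟨G.ne e, e, h0, rfl⟩
          have a := (hv _).1 h1'
          have b := (hv _).1 h2'
          simp [hH', a, b, this]
        have := SimpleGraph.ConnectedComponent.mem_supp_congr_adj c hadj
        simp only [UU, mem_filter, mem_univ, true_and]
        exact ⟨fun ⟨_, h⟩ => ⟨h2', this.1 h⟩, fun ⟨_, h⟩ => ⟨h1', this.2 h⟩⟩
      have h3 := hnS (G.s e)
      have h4 := hnS (G.t e)
      unfold Gr.cr
      by_cases a : G.s e ∈ SF <;> by_cases b : G.t e ∈ SF <;> by_cases c1 : G.s e ∈ UU c <;>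
        by_cases d : G.t e ∈ UU c <;> simp [a, b, c1, d] <;> tauto
    calc ∑ c ∈ O, G.cr (UU c) e ≤ _ := sum_le_sum fun c _ => hp c
      _ = (∑ c ∈ O, if G.t e ∈ UU c then 1 else 0) * (if G.s e ∈ SF then 1 else 0)
          + (∑ c ∈ O, if G.s e ∈ UU c then 1 else 0) * (if G.t e ∈ SF then 1 else 0) := by
          rw [sum_add_distrib, sum_mul, sum_mul]
      _ ≤ _ := by
          have h1 := hone (G.t e)
          have h2 := hone (G.s e)
          split_ifs <;> linarith
  have e3 := pair_reg G hK.st (fun v => if v ∈ SF then (1 : ℤ) else 0)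
  simp only [Int.cast_id, sum_boole, Finset.filter_mem_eq_inter, univ_inter] at e3
  have : r * O.card ≤ r * SF.card := by rw [e3]; exact e1.trans e2
  exact_mod_cast le_of_mul_le_mul_left this hr

lemma pm_exists {x : E → ℤ} {r : ℤ} (hK : G.InK x r) (hr : 0 < r) :
    ∃ m, G.PM m ∧ ∀ e, x e = 0 → m e = 0 := by
  obtain ⟨M, hM⟩ := SimpleGraph.tutte.2 (not_violator G hK hr)
  rw [SimpleGraph.Subgraph.isPerfectMatching_iff] at hM
  choose f hf hf' using hM
  dsimp only at hf hf'
  have hg : ∀ v, ∃ e, 0 < x e ∧ s(G.s e, G.t e) = s(v, f v) := fun v => (M.adj_sub (hf v)).2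
  have hff : ∀ v, f (f v) = v := fun v => (hf' _ v ((hf v).symm)).symm
  let P : Sym2 V → E → Prop := fun a e => 0 < x e ∧ s(G.s e, G.t e) = a
  have hP : ∀ v, ∃ e, P s(v, f v) e := hg
  let g : Sym2 V → Option E := fun a => if h : ∃ e, P a e then some h.choose else none
  have hgs : ∀ v, ∃ e, g s(v, f v) = some e ∧ 0 < x e ∧ s(G.s e, G.t e) = s(v, f v) := by
    intro v
    refine ⟨(hP v).choose, by simp only [g, dif_pos (hP v)], (hP v).choose_spec⟩
  refine ⟨fun e => if M.Adj (G.s e) (G.t e) ∧ g s(G.s e, G.t e) = some e then 1 else 0, ?_, ?_⟩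
  · refine ⟨fun e => by split_ifs <;> simp, fun v => ?_⟩
    obtain ⟨e0, h1, h2, h3⟩ := hgs v
    unfold Gr.cut
    have hv0 : G.cr {v} e0 = 1 := by
      rw [cr_single]
      have := G.ne e0
      have h4 : v ∈ s(G.s e0, G.t e0) := by rw [h3]; simp
      rcases Sym2.mem_iff.1 h4 with h | h <;> subst h <;> simp [this, this.symm]
    have hadj0 : M.Adj (G.s e0) (G.t e0) := by
      rw [← SimpleGraph.Subgraph.mem_edgeSet, h3, SimpleGraph.Subgraph.mem_edgeSet]
      exact hf v
    dsimp only
    rw [sum_eq_single e0]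
    · rw [if_pos ⟨hadj0, by rw [h3, h1]⟩, hv0]; rfl
    · intro e _ hne
      by_cases hc : G.cr {v} e = 0
      · simp [hc]
      rw [if_neg]
      · simp
      rintro ⟨ha, hb⟩
      apply hne
      have hs : s(G.s e, G.t e) = s(v, f v) := by
        rw [cr_single] at hc
        by_cases h5 : G.s e = v
        · rw [h5] at ha ⊢; rw [hf' v _ ha]
        · by_cases h6 : G.t e = v
          · rw [h6] at ha ⊢; rw [hf' v _ ha.symm, Sym2.eq_swap]
          · simp [h5, h6] at hc
      rw [hs, h1] at hb
      simpa using hb.symm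
    · simp
  · intro e he
    dsimp only
    rw [if_neg]
    rintro ⟨ha, hb⟩
    have hs : s(G.s e, G.t e) = s(G.s e, f (G.s e)) := by rw [hf' _ _ ha]
    obtain ⟨e0, h1, h2, h3⟩ := hgs (G.s e)
    rw [hs, h1] at hb
    have : e0 = e := by simpa using hb
    subst this
    omega

/-- bipartite: regular nonneg vectors are in K -/
lemma bip_inK {c : V → Prop} {x : E → ℤ} {r : ℤ} (hc : ∀ e, x e ≠ 0 → (c (G.s e) ↔ ¬ c (G.t e)))
    (hn : ∀ e, 0 ≤ x e) (hs : ∀ v, G.cut x {v} = r) : G.InK x r := by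
  refine ⟨hn, hs, fun U hU => ?_⟩
  rcases isEmpty_or_nonempty V with hV | ⟨⟨v0⟩⟩
  · have : U = ∅ := by ext v; exact (hV.false v).elim
    simp [this] at hU
  have hr : 0 ≤ r := by rw [← hs v0]; exact cut_nonneg G hn _
  have key := pair_reg G hs (fun v => if v ∈ U then (if c v then (1 : ℤ) else -1) else 0)
  set d : ℤ := ∑ v, (if v ∈ U then (if c v then (1 : ℤ) else -1) else 0) with hd
  have hodd : Odd d := by
    have h1 : d = U.card - 2 * ∑ v, (if v ∈ U then (if c v then (0 : ℤ) else 1) else 0) := by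
      have : (U.card : ℤ) = ∑ v, if v ∈ U then 1 else 0 := by
        simp [Finset.filter_mem_eq_inter]
      rw [this, hd, mul_sum, ← sum_sub_distrib]
      refine sum_congr rfl fun v _ => ?_
      split_ifs <;> simp
    have h2 : Odd (U.card : ℤ) := by exact_mod_cast hU
    rw [h1]
    exact h2.sub_even (even_two_mul _)
  simp only [Int.cast_id] at key
  have hab : ∀ e, |x e * ((if G.s e ∈ U then (if c (G.s e) then (1 : ℤ) else -1) else 0) +
      (if G.t e ∈ U then (if c (G.t e) then (1 : ℤ) else -1) else 0))| ≤ x e * G.cr U e := by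
    intro e
    rw [abs_mul, abs_of_nonneg (hn e)]
    by_cases h0 : x e = 0
    · simp [h0]
    apply mul_le_mul_of_nonneg_left _ (hn e)
    have := hc e h0
    unfold Gr.cr
    by_cases a : G.s e ∈ U <;> by_cases b : G.t e ∈ U <;> by_cases d : c (G.t e) <;>
      simp [a, b, d, this]
  have h3 : |r * d| ≤ G.cut x U := by
    rw [key]
    exact (abs_sum_le_sum_abs _ _).trans (sum_le_sum fun e _ => hab e)
  rw [abs_mul, abs_of_nonneg hr] at h3
  have h4 : 1 ≤ |d| := by
    apply Int.one_le_abs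
    rintro h
    rw [h] at hodd
    exact absurd hodd (by decide)
  nlinarith

lemma bip_C {c : V → Prop} : ∀ (n : ℕ) (x : E → ℤ),
    (∀ e, x e ≠ 0 → (c (G.s e) ↔ ¬ c (G.t e))) →
    (∀ e, 0 ≤ x e) → (∀ v, G.cut x {v} = n) → x ∈ G.C := by
  intro n
  induction n with
  | zero =>
    intro x _ hn hs
    rw [zero_of_r_zero G hn (by simpa using hs)]
    exact G.C.zero_mem
  | succ n ih =>
    intro x hc hn hs
    obtain ⟨m, hm, hm0⟩ := pm_exists G (bip_inK G hc hn hs) (by positivity)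
    have hm1 : ∀ e, m e ≤ 1 := by
      intro e
      have h1 := hm.st (G.s e)
      have h2 := single_le_sum (s := univ) (f := fun i => m i * G.cr {G.s e} i)
        (fun i _ => mul_nonneg (hm.nn i) (cr_nonneg G {G.s e} i)) (mem_univ e)
      have : G.cr {G.s e} e = 1 := by rw [cr_single]; simp [(G.ne e).symm]
      simp only [this, mul_one] at h2
      rw [← h1]; exact h2
    have hle : ∀ e, m e ≤ x e := by
      intro e
      by_cases h : x e = 0
      · rw [hm0 e h, h]
      · have := hn e; have := hm1 e; omega
    have h3 := ih (x - m) (by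
        intro e he
        apply hc
        intro h
        apply he
        simp [h, hm0 e h]) (fun e => by simpa using hle e) (fun v => by
        rw [cut_sub, hs, hm.st]; push_cast; ring)
    have : x = (x - m) + m := by simp
    rw [this]
    exact G.C.add_mem h3 (PM.inC G hm)

lemma bip_C' [Nonempty V] {c : V → Prop} {x : E → ℤ} {r : ℤ}
    (hc : ∀ e, x e ≠ 0 → (c (G.s e) ↔ ¬ c (G.t e)))
    (hn : ∀ e, 0 ≤ x e) (hs : ∀ v, G.cut x {v} = r) : x ∈ G.C := by
  have hr := InK.r_nonneg G (bip_inK G hc hn hs)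
  obtain ⟨n, rfl⟩ := Int.eq_ofNat_of_zero_le hr
  exact bip_C G n x hc hn hs

end
end DG

set_option linter.unusedSectionVars false
set_option linter.unusedVariables false
set_option linter.style.longLine false
set_option linter.unnecessarySeqFocus false
namespace DG
section
variable {V E : Type} [Fintype V] [Fintype E] (G : Gr V E)

/-- nontrivial odd set -/
def NT (U : Finset V) : Prop := Odd U.card ∧ 1 < U.card ∧ 1 < Uᶜ.card

/-- The critical situation. -/
structure Ctx (x0 : E → ℤ) (r0 : ℤ) : Prop where
  pos : ∀ e, 0 < x0 e
  st : ∀ v, G.cut x0 {v} = r0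
  od : ∀ U, NT U → r0 < G.cut x0 U
  rpos : 0 < r0
  ev : Even (Fintype.card V)
  ne : Nonempty V
  nb : ¬ ∃ c : V → Prop, ∀ e, (c (G.s e) ↔ ¬ c (G.t e))
  bd : ∀ z r, G.InK z r → ((∃ e, z e = 0) ∨ ∃ U, NT U ∧ G.cut z U = r) → G.Dy z

variable {G} {x0 : E → ℤ} {r0 : ℤ}

lemma NT.compl (hev : Even (Fintype.card V)) {U : Finset V} (h : NT U) : NT Uᶜ := by
  obtain ⟨a, b, c⟩ := h
  have := Finset.card_add_card_compl U
  refine ⟨by grind, c, by simpa using b⟩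

lemma inK_of (hev : Even (Fintype.card V)) {z : E → ℤ} {r : ℤ} (h1 : ∀ e, 0 ≤ z e)
    (h2 : ∀ v, G.cut z {v} = r) (h3 : ∀ U, NT U → r ≤ G.cut z U) : G.InK z r := by
  refine ⟨h1, h2, fun U hU => ?_⟩
  by_cases hN : NT U
  · exact h3 U hN
  have := Finset.card_add_card_compl U
  by_cases hc : U.card = 1
  · obtain ⟨v, rfl⟩ := Finset.card_eq_one.1 hc
    rw [h2]
  · have h4 : ¬ (1 < Uᶜ.card) := fun h => hN ⟨hU, by grind, h⟩
    have : Uᶜ.card = 1 := by grind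
    obtain ⟨v, hv⟩ := Finset.card_eq_one.1 this
    rw [← cut_compl, hv, h2]

/-- constraint index -/
abbrev Ix (V E : Type) [Fintype V] := E ⊕ {U : Finset V // NT U}

/-- degree functional -/
noncomputable def rr (G : Gr V E) [Nonempty V] : (E → ℤ) →+ ℤ where
  toFun z := G.cut z {Classical.arbitrary V}
  map_zero' := cut_zero G _
  map_add' x y := cut_add G x y _

/-- constraint functionals -/
noncomputable def phi (G : Gr V E) [Nonempty V] : Ix V E → ((E → ℤ) →+ ℤ)
  | Sum.inl e => Pi.evalAddMonoidHom (fun _ : E => ℤ) e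
  | Sum.inr U => { toFun := fun z => G.cut z U.1 - rr G z
                   map_zero' := by simp [cut_zero]
                   map_add' := fun x y => by simp only [cut_add, map_add]; ring }

lemma phi_inl [Nonempty V] (e : E) (z : E → ℤ) : phi G (Sum.inl e) z = z e := rfl
lemma phi_inr [Nonempty V] (U) (z : E → ℤ) : phi G (Sum.inr U) z = G.cut z U.1 - rr G z := rfl

/-- regular vectors -/
def Reg (G : Gr V E) [Nonempty V] : Submodule ℤ (E → ℤ) where
  carrier := {z | ∀ v, G.cut z {v} = rr G z}
  zero_mem' := fun v => by simp [cut_zero]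
  add_mem' := fun {a b} ha hb v => by rw [cut_add, ha, hb, map_add]
  smul_mem' := fun n a ha v => by rw [cut_smul, ha, map_zsmul, smul_eq_mul]

lemma mem_Reg [Nonempty V] {z : E → ℤ} : z ∈ Reg G ↔ ∀ v, G.cut z {v} = rr G z := Iff.rfl

lemma rr_eq [Nonempty V] {z : E → ℤ} {r : ℤ} (h : ∀ v, G.cut z {v} = r) : rr G z = r := h _

lemma reg_of [Nonempty V] {z : E → ℤ} {r : ℤ} (h : ∀ v, G.cut z {v} = r) : z ∈ Reg G :=
  fun v => by rw [h, rr_eq h]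

lemma inK_of_phi [Nonempty V] (hev : Even (Fintype.card V)) {z : E → ℤ} (hz : z ∈ Reg G)
    (h : ∀ i, 0 ≤ phi G i z) : G.InK z (rr G z) :=
  inK_of hev (fun e => h (Sum.inl e)) hz (fun U hU => by
    have := h (Sum.inr ⟨U, hU⟩); rw [phi_inr] at this; simpa using this)

lemma phi_of_inK [Nonempty V] {z : E → ℤ} {r : ℤ} (hz : G.InK z r) (i) : 0 ≤ phi G i z := by
  rcases i with e | U
  · exact hz.nn e
  · rw [phi_inr, rr_eq hz.st]; have := hz.od U.1 U.2.1; omega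

lemma Ctx.phi_pos [Nonempty V] (hc : Ctx G x0 r0) (i) : 0 < phi G i x0 := by
  rcases i with e | U
  · exact hc.pos e
  · rw [phi_inr, rr_eq hc.st]; have := hc.od U.1 U.2; omega

lemma Ctx.dy [Nonempty V] (hc : Ctx G x0 r0) {z : E → ℤ} (hz : z ∈ Reg G)
    (h : ∀ i, 0 ≤ phi G i z) (i) (hi : phi G i z = 0) : G.Dy z := by
  refine hc.bd z _ (inK_of_phi hc.ev hz h) ?_
  rcases i with e | U
  · exact Or.inl ⟨e, hi⟩
  · right; refine ⟨U.1, U.2, ?_⟩; rw [phi_inr] at hi; linarith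

lemma Dy.inC {z : E → ℤ} (h : G.Dy z) : ∃ n : ℕ, 0 < n ∧ n • z ∈ G.C := by
  obtain ⟨k, hk⟩ := h
  exact ⟨2 ^ k, by positivity, hk⟩

lemma PM.le_one {m : E → ℤ} (hm : G.PM m) (e : E) : m e ≤ 1 := by
  have h1 := hm.st (G.s e)
  have h2 := single_le_sum (s := univ) (f := fun i => m i * G.cr {G.s e} i)
    (fun i _ => mul_nonneg (hm.nn i) (cr_nonneg G {G.s e} i)) (mem_univ e)
  have : G.cr {G.s e} e = 1 := by rw [cr_single]; simp [(G.ne e).symm]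
  simp only [this, mul_one] at h2
  rw [← h1]; exact h2

lemma PM.reg [Nonempty V] {m : E → ℤ} (hm : G.PM m) : m ∈ Reg G := reg_of hm.st

lemma PM.phi_nonneg [Nonempty V] {m : E → ℤ} (hm : G.PM m) (i) : 0 ≤ phi G i m :=
  phi_of_inK (PM.inK G hm) i

/-- Edmonds -/
lemma Ctx.edmonds (hc : Ctx G x0 r0) {z : E → ℤ} {r : ℤ} (hz : G.InK z r) :
    ∃ n : ℕ, 0 < n ∧ n • z ∈ G.C := by
  have := hc.ne
  rcases (InK.r_nonneg G hz).eq_or_lt with hr | hr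
  · rw [zero_of_r_zero G hz.nn (by rw [hr]; exact hz.st)]
    exact ⟨1, one_pos, by simpa using G.C.zero_mem⟩
  by_cases hb : ∃ i, phi G i z = 0
  · obtain ⟨i, hi⟩ := hb
    exact Dy.inC (hc.dy (reg_of hz.st) (phi_of_inK hz) i hi)
  push Not at hb
  obtain ⟨m, hm, -⟩ := pm_exists G hz hr
  have hne : (univ.filter fun i => 0 < phi G i m).Nonempty := by
    by_contra hcon
    rw [not_nonempty_iff_eq_empty, filter_eq_empty_iff] at hcon
    have : m = 0 := by
      funext e
      have h1 := hcon (mem_univ (Sum.inl e))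
      rw [phi_inl] at h1
      have := hm.nn e
      simp; omega
    have h2 := hm.st (Classical.arbitrary V)
    rw [this, cut_zero] at h2
    omega
  obtain ⟨i, hi, hmin⟩ := exists_min_image _ (fun i => (phi G i z : ℚ) / phi G i m) hne
  simp only [mem_filter, mem_univ, true_and] at hi hmin
  have hzi : 0 ≤ phi G i z := phi_of_inK hz i
  have hle : ∀ j, phi G i z * phi G j m ≤ phi G i m * phi G j z := by
    intro j
    rcases (PM.phi_nonneg hm j).eq_or_lt with h | h
    · rw [← h, mul_zero]; exact mul_nonneg hi.le (phi_of_inK hz j)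
    · have h1 := hmin j h
      have a : (0 : ℚ) < phi G i m := by exact_mod_cast hi
      have b : (0 : ℚ) < phi G j m := by exact_mod_cast h
      rw [div_le_div_iff₀ a b] at h1
      have : phi G i z * phi G j m ≤ phi G j z * phi G i m := by exact_mod_cast h1
      linarith
  set y := phi G i m • z - phi G i z • m with hy
  have hyr : y ∈ Reg G := (Reg G).sub_mem ((Reg G).smul_mem _ (reg_of hz.st))
    ((Reg G).smul_mem _ (PM.reg hm))
  have hyφ : ∀ j, phi G j y = phi G i m * phi G j z - phi G i z * phi G j m := by
    intro j; rw [hy, map_sub, map_zsmul, map_zsmul, smul_eq_mul, smul_eq_mul]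
  obtain ⟨n, hn, hn'⟩ := Dy.inC (hc.dy hyr (fun j => by rw [hyφ]; have := hle j; omega) i
    (by rw [hyφ]; ring))
  obtain ⟨a, ha⟩ := Int.eq_ofNat_of_zero_le hi.le
  obtain ⟨b, hb⟩ := Int.eq_ofNat_of_zero_le hzi
  refine ⟨n * a, by rw [ha] at hi; have : 0 < a := by exact_mod_cast hi
                    positivity, ?_⟩
  have : (n * a) • z = n • y + (n * b) • m := by
    rw [hy, ha, hb]
    funext e
    simp; ring
  rw [this]
  exact G.C.add_mem hn' (G.C.nsmul_mem (PM.inC G hm) _)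

lemma Ctx.inK (hc : Ctx G x0 r0) : G.InK x0 r0 :=
  inK_of hc.ev (fun e => (hc.pos e).le) hc.st (fun U hU => (hc.od U hU).le)

lemma exists_PM_of_C {z : E → ℤ} (hz : z ∈ G.C) (e : E) (he : z e ≠ 0) :
    ∃ m, G.PM m ∧ m e = 1 ∧ ∃ z' ∈ G.C, z = m + z' := by
  obtain ⟨L, hL, rfl⟩ := (C_iff G).1 hz
  have : ∃ m ∈ L, m e ≠ 0 := by
    by_contra hcon
    push Not at hcon
    apply he
    rw [msum_apply, Multiset.sum_eq_zero]
    intro y hy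
    obtain ⟨m', hm', rfl⟩ := Multiset.mem_map.1 hy
    exact hcon m' hm'
  obtain ⟨m, hm, hme⟩ := this
  obtain ⟨L', rfl⟩ := Multiset.exists_cons_of_mem hm
  have := (hL m hm).nn e
  have := PM.le_one (hL m hm) e
  refine ⟨m, hL m hm, by omega, L'.sum, (C_iff G).2 ⟨L', fun m' h => hL m' (Multiset.mem_cons_of_mem h), rfl⟩, by simp⟩

lemma Ctx.edge_PM (hc : Ctx G x0 r0) (e : E) : ∃ m, G.PM m ∧ m e = 1 := by
  obtain ⟨n, hn, h⟩ := hc.edmonds hc.inK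
  obtain ⟨m, hm, h1, -⟩ := exists_PM_of_C h e (by
    have := hc.pos e
    simp; omega)
  exact ⟨m, hm, h1⟩

/-- large multiples of x0 dominate -/
lemma Ctx.dominate [Nonempty V] (hc : Ctx G x0 r0) (z : E → ℤ) :
    ∃ j : ℕ, ∀ j' : ℕ, j ≤ j' → ∀ i, 0 < phi G i (z + j' • x0) := by
  refine ⟨∑ i, (phi G i z).natAbs + 1, fun j' hj i => ?_⟩
  have h1 : (phi G i z).natAbs ≤ ∑ i, (phi G i z).natAbs :=
    single_le_sum (f := fun i => (phi G i z).natAbs) (fun _ _ => Nat.zero_le _) (mem_univ i)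
  have h2 := hc.phi_pos i
  rw [map_add, map_nsmul, nsmul_eq_mul]
  have h3 : (j' : ℤ) ≤ j' * phi G i x0 := by nlinarith
  omega

lemma Ctx.density (hc : Ctx G x0 r0) {k : ℕ} {a b : E → ℤ} (ha : a ∈ G.C) (hb : b ∈ G.C)
    (h : (2 ^ k : ℕ) • x0 + b = a) : G.Dy x0 := by
  have := hc.ne
  have hregC : ∀ z ∈ G.C, z ∈ Reg G := by
    intro z hz
    refine AddSubmonoid.closure_induction (fun m hm => PM.reg hm) (Reg G).zero_mem
      (fun _ _ _ _ h1 h2 => (Reg G).add_mem h1 h2) hz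
  obtain ⟨j0, hj0⟩ := hc.dominate (-b)
  set d := j0 with hd
  have hj : j0 ≤ 2 ^ (k + d) :=
    (Nat.lt_two_pow_self).le.trans (Nat.pow_le_pow_right (by norm_num) (by omega))
  have hp := hj0 _ hj
  obtain ⟨n, hn, hcC⟩ := hc.edmonds (inK_of_phi hc.ev
    ((Reg G).add_mem ((Reg G).neg_mem (hregC b hb)) (nsmul_mem (reg_of hc.st) _))
    (fun i => (hp i).le))
  set c := n • (-b + 2 ^ (k + d) • x0) with hcdef
  set A := n * 2 ^ d with hA
  have hApos : 0 < A := by positivity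
  set S := n + 2 * d with hS
  set l := 2 ^ S / A with hl
  set t := 2 ^ S % A with ht
  have hlt : A * l + t = 2 ^ S := Nat.div_add_mod _ _
  have ht' : t < A := Nat.mod_lt _ hApos
  have hl' : 2 ^ d ≤ l := by
    rw [hl, Nat.le_div_iff_mul_le hApos, hA, hS, pow_add, two_mul, pow_add]
    have : n ≤ 2 ^ n := (Nat.lt_two_pow_self).le
    calc 2 ^ d * (n * 2 ^ d) = n * (2 ^ d * 2 ^ d) := by ring
      _ ≤ _ := Nat.mul_le_mul_right _ this
  have htl : t ≤ n * l := ht'.le.trans (Nat.mul_le_mul_left _ hl')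
  refine ⟨k + S, ?_⟩
  have heq : (2 ^ (k + S) : ℕ) • x0 = l • c + (n * l - t) • b + t • a := by
    rw [← h, hcdef, pow_add 2 k S, ← hlt, hA]
    obtain ⟨q, hq⟩ := Nat.exists_eq_add_of_le htl
    rw [hq, Nat.add_sub_cancel_left]
    funext e
    have hq' : (n : ℤ) * l = t + q := by exact_mod_cast hq
    simp only [Pi.smul_apply, Pi.add_apply, Pi.neg_apply]
    simp only [nsmul_eq_mul]
    push_cast
    linear_combination (b e) * hq'
  rw [heq]
  exact G.C.add_mem (G.C.add_mem (nsmul_mem hcC _) (nsmul_mem hb _)) (nsmul_mem ha _)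

/-- integer span of PMs -/
def Sp (G : Gr V E) : Submodule ℤ (E → ℤ) := Submodule.span ℤ {m | G.PM m}

lemma C_le_Sp {z : E → ℤ} (hz : z ∈ G.C) : z ∈ Sp G :=
  AddSubmonoid.closure_induction (fun m hm => Submodule.subset_span hm) (Sp G).zero_mem
      (fun _ _ _ _ h1 h2 => (Sp G).add_mem h1 h2) hz

lemma Sp_diff {z : E → ℤ} (hz : z ∈ Sp G) : ∃ a ∈ G.C, ∃ b ∈ G.C, z + b = a := by
  refine Submodule.span_induction (p := fun z _ => ∃ a ∈ G.C, ∃ b ∈ G.C, z + b = a)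
    ?_ ?_ ?_ ?_ hz
  · intro m hm; exact ⟨m, PM.inC G hm, 0, G.C.zero_mem, by simp⟩
  · exact ⟨0, G.C.zero_mem, 0, G.C.zero_mem, by simp⟩
  · rintro x y _ _ ⟨a, ha, b, hb, h1⟩ ⟨a', ha', b', hb', h2⟩
    exact ⟨a + a', G.C.add_mem ha ha', b + b', G.C.add_mem hb hb', by rw [← h1, ← h2]; abel⟩
  · rintro n x _ ⟨a, ha, b, hb, h1⟩
    rcases Int.eq_nat_or_neg n with ⟨k, rfl | rfl⟩
    · exact ⟨k • a, nsmul_mem ha _, k • b, nsmul_mem hb _, by rw [← h1]; simp⟩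
    · exact ⟨k • b, nsmul_mem hb _, k • a, nsmul_mem ha _, by rw [← h1]; simp⟩

lemma Sp_le_Reg [Nonempty V] : Sp G ≤ Reg G := Submodule.span_le.2 fun m hm => PM.reg hm

lemma Ctx.torsion [Nonempty V] (hc : Ctx G x0 r0) {z : E → ℤ} (hz : z ∈ Reg G) :
    ∃ n : ℕ, 0 < n ∧ n • z ∈ Sp G := by
  obtain ⟨j, hj⟩ := hc.dominate z
  obtain ⟨n1, h1, h1'⟩ := hc.edmonds (inK_of_phi hc.ev
    ((Reg G).add_mem hz (nsmul_mem (reg_of hc.st) _)) (fun i => (hj j le_rfl i).le))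
  obtain ⟨n2, h2, h2'⟩ := hc.edmonds hc.inK
  refine ⟨n1 * n2, by positivity, ?_⟩
  have : (n1 * n2) • z = n2 • (n1 • (z + j • x0)) - (n1 * j) • (n2 • x0) := by
    funext e; simp; ring
  rw [this]
  exact (Sp G).sub_mem (nsmul_mem (C_le_Sp h1') _) (nsmul_mem (C_le_Sp h2') _)

lemma Ctx.torsion' [Nonempty V] (hc : Ctx G x0 r0) :
    ∃ n : ℕ, 0 < n ∧ ∀ z ∈ Reg G, n • z ∈ Sp G := by
  obtain ⟨S, hS⟩ : (Reg G).FG := IsNoetherian.noetherian _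
  have hmem : ∀ z : S, (z : E → ℤ) ∈ Reg G := fun z => by
    rw [← hS]; exact Submodule.subset_span z.2
  choose f hf hf' using fun z : S => hc.torsion (hmem z)
  refine ⟨∏ z, f z, Finset.prod_pos fun z _ => hf z, ?_⟩
  intro z hz
  rw [← hS] at hz
  refine Submodule.span_induction (p := fun z _ => (∏ z, f z) • z ∈ Sp G) ?_ ?_ ?_ ?_ hz
  · intro y hy
    obtain ⟨c, hc⟩ := Finset.dvd_prod_of_mem f (mem_univ (⟨y, hy⟩ : S))
    rw [hc, mul_comm, mul_smul]
    exact nsmul_mem (hf' ⟨y, hy⟩) _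
  · simp
  · intro x y _ _ h1 h2; rw [smul_add]; exact (Sp G).add_mem h1 h2
  · intro n x _ h; rw [smul_comm]; exact (Sp G).smul_mem _ h

lemma Ctx.exists_p [Nonempty V] (hc : Ctx G x0 r0) (hnd : ¬ G.Dy x0) :
    ∃ p : ℕ, p.Prime ∧ p ≠ 2 ∧ ∃ z ∈ Reg G, ∀ u ∈ Sp G, ∀ z' ∈ Reg G, z ≠ u + p • z' := by
  by_contra hcon
  push Not at hcon
  obtain ⟨N, hN, hNz⟩ := hc.torsion'
  obtain ⟨k, m, hm, hkm⟩ := Nat.exists_eq_two_pow_mul_odd hN.ne'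
  have key : ∀ m : ℕ, Odd m → ∀ z ∈ Reg G, ∃ u ∈ Sp G, ∃ z' ∈ Reg G, z = u + m • z' := by
    intro m
    induction m using Nat.recOnMul with
    | zero => intro h; exact absurd h (by decide)
    | one => intro _ z hz; exact ⟨0, (Sp G).zero_mem, z, hz, by simp⟩
    | prime p hp =>
      intro ho z hz
      exact hcon p hp (by rintro rfl; exact absurd ho (by decide)) z hz
    | mul a b iha ihb =>
      intro ho z hz
      obtain ⟨u, hu, z', hz', rfl⟩ := iha (Nat.odd_mul.1 ho).1 z hz
      obtain ⟨u', hu', z'', hz'', rfl⟩ := ihb (Nat.odd_mul.1 ho).2 z' hz'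
      exact ⟨u + a • u', (Sp G).add_mem hu (nsmul_mem hu' _), z'', hz'', by
        rw [smul_add, mul_smul, add_assoc]⟩
  obtain ⟨u, hu, z', hz', h⟩ := key m hm x0 (reg_of hc.st)
  have : (2 ^ k : ℕ) • x0 ∈ Sp G := by
    rw [h, smul_add, ← mul_smul, ← hkm]
    exact (Sp G).add_mem (nsmul_mem hu _) (hNz z' hz')
  obtain ⟨a, ha, b, hb, hab⟩ := Sp_diff this
  exact hnd (hc.density ha hb hab)

lemma Ctx.exists_w [Nonempty V] (hc : Ctx G x0 r0) (hnd : ¬ G.Dy x0) :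
    ∃ p : ℕ, p.Prime ∧ p ≠ 2 ∧ ∃ w : (E → ℤ) →+ ZMod p, (∀ m, G.PM m → w m = 0) ∧
      ∃ z ∈ Reg G, w z ≠ 0 := by
  obtain ⟨p, hp, hp2, z, hz, hzn⟩ := hc.exists_p hnd
  haveI := Fact.mk hp
  let cst : (E → ℤ) →+ (E → ZMod p) :=
    { toFun := fun z e => (z e : ZMod p)
      map_zero' := by funext e; simp
      map_add' := fun a b => by funext e; simp }
  let D : Submodule (ZMod p) (E → ZMod p) := Submodule.span _ (cst '' {m | G.PM m})
  have hlift : ∀ y ∈ D, ∃ u ∈ Sp G, cst u = y := by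
    intro y hy
    refine Submodule.span_induction (p := fun y _ => ∃ u ∈ Sp G, cst u = y) ?_ ?_ ?_ ?_ hy
    · rintro _ ⟨m, hm, rfl⟩; exact ⟨m, Submodule.subset_span hm, rfl⟩
    · exact ⟨0, (Sp G).zero_mem, map_zero _⟩
    · rintro x y _ _ ⟨a, ha, rfl⟩ ⟨b, hb, rfl⟩
      exact ⟨a + b, (Sp G).add_mem ha hb, map_add _ _ _⟩
    · rintro c x _ ⟨a, ha, rfl⟩
      obtain ⟨n, rfl⟩ := ZMod.intCast_surjective c
      refine ⟨n • a, (Sp G).smul_mem _ ha, ?_⟩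
      funext e
      change (((n • a) e : ℤ) : ZMod p) = (n : ZMod p) * ((a e : ℤ) : ZMod p)
      simp
  have hnot : cst z ∉ D := by
    intro h
    obtain ⟨u, hu, hu'⟩ := hlift _ h
    have : ∀ e, (p : ℤ) ∣ z e - u e := by
      intro e
      have h1 : ((u e : ℤ) : ZMod p) = ((z e : ℤ) : ZMod p) := congrFun hu' e
      rw [← ZMod.intCast_zmod_eq_zero_iff_dvd]
      push_cast; rw [h1, sub_self]
    choose z' hz' using this
    have heq : z = u + p • z' := by
      funext e; have := hz' e; simp; linarith
    refine hzn u hu z' ?_ heq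
    have h2 : (p : ℤ) • z' ∈ Reg G := by
      have : (p : ℤ) • z' = z - u := by rw [heq]; funext e; simp
      rw [this]; exact (Reg G).sub_mem hz (Sp_le_Reg hu)
    intro v
    have h3 := h2 v
    rw [cut_smul, map_zsmul, smul_eq_mul] at h3
    exact mul_left_cancel₀ (by exact_mod_cast hp.ne_zero) h3
  obtain ⟨f, hf, hf'⟩ := Submodule.exists_le_ker_of_notMem hnot
  refine ⟨p, hp, hp2, f.toAddMonoidHom.comp cst, ?_, z, hz, hf⟩
  intro m hm
  exact hf' (Submodule.subset_span ⟨m, hm, rfl⟩)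

end
end DG

set_option linter.unusedSectionVars false
set_option linter.unusedVariables false
set_option linter.style.longLine false
set_option linter.unnecessarySeqFocus false
namespace DG
section
variable {W ι : Type} [AddCommGroup W] [Fintype ι]

/-- argmax face -/
def IsTop (ψ : ι → W →+ ℚ) (f : W) (k : ι) : Prop := ∀ l, ψ l f ≤ ψ k f

lemma top_ne [Nonempty ι] (ψ : ι → W →+ ℚ) (f : W) : ∃ k, IsTop ψ f k := by
  obtain ⟨k, _, hk⟩ := exists_max_image univ (fun k => ψ k f) univ_nonempty
  exact ⟨k, fun l => hk l (mem_univ _)⟩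

lemma top_perturb (ψ : ι → W →+ ℚ) (f g : W) : ∃ N : ℕ, ∀ k,
    IsTop ψ (N • f + g) k ↔ (IsTop ψ f k ∧ ∀ l, IsTop ψ f l → ψ l g ≤ ψ k g) := by
  rcases isEmpty_or_nonempty ι with he | he
  · exact ⟨0, fun k => (IsEmpty.false k).elim⟩
  have h1 : ∀ q : ι × ι, ∃ N : ℕ, ψ q.1 f < ψ q.2 f →
      ψ q.1 g - ψ q.2 g < N * (ψ q.2 f - ψ q.1 f) := by
    intro q
    by_cases h : ψ q.1 f < ψ q.2 f
    · obtain ⟨N, hN⟩ := exists_nat_gt ((ψ q.1 g - ψ q.2 g) / (ψ q.2 f - ψ q.1 f))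
      refine ⟨N, fun _ => ?_⟩
      rwa [div_lt_iff₀ (by linarith)] at hN
    · exact ⟨0, fun h' => absurd h' h⟩
  choose n hn using h1
  set N := ∑ q, n q with hN
  have hle : ∀ q, n q ≤ N := fun q => single_le_sum (fun _ _ => Nat.zero_le _) (mem_univ q)
  have key : ∀ k l, ψ k f < ψ l f → ψ k (N • f + g) < ψ l (N • f + g) := by
    intro k l h
    have h2 := hn (k, l) h
    have h3 : (n (k, l) : ℚ) ≤ N := by exact_mod_cast hle (k, l)
    simp only [map_add, map_nsmul, nsmul_eq_mul]
    simp only at h2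
    nlinarith
  have val : ∀ k, ψ k (N • f + g) = N * ψ k f + ψ k g := by
    intro k; rw [map_add, map_nsmul, nsmul_eq_mul]
  refine ⟨N, fun k => ⟨fun h => ?_, ?_⟩⟩
  · have h4 : IsTop ψ f k := by
      intro l
      by_contra hcon
      exact absurd (key k l (not_le.1 hcon)) (not_lt.2 (h l))
    refine ⟨h4, fun l hl => ?_⟩
    have h5 := h l
    rw [val, val, le_antisymm (h4 l) (hl k)] at h5
    linarith
  · rintro ⟨h4, h5⟩ l
    by_cases hl : IsTop ψ f l
    · rw [val, val, le_antisymm (h4 l) (hl k)]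
      linarith [h5 l hl]
    · have : ψ l f < ψ k f := by
        by_contra hcon
        exact hl fun l' => (h4 l').trans (not_lt.1 hcon)
      exact (key l k this).le

lemma top_scale (ψ : ι → W →+ ℚ) (g g1 : W) (q : ℚ) :
    ∃ n : ℚ, 0 < n ∧ ∃ h : W, ∀ k, ψ k h = n * (ψ k g + q * ψ k g1) := by
  refine ⟨q.den, by exact_mod_cast q.den_pos, q.den • g + q.num • g1, fun k => ?_⟩
  rw [map_add, map_nsmul, map_zsmul, nsmul_eq_mul, zsmul_eq_mul]
  have : (q.num : ℚ) = q.den * q := by rw [mul_comm]; exact (Rat.mul_den_eq_num q).symm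
  rw [this]; ring

lemma ridge_q (ψ : ι → W →+ ℚ) (h0 : ∃ a b z, ψ a z ≠ ψ b z) :
    ∃ i j f fi fj, IsTop ψ f i ∧ IsTop ψ f j ∧ (∃ z, ψ i z ≠ ψ j z) ∧
      (∀ k, IsTop ψ f k → ∃ μ : ℚ, 0 ≤ μ ∧ μ ≤ 1 ∧ ∀ z, ψ k z = (1 - μ) * ψ i z + μ * ψ j z) ∧
      IsTop ψ fi i ∧ (∀ k, IsTop ψ fi k → ψ k = ψ i) ∧
      IsTop ψ fj j ∧ (∀ k, IsTop ψ fj k → ψ k = ψ j) := by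
  let two : W → Prop := fun f => ∃ a b z, IsTop ψ f a ∧ IsTop ψ f b ∧ ψ a z ≠ ψ b z
  have hex : ∃ n, ∃ f, two f ∧ (univ.filter fun k => IsTop ψ f k).card = n := by
    obtain ⟨a, b, z, h⟩ := h0
    exact ⟨_, 0, ⟨a, b, z, fun l => by simp, fun l => by simp, h⟩, rfl⟩
  obtain ⟨f, hf, hcard⟩ := Nat.find_spec hex
  have hmin : ∀ f', two f' → (univ.filter fun k => IsTop ψ f k).card ≤
      (univ.filter fun k => IsTop ψ f' k).card := by
    intro f' h'
    rw [hcard]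
    exact Nat.find_min' hex ⟨f', h', rfl⟩
  have P : ∀ g, (∀ a b, IsTop ψ f a → IsTop ψ f b → ψ a g = ψ b g) ∨
      (∃ f', (∀ k, IsTop ψ f' k ↔ (IsTop ψ f k ∧ ∀ l, IsTop ψ f l → ψ l g ≤ ψ k g)) ∧
        ∀ a b, IsTop ψ f' a → IsTop ψ f' b → ψ a = ψ b) := by
    intro g
    obtain ⟨N, hN⟩ := top_perturb ψ f g
    by_cases h2 : two (N • f + g)
    · left
      have hsub : (univ.filter fun k => IsTop ψ (N • f + g) k) ⊆
          (univ.filter fun k => IsTop ψ f k) := by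
        intro k; simp only [mem_filter, mem_univ, true_and]; exact fun h => ((hN k).1 h).1
      have heq := Finset.eq_of_subset_of_card_le hsub (hmin _ h2)
      have hall : ∀ k, IsTop ψ f k → IsTop ψ (N • f + g) k := by
        intro k hk
        have : k ∈ (univ.filter fun k => IsTop ψ f k) := by simpa using hk
        rw [← heq] at this
        simpa using this
      intro a b ha hb
      exact le_antisymm (((hN b).1 (hall b hb)).2 a ha) (((hN a).1 (hall a ha)).2 b hb)
    · right
      refine ⟨_, hN, fun a b ha hb => ?_⟩
      by_contra hcon
      apply h2
      obtain ⟨z, hz⟩ := DFunLike.exists_ne hcon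
      exact ⟨a, b, z, ha, hb, hz⟩
  obtain ⟨a1, b1, g1, ha1, hb1, hg1⟩ := hf
  have : Nonempty ι := ⟨a1⟩
  rcases P g1 with hcon | ⟨fi, hfi, hfi'⟩
  · exact absurd (hcon a1 b1 ha1 hb1) hg1
  rcases P (-g1) with hcon | ⟨fj, hfj, hfj'⟩
  · exact absurd (hcon a1 b1 ha1 hb1) (by simpa using hg1)
  obtain ⟨i, hi⟩ := top_ne ψ fi
  obtain ⟨j, hj⟩ := top_ne ψ fj
  have hiF := ((hfi i).1 hi).1
  have himax := ((hfi i).1 hi).2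
  have hjF := ((hfj j).1 hj).1
  have hjmin : ∀ l, IsTop ψ f l → ψ j g1 ≤ ψ l g1 := by
    intro l hl
    have := ((hfj j).1 hj).2 l hl
    simpa using this
  have hlt : ψ j g1 < ψ i g1 := by
    by_contra hcon
    apply hg1
    have := himax a1 ha1
    have := himax b1 hb1
    have := hjmin a1 ha1
    have := hjmin b1 hb1
    linarith
  have huniq : ∀ k, IsTop ψ f k → ψ k g1 = ψ i g1 → ψ k = ψ i := by
    intro k hk h
    exact hfi' k i ((hfi k).2 ⟨hk, fun l hl => by rw [h]; exact himax l hl⟩) hi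
  -- main claim
  have claim : ∀ g, ψ i g = ψ j g → ∀ c, IsTop ψ f c → ψ c g ≤ ψ i g := by
    intro g hg c hc
    by_contra hcon
    push Not at hcon
    have hne : (univ.filter fun x => IsTop ψ f x ∧ ψ x g1 < ψ i g1).Nonempty := by
      refine ⟨c, ?_⟩
      simp only [mem_filter, mem_univ, true_and]
      refine ⟨hc, lt_of_le_of_ne (himax c hc) fun h => ?_⟩
      rw [huniq c hc h] at hcon
      exact lt_irrefl _ hcon
    have hcmem : c ∈ (univ.filter fun x => IsTop ψ f x ∧ ψ x g1 < ψ i g1) := by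
      simp only [mem_filter, mem_univ, true_and]
      refine ⟨hc, lt_of_le_of_ne (himax c hc) fun h => ?_⟩
      rw [huniq c hc h] at hcon
      exact lt_irrefl _ hcon
    obtain ⟨x, hx, hxmax⟩ := exists_max_image _
      (fun x => (ψ x g - ψ i g) / (ψ i g1 - ψ x g1)) hne
    have hxc := hxmax c hcmem
    simp only [mem_filter, mem_univ, true_and] at hx hcmem hxmax
    set q := (ψ x g - ψ i g) / (ψ i g1 - ψ x g1) with hq
    have hqpos : 0 < q := lt_of_lt_of_le (div_pos (by linarith) (by linarith [hcmem.2])) hxc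
    obtain ⟨n, hn, h, hh⟩ := top_scale ψ g g1 q
    have hxeq : ψ x h = ψ i h := by
      rw [hh, hh]
      have : q * (ψ i g1 - ψ x g1) = ψ x g - ψ i g := by
        rw [hq]; exact div_mul_cancel₀ _ (by linarith [hx.2])
      linear_combination (-n) * this
    have hile : ∀ l, IsTop ψ f l → ψ l h ≤ ψ i h := by
      intro l hl
      rcases (himax l hl).eq_or_lt with h1 | h1
      · rw [huniq l hl h1]
      · have h2 := hxmax l ⟨hl, h1⟩
        rw [div_le_iff₀ (by linarith)] at h2
        rw [hh, hh]
        exact mul_le_mul_of_nonneg_left (by linarith) hn.le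
    rcases P h with hc1 | ⟨f', hf', hf''⟩
    · have h3 := hc1 i j hiF hjF
      rw [hh, hh, hg] at h3
      have h4 := mul_left_cancel₀ hn.ne' h3
      nlinarith
    · have h3 := hf'' x i ((hf' x).2 ⟨hx.1, fun l hl => by rw [hxeq]; exact hile l hl⟩)
        ((hf' i).2 ⟨hiF, hile⟩)
      have := hx.2
      rw [h3] at this
      exact lt_irrefl _ this
  have claim2 : ∀ g, ψ i g = ψ j g → ∀ c, IsTop ψ f c → ψ c g = ψ i g := by
    intro g hg c hc
    refine le_antisymm (claim g hg c hc) ?_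
    have := claim (-g) (by simpa using hg) c hc
    simpa using this
  refine ⟨i, j, f, fi, fj, hiF, hjF, ⟨g1, hlt.ne'⟩, ?_, hi, fun k hk => hfi' k i hk hi, hj,
    fun k hk => hfj' k j hk hj⟩
  intro c hc
  have hD : 0 < ψ i g1 - ψ j g1 := by linarith
  refine ⟨(ψ i g1 - ψ c g1) / (ψ i g1 - ψ j g1),
    div_nonneg (by linarith [himax c hc]) hD.le,
    (div_le_one hD).2 (by linarith [hjmin c hc]), fun z => ?_⟩
  obtain ⟨n, hn, h, hh⟩ := top_scale ψ z g1 (-(ψ i z - ψ j z) / (ψ i g1 - ψ j g1))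
  have h1 := claim2 h (by
    rw [hh, hh]; congr 1; field_simp; ring) c hc
  rw [hh, hh] at h1
  have h2 := mul_left_cancel₀ hn.ne' h1
  field_simp at h2 ⊢
  linarith

/-- integral ridge lemma -/
lemma ridge (φ : ι → W →+ ℤ) (x0 : W) (hx : ∀ i, 0 < φ i x0)
    (h0 : ∃ a b z, φ a x0 * φ b z ≠ φ b x0 * φ a z) :
    ∃ i j y yi yj, (∀ k, 0 ≤ φ k y) ∧ φ i y = 0 ∧ φ j y = 0 ∧
      (∃ z, φ i x0 * φ j z ≠ φ j x0 * φ i z) ∧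
      (∀ k, φ k y = 0 → ∃ α β : ℚ, 0 ≤ α ∧ 0 ≤ β ∧ ∀ z, (φ k z : ℚ) = α * φ i z + β * φ j z) ∧
      (∀ k, 0 ≤ φ k yi) ∧ φ i yi = 0 ∧ (∀ k, φ k yi = 0 → ∀ z, φ i x0 * φ k z = φ k x0 * φ i z) ∧
      (∀ k, 0 ≤ φ k yj) ∧ φ j yj = 0 ∧ (∀ k, φ k yj = 0 → ∀ z, φ j x0 * φ k z = φ k x0 * φ j z) := by
  let ψ : ι → W →+ ℚ := fun k =>
    { toFun := fun z => (φ k z : ℚ) / φ k x0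
      map_zero' := by simp
      map_add' := fun a b => by rw [map_add]; push_cast; rw [add_div] }
  have hψ : ∀ k z, ψ k z = (φ k z : ℚ) / φ k x0 := fun k z => rfl
  have hxq : ∀ k, (0 : ℚ) < φ k x0 := fun k => by exact_mod_cast hx k
  have heq : ∀ k l z, ψ k z = ψ l z ↔ φ k x0 * φ l z = φ l x0 * φ k z := by
    intro k l z
    rw [hψ, hψ, div_eq_div_iff (hxq k).ne' (hxq l).ne']
    constructor
    · intro h
      have : φ k z * φ l x0 = φ l z * φ k x0 := by exact_mod_cast h
      linarith
    · intro h
      have : φ k z * φ l x0 = φ l z * φ k x0 := by linarith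
      exact_mod_cast this
  obtain ⟨i, j, f, fi, fj, hi, hj, hne, hμ, hfi, hfi', hfj, hfj'⟩ := ridge_q ψ (by
    obtain ⟨a, b, z, h⟩ := h0
    exact ⟨a, b, z, fun h' => h ((heq a b z).1 h')⟩)
  -- the vector
  let Y : ι → W → W := fun i f => φ i f • x0 - φ i x0 • f
  have hY : ∀ k i f, (φ k (Y i f) : ℚ) = φ i x0 * φ k x0 * (ψ i f - ψ k f) := by
    intro k i f
    have h1 := hxq i
    have h2 := hxq k
    simp only [Y]
    rw [map_sub, map_zsmul, map_zsmul, hψ, hψ]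
    push_cast [smul_eq_mul]
    field_simp
  have hYn : ∀ i f, IsTop ψ f i → ∀ k, 0 ≤ φ k (Y i f) := by
    intro i f h k
    have : (0 : ℚ) ≤ φ k (Y i f) := by
      rw [hY]
      exact mul_nonneg (mul_pos (hxq i) (hxq k)).le (by linarith [h k])
    exact_mod_cast this
  have hY0 : ∀ i f, IsTop ψ f i → ∀ k, φ k (Y i f) = 0 → IsTop ψ f k := by
    intro i f h k h0 l
    have h1 := hY k i f
    rw [h0] at h1
    have h2 : ψ i f - ψ k f = 0 := by
      rcases mul_eq_zero.1 h1.symm with h3 | h3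
      · exact absurd h3 (mul_pos (hxq i) (hxq k)).ne'
      · exact h3
    have := h l
    linarith
  have hY1 : ∀ i f k, IsTop ψ f i → IsTop ψ f k → φ k (Y i f) = 0 := by
    intro i f k h1 h2
    have : (φ k (Y i f) : ℚ) = 0 := by
      rw [hY, le_antisymm (h1 k) (h2 i)]; ring
    exact_mod_cast this
  refine ⟨i, j, Y i f, Y i fi, Y j fj, hYn i f hi, hY1 _ _ _ hi hi, hY1 _ _ _ hi hj, ?_, ?_,
    hYn _ _ hfi, hY1 _ _ _ hfi hfi, ?_, hYn _ _ hfj, hY1 _ _ _ hfj hfj, ?_⟩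
  · obtain ⟨z, hz⟩ := hne
    exact ⟨z, fun h => hz ((heq i j z).2 h)⟩
  · intro k hk
    obtain ⟨μ, h1, h2, h3⟩ := hμ k (hY0 i f hi k hk)
    refine ⟨(1 - μ) * φ k x0 / φ i x0, μ * φ k x0 / φ j x0,
      div_nonneg (mul_nonneg (by linarith) (hxq k).le) (hxq i).le,
      div_nonneg (mul_nonneg (by linarith) (hxq k).le) (hxq j).le, fun z => ?_⟩
    have := h3 z
    rw [hψ, hψ, hψ] at this
    have h1 := hxq i
    have h2 := hxq k
    have h3 := hxq j
    field_simp at this ⊢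
    linarith
  · intro k hk z
    rw [← heq, hfi' k (hY0 i fi hfi k hk)]
  · intro k hk z
    rw [← heq, hfj' k (hY0 j fj hfj k hk)]
end
end DG

set_option linter.unusedSectionVars false
set_option linter.unusedVariables false
set_option linter.style.longLine false
set_option linter.unnecessarySeqFocus false
namespace DG
section
variable {V E : Type} [Fintype V] [Fintype E] {G : Gr V E} {x0 : E → ℤ} {r0 : ℤ}

/-- surplus of a cut -/
noncomputable def sur (G : Gr V E) [Nonempty V] (U : Finset V) : (E → ℤ) →+ ℤ where
  toFun z := G.cut z U - rr G z
  map_zero' := by simp [cut_zero]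
  map_add' := fun x y => by simp only [cut_add, map_add]; ring

lemma sur_def [Nonempty V] (U : Finset V) (z : E → ℤ) : sur G U z = G.cut z U - rr G z := rfl

lemma sur_compl [Nonempty V] (U : Finset V) : sur G Uᶜ = sur G U := by
  ext z; simp [sur_def, cut_compl]

lemma phi_inr' [Nonempty V] (U) : phi G (Sum.inr U) = sur G U.1 := rfl

lemma w_Dy {p : ℕ} (hp : p.Prime) (hp2 : p ≠ 2) {w : (E → ℤ) →+ ZMod p}
    (hw : ∀ m, G.PM m → w m = 0) {z : E → ℤ} (hz : G.Dy z) : w z = 0 := by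
  have := Fact.mk hp
  obtain ⟨k, hk⟩ := hz
  have h1 : w ((2 ^ k : ℕ) • z) = 0 :=
    AddSubmonoid.closure_le (S := AddMonoidHom.mker w).2 (fun m hm => hw m hm) hk
  rw [map_nsmul, nsmul_eq_mul] at h1
  rcases mul_eq_zero.1 h1 with h2 | h2
  · exfalso
    push_cast at h2
    have h4 : (2 : ZMod p) = 0 := by
      by_contra hcon
      exact pow_ne_zero k hcon h2
    have h5 : ((2 : ℕ) : ZMod p) = 0 := by exact_mod_cast h4
    rw [ZMod.natCast_eq_zero_iff] at h5
    exact hp2 ((Nat.prime_dvd_prime_iff_eq hp Nat.prime_two).1 h5)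
  · exact h2

/-- large multiples dominate wherever the functional is positive -/
lemma dominate2 [Nonempty V] (z y : E → ℤ) :
    ∃ N : ℕ, ∀ i, 0 < phi G i y → 0 < phi G i (z + N • y) := by
  refine ⟨∑ i, (phi G i z).natAbs + 1, fun i h2 => ?_⟩
  have h1 : (phi G i z).natAbs ≤ ∑ i, (phi G i z).natAbs :=
    single_le_sum (f := fun i => (phi G i z).natAbs) (fun _ _ => Nat.zero_le _) (mem_univ i)
  rw [map_add, map_nsmul, nsmul_eq_mul]
  set S := ∑ i, (phi G i z).natAbs
  have h3 : ((S + 1 : ℕ) : ℤ) ≤ ((S + 1 : ℕ) : ℤ) * phi G i y := by nlinarith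
  omega

lemma Ctx.facet [Nonempty V] (hc : Ctx G x0 r0) {p : ℕ} (hp : p.Prime) (hp2 : p ≠ 2)
    {w : (E → ℤ) →+ ZMod p} (hw : ∀ m, G.PM m → w m = 0) {yi : E → ℤ} (hyr : yi ∈ Reg G)
    (hn : ∀ k, 0 ≤ phi G k yi) (i) (hi : phi G i yi = 0)
    (hpr : ∀ k, phi G k yi = 0 → ∀ z ∈ Reg G, phi G i x0 * phi G k z = phi G k x0 * phi G i z)
    {z : E → ℤ} (hz : z ∈ Reg G) (hzi : phi G i z = 0) : w z = 0 := by
  obtain ⟨N, hN⟩ := dominate2 (G := G) z yi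
  have h1 : G.Dy (z + N • yi) := by
    refine hc.dy ((Reg G).add_mem hz (nsmul_mem hyr _)) (fun k => ?_) i ?_
    · rcases (hn k).eq_or_lt with h | h
      · have h2 := hpr k h.symm z hz
        rw [hzi, mul_zero] at h2
        rcases mul_eq_zero.1 h2 with h3 | h3
        · exact absurd h3 (hc.phi_pos i).ne'
        · rw [map_add, map_nsmul, ← h, h3]; simp
      · exact (hN k h).le
    · rw [map_add, map_nsmul, hi, hzi]; simp
  have h2 := w_Dy hp hp2 hw h1
  have h3 := w_Dy hp hp2 hw (hc.dy hyr hn i hi)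
  rw [map_add, map_nsmul, h3] at h2
  simpa using h2

lemma Ctx.noedge [Nonempty V] (hc : Ctx G x0 r0) {p : ℕ}
    {w : (E → ℤ) →+ ZMod p} (hw : ∀ m, G.PM m → w m = 0) (e : E)
    (h : ∀ z ∈ Reg G, z e = 0 → w z = 0) {z : E → ℤ} (hz : z ∈ Reg G) : w z = 0 := by
  obtain ⟨m, hm, hme⟩ := hc.edge_PM e
  have := h (z - z e • m) ((Reg G).sub_mem hz ((Reg G).smul_mem _ (PM.reg hm))) (by
    simp [hme])
  rw [map_sub, map_zsmul, hw m hm] at this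
  simpa using this

/-- the ridge data -/
structure Rdg (G : Gr V E) [Nonempty V] (x0 : E → ℤ) {p : ℕ} (w : (E → ℤ) →+ ZMod p)
    (A B : Finset V) (y yA yB : E → ℤ) : Prop where
  ntA : NT A
  ntB : NT B
  yreg : y ∈ Reg G
  yAreg : yA ∈ Reg G
  yBreg : yB ∈ Reg G
  ynn : ∀ k, 0 ≤ phi G k y
  yAnn : ∀ k, 0 ≤ phi G k yA
  yBnn : ∀ k, 0 ≤ phi G k yB
  rpos : 0 < rr G y
  yA0 : sur G A y = 0
  yB0 : sur G B y = 0
  np : ∃ z ∈ Reg G, sur G A x0 * sur G B z ≠ sur G B x0 * sur G A z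
  comb : ∀ k, phi G k y = 0 → ∃ α β : ℚ, 0 ≤ α ∧ 0 ≤ β ∧
    ∀ z ∈ Reg G, (phi G k z : ℚ) = α * sur G A z + β * sur G B z
  yAA : sur G A yA = 0
  yBB : sur G B yB = 0
  yAB : 0 < sur G B yA
  yBA : 0 < sur G A yB
  wA : ∀ z ∈ Reg G, sur G A z = 0 → w z = 0
  wB : ∀ z ∈ Reg G, sur G B z = 0 → w z = 0

lemma Rdg.symm [Nonempty V] {p : ℕ} {w : (E → ℤ) →+ ZMod p}
    {A B : Finset V} {y yA yB : E → ℤ} (h : Rdg G x0 w A B y yA yB) : Rdg G x0 w B A y yB yA where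
  ntA := h.ntB
  ntB := h.ntA
  yreg := h.yreg
  yAreg := h.yBreg
  yBreg := h.yAreg
  ynn := h.ynn
  yAnn := h.yBnn
  yBnn := h.yAnn
  rpos := h.rpos
  yA0 := h.yB0
  yB0 := h.yA0
  np := by obtain ⟨z, hz, h1⟩ := h.np; exact ⟨z, hz, fun h => h1 h.symm⟩
  comb := fun k hk => by
    obtain ⟨a, b, ha, hb, hab⟩ := h.comb k hk
    exact ⟨b, a, hb, ha, fun z hz => by rw [hab z hz, add_comm]⟩
  yAA := h.yBB
  yBB := h.yAA
  yAB := h.yBA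
  yBA := h.yAB
  wA := h.wB
  wB := h.wA

lemma Rdg.complB [Nonempty V] {p : ℕ} {w : (E → ℤ) →+ ZMod p} (hev : Even (Fintype.card V))
    {A B : Finset V} {y yA yB : E → ℤ} (h : Rdg G x0 w A B y yA yB) :
    Rdg G x0 w A Bᶜ y yA yB where
  ntA := h.ntA
  ntB := h.ntB.compl hev
  yreg := h.yreg
  yAreg := h.yAreg
  yBreg := h.yBreg
  ynn := h.ynn
  yAnn := h.yAnn
  yBnn := h.yBnn
  rpos := h.rpos
  yA0 := h.yA0
  yB0 := by rw [sur_compl]; exact h.yB0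
  np := by rw [sur_compl]; exact h.np
  comb := by rw [sur_compl]; exact h.comb
  yAA := h.yAA
  yBB := by rw [sur_compl]; exact h.yBB
  yAB := by rw [sur_compl]; exact h.yAB
  yBA := h.yBA
  wA := h.wA
  wB := by rw [sur_compl]; exact h.wB

lemma Ctx.exists_rdg [Nonempty V] (hc : Ctx G x0 r0) {p : ℕ} (hp : p.Prime) (hp2 : p ≠ 2)
    {w : (E → ℤ) →+ ZMod p} (hw : ∀ m, G.PM m → w m = 0) (hwn : ∃ z ∈ Reg G, w z ≠ 0) :
    ∃ A B y yA yB, Rdg G x0 w A B y yA yB := by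
  obtain ⟨z0, hz0, hwz0⟩ := hwn
  obtain ⟨M, hM, -⟩ := pm_exists G hc.inK hc.rpos
  -- an edge missed by M
  have hmiss : ∃ e, M e = 0 := by
    by_contra hcon
    push Not at hcon
    have h1 : ∀ e, 1 ≤ M e := fun e => by have := hM.nn e; have := hcon e; omega
    apply hc.nb
    refine ⟨fun v => ∃ e, G.s e = v, fun e => ⟨fun _ => ?_, fun _ => ⟨e, rfl⟩⟩⟩
    rintro ⟨e', he'⟩
    have hne : e' ≠ e := by
      rintro rfl
      exact G.ne _ he'
    have h2 := hM.st (G.t e)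
    have h3 : ∑ i ∈ {e', e}, M i * G.cr {G.t e} i ≤ ∑ i, M i * G.cr {G.t e} i :=
      sum_le_univ_sum_of_nonneg fun i => mul_nonneg (hM.nn i) (cr_nonneg G {G.t e} i)
    rw [sum_pair hne] at h3
    have h4 : G.cr {G.t e} e = 1 := by rw [cr_single]; simp [G.ne e]
    have h5 : G.cr {G.t e} e' = 1 := by
      rw [cr_single, he']; simp
      intro h; exact G.ne e' (by rw [he', h])
    rw [h4, h5] at h3
    have := h1 e
    have := h1 e'
    have h6 : G.cut M {G.t e} = ∑ i, M i * G.cr {G.t e} i := rfl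
    omega
  obtain ⟨e, he⟩ := hmiss
  let Tp : Ix V E → Prop := fun k => phi G k M = 0
  let φ : {k // Tp k} → Reg G →+ ℤ := fun k => (phi G k.1).comp (Reg G).subtype.toAddMonoidHom
  have hφ : ∀ k (z : Reg G), φ k z = phi G k.1 z.1 := fun _ _ => rfl
  have h0 : ∃ a b z, φ a ⟨x0, reg_of hc.st⟩ * φ b z ≠ φ b ⟨x0, reg_of hc.st⟩ * φ a z := by
    by_contra hcon
    push Not at hcon
    refine hwz0 (hc.noedge hw e (fun z hz hze => ?_) hz0)
    refine hc.facet hp hp2 hw (PM.reg hM) (PM.phi_nonneg hM) (Sum.inl e) he ?_ hz hze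
    intro k hk z hz
    exact hcon ⟨Sum.inl e, he⟩ ⟨k, hk⟩ ⟨z, hz⟩
  obtain ⟨i, j, y', yi', yj', hyn, hyi, hyj, hne, hcomb, hin, hii, hip, hjn, hjj, hjp⟩ :=
    ridge φ ⟨x0, reg_of hc.st⟩ (fun k => hc.phi_pos k.1) h0
  simp only [hφ] at hyn hyi hyj hne hcomb hin hii hip hjn hjj hjp
  have lift : ∀ u : Reg G, (∀ k : {k // Tp k}, 0 ≤ phi G k.1 u.1) →
      ∃ v ∈ Reg G, (∀ k, 0 ≤ phi G k v) ∧ (∀ k, Tp k → phi G k v = phi G k u.1) ∧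
        (∀ k, ¬ Tp k → 0 < phi G k v) ∧ 0 < rr G v := by
    intro u hu
    obtain ⟨N, hN⟩ := dominate2 (G := G) u.1 M
    set N' := N + (rr G u.1).natAbs + 1 with hN'
    have hpos : ∀ k, ¬ Tp k → 0 < phi G k (u.1 + N' • M) := by
      intro k hk
      have h1 : 0 < phi G k M := lt_of_le_of_ne (PM.phi_nonneg hM k) fun h => hk h.symm
      have h2 := hN k h1
      rw [map_add, map_nsmul, nsmul_eq_mul] at h2 ⊢
      rw [hN']; push_cast
      nlinarith [abs_nonneg (rr G u.1)]
    have heq : ∀ k, Tp k → phi G k (u.1 + N' • M) = phi G k u.1 := by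
      intro k hk
      have hk' : phi G k M = 0 := hk
      rw [map_add, map_nsmul, hk', smul_zero, add_zero]
    refine ⟨u.1 + N' • M, (Reg G).add_mem u.2 (nsmul_mem (PM.reg hM) _), fun k => ?_, heq, hpos, ?_⟩
    · by_cases hk : Tp k
      · rw [heq k hk]; exact hu ⟨k, hk⟩
      · exact (hpos k hk).le
    · rw [map_add, map_nsmul, rr_eq hM.st, nsmul_eq_mul, hN']
      push_cast
      have := neg_abs_le (rr G u.1)
      linarith
  obtain ⟨y, hyr, hy1, hy2, hy3, hy4⟩ := lift y' hyn
  obtain ⟨yi, hyir, hyi1, hyi2, hyi3, hyi4⟩ := lift yi' hin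
  obtain ⟨yj, hyjr, hyj1, hyj2, hyj3, hyj4⟩ := lift yj' hjn
  have fi : ∀ z ∈ Reg G, phi G i.1 z = 0 → w z = 0 := by
    intro z hz hzi
    refine hc.facet hp hp2 hw hyir hyi1 i.1 (by rw [hyi2 _ i.2, hii]) ?_ hz hzi
    intro k hk z hz
    by_cases hT : Tp k
    · exact hip ⟨k, hT⟩ (by rw [← hyi2 k hT, hk]) ⟨z, hz⟩
    · exact absurd hk (hyi3 k hT).ne'
  have fj : ∀ z ∈ Reg G, phi G j.1 z = 0 → w z = 0 := by
    intro z hz hzi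
    refine hc.facet hp hp2 hw hyjr hyj1 j.1 (by rw [hyj2 _ j.2, hjj]) ?_ hz hzi
    intro k hk z hz
    by_cases hT : Tp k
    · exact hjp ⟨k, hT⟩ (by rw [← hyj2 k hT, hk]) ⟨z, hz⟩
    · exact absurd hk (hyj3 k hT).ne'
  have hnp : phi G j.1 yi ≠ 0 := by
    intro h
    obtain ⟨z, hz⟩ := hne
    exact hz (hip j (by rw [← hyi2 _ j.2, h]) z)
  have hnp' : phi G i.1 yj ≠ 0 := by
    intro h
    obtain ⟨z, hz⟩ := hne
    exact hz (hjp i (by rw [← hyj2 _ i.2, h]) z).symm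
  have hcomb' : ∀ k, phi G k y = 0 → ∃ α β : ℚ, 0 ≤ α ∧ 0 ≤ β ∧
      ∀ z ∈ Reg G, (phi G k z : ℚ) = α * phi G i.1 z + β * phi G j.1 z := by
    intro k hk
    by_cases hT : Tp k
    · obtain ⟨α, β, h1, h2, h3⟩ := hcomb ⟨k, hT⟩ (by rw [← hy2 k hT, hk])
      exact ⟨α, β, h1, h2, fun z hz => h3 ⟨z, hz⟩⟩
    · exact absurd hk (hy3 k hT).ne'
  have hiy : phi G i.1 y = 0 := by rw [hy2 _ i.2, hyi]
  have hjy : phi G j.1 y = 0 := by rw [hy2 _ j.2, hyj]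
  have hiyi : phi G i.1 yi = 0 := by rw [hyi2 _ i.2, hii]
  have hjyj : phi G j.1 yj = 0 := by rw [hyj2 _ j.2, hjj]
  have hne' : ∃ z ∈ Reg G, phi G i.1 x0 * phi G j.1 z ≠ phi G j.1 x0 * phi G i.1 z := by
    obtain ⟨z, hz⟩ := hne
    exact ⟨z.1, z.2, hz⟩
  clear hip hjp hii hjj hyi hyj hne hcomb
  obtain ⟨i, hiT⟩ := i
  obtain ⟨j, hjT⟩ := j
  rcases i with ei | A
  · exact absurd (hc.noedge hw ei fi hz0) hwz0
  rcases j with ej | B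
  · exact absurd (hc.noedge hw ej fj hz0) hwz0
  exact ⟨A.1, B.1, y, yi, yj, A.2, B.2, hyr, hyir, hyjr, hy1, hyi1, hyj1, hy4, hiy, hjy, hne',
    hcomb', hiyi, hjyj, lt_of_le_of_ne (hyi1 (Sum.inr B)) hnp.symm, lt_of_le_of_ne (hyj1 (Sum.inr A)) hnp'.symm, fi, fj⟩

/-- the w-facts for a facet -/
lemma facet_dvd [Nonempty V] {p : ℕ} (hp : p.Prime) {w : (E → ℤ) →+ ZMod p}
    (hw : ∀ m, G.PM m → w m = 0) (hwn : ∃ z ∈ Reg G, w z ≠ 0) {A : Finset V}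
    (wA : ∀ z ∈ Reg G, sur G A z = 0 → w z = 0) {m : E → ℤ} (hm : G.PM m) :
    (p : ℤ) ∣ sur G A m := by
  have := Fact.mk hp
  obtain ⟨z0, hz0, hwz0⟩ := hwn
  have := wA (sur G A m • z0 - sur G A z0 • m)
    ((Reg G).sub_mem ((Reg G).smul_mem _ hz0) ((Reg G).smul_mem _ (PM.reg hm))) (by
      rw [map_sub, map_zsmul, map_zsmul, smul_eq_mul, smul_eq_mul]; ring)
  rw [map_sub, map_zsmul, map_zsmul, hw m hm, smul_zero, sub_zero, zsmul_eq_mul] at this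
  rcases mul_eq_zero.1 this with h | h
  · rwa [ZMod.intCast_zmod_eq_zero_iff_dvd] at h
  · exact absurd h hwz0

lemma facet_six [Nonempty V] {p : ℕ} (hp : p.Prime) (hp2 : p ≠ 2) {w : (E → ℤ) →+ ZMod p}
    (hw : ∀ m, G.PM m → w m = 0) (hwn : ∃ z ∈ Reg G, w z ≠ 0) {A : Finset V} (hA : NT A)
    (wA : ∀ z ∈ Reg G, sur G A z = 0 → w z = 0) {m : E → ℤ} (hm : G.PM m)
    (h0 : sur G A m ≠ 0) : 6 ≤ sur G A m := by
  have h1 := facet_dvd hp hw hwn wA hm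
  have h2 : 0 ≤ sur G A m := PM.phi_nonneg hm (Sum.inr ⟨A, hA⟩)
  obtain ⟨k, hk⟩ := cut_parity G hm.st A
  have h3 : (2 : ℤ) ∣ sur G A m := by
    rw [sur_def, rr_eq hm.st, hk]
    have : Odd (A.card : ℤ) := by exact_mod_cast hA.1
    obtain ⟨l, hl⟩ := this
    exact ⟨l - k, by rw [hl]; ring⟩
  have h4 : IsCoprime (2 : ℤ) p := by
    have : Nat.Coprime 2 p := (Nat.coprime_primes Nat.prime_two hp).2 hp2.symm
    exact_mod_cast Nat.isCoprime_iff_coprime.2 this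
  obtain ⟨c, hc⟩ := h4.mul_dvd h3 h1
  have h5 : 3 ≤ p := by
    have := hp.two_le
    omega
  have h6 : (3 : ℤ) ≤ p := by exact_mod_cast h5
  have h7 : 0 < c := by
    by_contra hcon
    push Not at hcon
    have : sur G A m ≤ 0 := by rw [hc]; nlinarith
    omega
  nlinarith

lemma facet_prop [Nonempty V] {p : ℕ} {w : (E → ℤ) →+ ZMod p} {A : Finset V}
    (wA : ∀ z ∈ Reg G, sur G A z = 0 → w z = 0) {z z' : E → ℤ} (hz : z ∈ Reg G) (hz' : z' ∈ Reg G) :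
    (sur G A z' : ZMod p) * w z = sur G A z * w z' := by
  have := wA (sur G A z' • z - sur G A z • z')
    ((Reg G).sub_mem ((Reg G).smul_mem _ hz) ((Reg G).smul_mem _ hz')) (by
      rw [map_sub, map_zsmul, map_zsmul, smul_eq_mul, smul_eq_mul]; ring)
  rw [map_sub, map_zsmul, map_zsmul, zsmul_eq_mul, zsmul_eq_mul] at this
  exact sub_eq_zero.1 this
end
end DG

set_option linter.unusedSectionVars false
set_option linter.unusedVariables false
set_option linter.style.longLine false
set_option linter.unnecessarySeqFocus false
namespace DG
section
variable {V E : Type} [Fintype V] [Fintype E] {G : Gr V E} {x0 : E → ℤ} {r0 : ℤ}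

lemma cr_ind (U : Finset V) (e : E) :
    G.cr U e = if (G.s e ∈ U ↔ G.t e ∈ U) then 0 else 1 := by
  unfold Gr.cr; split_ifs <;> rfl

lemma Ctx.conn_aux (hc : Ctx G x0 r0) (C : Finset V) (hC : C.Nonempty) (hC' : Cᶜ.Nonempty)
    (hev : Even C.card) (hcl : ∀ e, G.s e ∈ C ↔ G.t e ∈ C) : C.card = 2 := by
  obtain ⟨v, hv⟩ := hC
  have hcut : G.cut x0 (C.erase v) = G.cut x0 {v} := by
    unfold Gr.cut
    refine sum_congr rfl fun e _ => ?_
    congr 1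
    have h1 := hcl e
    have h2 := G.ne e
    rw [cr_ind, cr_ind]
    simp only [mem_erase, mem_singleton]
    grind
  have hcard := Finset.card_erase_of_mem hv
  have hpos : 0 < C.card := card_pos.2 ⟨v, hv⟩
  by_contra hne
  have : NT (C.erase v) := by
    refine ⟨by grind, by grind, ?_⟩
    obtain ⟨u, hu⟩ := hC'
    rw [mem_compl] at hu
    rw [Finset.one_lt_card]
    refine ⟨v, by simp, u, by simp [hu], ?_⟩
    rintro rfl; exact hu hv
  have := hc.od _ this
  rw [hcut, hc.st] at this
  omega

lemma Ctx.conn (hc : Ctx G x0 r0) (C : Finset V) (hC : C.Nonempty)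
    (hcl : ∀ e, G.s e ∈ C ↔ G.t e ∈ C) : C = univ := by
  by_contra hne
  have hC' : Cᶜ.Nonempty := by
    rw [nonempty_iff_ne_empty]; intro h; exact hne ((compl_eq_empty_iff _).1 h)
  have hcut : G.cut x0 C = 0 := by
    unfold Gr.cut
    refine sum_eq_zero fun e _ => ?_
    rw [cr_ind, if_pos (hcl e), mul_zero]
  rcases Nat.even_or_odd C.card with hev | hod
  · have hcc := Finset.card_add_card_compl C
    have hV := hc.ev
    have h1 := hc.conn_aux C hC hC' hev hcl
    have h2 := hc.conn_aux Cᶜ hC' (by simpa using hC) (by grind) (fun e => by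
      simp only [mem_compl, not_iff_not]; exact hcl e)
    obtain ⟨a, b, hab, h3⟩ := card_eq_two.1 h1
    obtain ⟨c, d, hcd, h4⟩ := card_eq_two.1 h2
    apply hc.nb
    refine ⟨fun v => v = a ∨ v = c, fun e => ?_⟩
    have h5 := hcl e
    have h6 := G.ne e
    have ha : ∀ v, v ∈ C ↔ v = a ∨ v = b := fun v => by rw [h3]; simp
    have hb : ∀ v, v ∉ C ↔ v = c ∨ v = d := fun v => by rw [← mem_compl, h4]; simp
    have := ha (G.s e)
    have := ha (G.t e)
    have := hb (G.s e)
    have := hb (G.t e)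
    have := (ha a).2 (Or.inl rfl)
    have := (ha b).2 (Or.inr rfl)
    have := (hb c).2 (Or.inl rfl)
    have := (hb d).2 (Or.inr rfl)
    grind
  · have := hc.inK.od C hod
    have := hc.rpos
    omega

/-- half-unit stars -/
lemma Ctx.halfunit (hc : Ctx G x0 r0) (v0 : V) :
    ∃ c : E → ℤ, ∀ u, G.cut c {u} = if u = v0 then 2 else 0 := by
  let H : (V → ℤ) → Prop := fun d => ∃ c : E → ℤ, ∀ u, G.cut c {u} = d u
  have hsub : ∀ d d', H d → H d' → H (fun u => d u - d' u) := by
    rintro d d' ⟨c, h⟩ ⟨c', h'⟩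
    exact ⟨c - c', fun u => by rw [cut_sub, h, h']⟩
  have hedge : ∀ e, H (fun u => (if u = G.s e then 1 else 0) + (if u = G.t e then 1 else 0)) := by
    intro e
    refine ⟨Pi.single e 1, fun u => ?_⟩
    unfold Gr.cut
    rw [sum_eq_single e]
    · rw [Pi.single_eq_same, one_mul, cr_single]
      simp only [eq_comm]
    · intro b _ hb; simp [hb]
    · simp
  let Sp : V → Prop := fun v => H (fun u => (if u = v then 1 else 0) - (if u = v0 then 1 else 0))
  let Sm : V → Prop := fun v => H (fun u => (if u = v then 1 else 0) + (if u = v0 then 1 else 0))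
  have e1 : ∀ e, Sp (G.s e) → Sm (G.t e) := by
    intro e h
    obtain ⟨c, hc⟩ := hsub _ _ (hedge e) h
    exact ⟨c, fun u => by rw [hc]; ring⟩
  have e2 : ∀ e, Sp (G.t e) → Sm (G.s e) := by
    intro e h
    obtain ⟨c, hc⟩ := hsub _ _ (hedge e) h
    exact ⟨c, fun u => by rw [hc]; ring⟩
  have e3 : ∀ e, Sm (G.s e) → Sp (G.t e) := by
    intro e h
    obtain ⟨c, hc⟩ := hsub _ _ (hedge e) h
    exact ⟨c, fun u => by rw [hc]; ring⟩
  have e4 : ∀ e, Sm (G.t e) → Sp (G.s e) := by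
    intro e h
    obtain ⟨c, hc⟩ := hsub _ _ (hedge e) h
    exact ⟨c, fun u => by rw [hc]; ring⟩
  have hall : ∀ v, Sp v ∨ Sm v := by
    have h := hc.conn (univ.filter fun v => Sp v ∨ Sm v) ⟨v0, by
      simp only [mem_filter, mem_univ, true_and]
      left; exact ⟨0, fun u => by rw [cut_zero]; simp⟩⟩ (fun e => by
      simp only [mem_filter, mem_univ, true_and]
      exact ⟨fun h => h.elim (fun h => Or.inr (e1 e h)) (fun h => Or.inl (e3 e h)),
        fun h => h.elim (fun h => Or.inr (e2 e h)) (fun h => Or.inl (e4 e h))⟩)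
    intro v
    have : v ∈ (univ.filter fun v => Sp v ∨ Sm v) := by rw [h]; simp
    simpa using this
  have : ∃ v, Sp v ∧ Sm v := by
    by_contra hcon
    push Not at hcon
    apply hc.nb
    refine ⟨Sp, fun e => ⟨fun h h' => hcon _ h' (e1 e h), fun h => ?_⟩⟩
    exact e4 e ((hall _).resolve_left h)
  obtain ⟨v, h1, h2⟩ := this
  obtain ⟨c, hc⟩ := hsub _ _ h2 h1
  exact ⟨c, fun u => by rw [hc]; beta_reduce; split_ifs <;> norm_num⟩

lemma Ctx.potential (hc : Ctx G x0 r0) {F : Type} [Field F] (h2 : (2 : F) ≠ 0) (f : E → F)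
    (hf : ∀ z : E → ℤ, (∀ v, G.cut z {v} = 0) → ∑ e, f e * (z e : F) = 0) :
    ∃ π : V → F, ∀ e, f e = π (G.s e) + π (G.t e) := by
  choose c hcc using hc.halfunit
  refine ⟨fun v => (∑ e, f e * (c v e : F)) / 2, fun e => ?_⟩
  have h := hf (2 • Pi.single e 1 - c (G.s e) - c (G.t e)) (fun v => by
    rw [cut_sub, cut_sub, cut_nsmul, hcc, hcc]
    have : G.cut (Pi.single e 1) {v} = G.cr {v} e := by
      unfold Gr.cut
      rw [sum_eq_single e]
      · rw [Pi.single_eq_same, one_mul]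
      · intro b _ hb; simp [hb]
      · simp
    rw [this, cr_single]
    simp only [eq_comm (a := v)]
    split_ifs <;> norm_num)
  have h3 : ∑ e', f e' * (((2 • Pi.single e 1 - c (G.s e) - c (G.t e) : E → ℤ) e' : ℤ) : F)
      = 2 * f e - ∑ e', f e' * (c (G.s e) e' : F) - ∑ e', f e' * (c (G.t e) e' : F) := by
    have h4 : 2 * f e = ∑ e', f e' * (((2 • Pi.single e 1 : E → ℤ) e' : ℤ) : F) := by
      rw [sum_eq_single e]
      · simp; ring
      · intro b _ hb; simp [hb]
      · simp
    rw [h4, ← sum_sub_distrib, ← sum_sub_distrib]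
    refine sum_congr rfl fun e' _ => ?_
    simp only [Pi.sub_apply]
    push_cast; ring
  rw [h3] at h
  field_simp
  linear_combination h

/-- tight sets at an everywhere positive vector are connected -/
lemma Ctx.tight_conn (hc : Ctx G x0 r0) {y : E → ℤ} {r : ℤ} (hK : G.InK y r)
    (hpos : ∀ e, 0 < y e) {U : Finset V} (hU : NT U) (ht : G.cut y U = r)
    (C : Finset V) (hCU : C ⊆ U) (hC : C.Nonempty)
    (hcl : ∀ e, G.s e ∈ U → G.t e ∈ U → (G.s e ∈ C ↔ G.t e ∈ C)) : C = U := by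
  by_contra hne
  have hD : (U \ C).Nonempty := by
    rw [sdiff_nonempty]; intro h; exact hne (subset_antisymm hCU h)
  have hsum : G.cut y U = G.cut y C + G.cut y (U \ C) := by
    unfold Gr.cut
    rw [← sum_add_distrib]
    refine sum_congr rfl fun e _ => ?_
    rw [← mul_add]
    congr 1
    have h1 := hcl e
    have h2 := @hCU (G.s e)
    have h3 := @hCU (G.t e)
    rw [cr_ind, cr_ind, cr_ind]
    simp only [mem_sdiff]
    split_ifs <;> grind
  have hcard : C.card + (U \ C).card = U.card := by
    rw [card_sdiff_of_subset hCU]; have := card_le_card hCU; omega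
  have hUne : ∃ u, u ∉ U := by
    have := hU.2.2
    obtain ⟨u, hu⟩ := card_pos.1 (show 0 < Uᶜ.card by omega)
    exact ⟨u, mem_compl.1 hu⟩
  obtain ⟨u, hu⟩ := hUne
  have key : ∀ D : Finset V, D ⊆ U → D.Nonempty → G.cut y D ≤ 0 → False := by
    intro D hDU hDn h0
    have h1 : G.cut y D = 0 := le_antisymm h0 (cut_nonneg G hK.nn D)
    have h2 := (sum_eq_zero_iff_of_nonneg (s := univ)
      (fun i _ => mul_nonneg (hK.nn i) (cr_nonneg G D i))).1 h1
    have h3 := hc.conn D hDn (fun e => by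
      have := h2 e (mem_univ e)
      rw [cr_ind] at this
      by_contra hcon
      rw [if_neg hcon] at this
      have := hpos e
      omega)
    have : u ∈ D := by rw [h3]; simp
    exact hu (hDU this)
  have hUo := hU.1
  rcases Nat.even_or_odd C.card with h | h
  · have h1 := hK.od (U \ C) (by grind)
    exact key C hCU hC (by omega)
  · have h1 := hK.od C h
    exact key (U \ C) sdiff_subset hD (by omega)

lemma Ctx.tight_nonbip (hc : Ctx G x0 r0) {y : E → ℤ} {r : ℤ} (hK : G.InK y r) (hr : 0 < r)
    (hpos : ∀ e, 0 < y e) {U : Finset V} (hU : NT U) (ht : G.cut y U = r) (c : V → Prop)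
    (hcol : ∀ e, G.s e ∈ U → G.t e ∈ U → (c (G.s e) ↔ ¬ c (G.t e))) : False := by
  let ρ : V → ℤ := fun v => if v ∈ U then (if c v then 1 else -1) else 0
  have hub : ∀ e, ρ (G.s e) + ρ (G.t e) ≤ G.cr U e ∧ -G.cr U e ≤ ρ (G.s e) + ρ (G.t e) := by
    intro e
    have h1 := hcol e
    rw [cr_ind]
    simp only [ρ]
    split_ifs <;> grind
  have hp := pair_reg G hK.st ρ
  have hodd : Odd (∑ v, ρ v) := by
    have : ∑ v, ρ v = ∑ v, (if v ∈ U then (1 : ℤ) else 0) -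
        2 * ∑ v, (if v ∈ U ∧ ¬ c v then (1 : ℤ) else 0) := by
      rw [mul_sum, ← sum_sub_distrib]
      refine sum_congr rfl fun v _ => ?_
      simp only [ρ]
      split_ifs <;> grind
    rw [this]
    have h2 : ∑ v, (if v ∈ U then (1 : ℤ) else 0) = U.card := by simp
    rw [h2]
    have : Odd (U.card : ℤ) := by exact_mod_cast hU.1
    exact this.sub_even (even_two_mul _)
  simp only [Int.cast_id] at hp
  have hcutU : ∑ e, y e * G.cr U e = r := ht
  have h1 : r * ∑ v, ρ v ≤ r := by
    rw [hp]; conv_rhs => rw [← hcutU]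
    exact sum_le_sum fun e _ => mul_le_mul_of_nonneg_left (hub e).1 (hK.nn e)
  have h2 : -r ≤ r * ∑ v, ρ v := by
    rw [hp, ← hcutU, ← sum_neg_distrib]
    exact sum_le_sum fun e _ => by
      have := mul_le_mul_of_nonneg_left (hub e).2 (hK.nn e); linarith
  have h3 : ∑ v, ρ v = 1 ∨ ∑ v, ρ v = -1 := by
    have : ∑ v, ρ v ≤ 1 := by nlinarith
    have : -1 ≤ ∑ v, ρ v := by nlinarith
    grind
  have hp0 := pair_reg G hc.st ρ
  simp only [Int.cast_id] at hp0
  have hx := hc.od U hU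
  have hx' : G.cut x0 U = ∑ e, x0 e * G.cr U e := rfl
  rcases h3 with h3 | h3
  · have h4 : ∑ e, y e * (G.cr U e - (ρ (G.s e) + ρ (G.t e))) = 0 := by
      simp only [mul_sub, sum_sub_distrib]
      rw [hcutU, ← hp, h3]; ring
    have h5 := (sum_eq_zero_iff_of_nonneg (s := univ)
      (fun i _ => mul_nonneg (hK.nn i) (by linarith [(hub i).1]))).1 h4
    have h6 : ∀ e, ρ (G.s e) + ρ (G.t e) = G.cr U e := by
      intro e
      rcases mul_eq_zero.1 (h5 e (mem_univ e)) with h | h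
      · exact absurd h (hpos e).ne'
      · linarith
    simp only [h6] at hp0
    rw [h3] at hp0
    linarith
  · have h4 : ∑ e, y e * (G.cr U e + (ρ (G.s e) + ρ (G.t e))) = 0 := by
      simp only [mul_add, sum_add_distrib]
      simp only [mul_add, sum_add_distrib] at hp
      rw [hcutU, ← hp, h3]; ring
    have h5 := (sum_eq_zero_iff_of_nonneg (s := univ)
      (fun i _ => mul_nonneg (hK.nn i) (by linarith [(hub i).2]))).1 h4
    have h6 : ∀ e, ρ (G.s e) + ρ (G.t e) = -G.cr U e := by
      intro e
      rcases mul_eq_zero.1 (h5 e (mem_univ e)) with h | h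
      · exact absurd h (hpos e).ne'
      · linarith
    simp only [h6, mul_neg, sum_neg_distrib] at hp0
    rw [h3] at hp0
    linarith

lemma Ctx.tight_zero (hc : Ctx G x0 r0) {y : E → ℤ} {r : ℤ} (hK : G.InK y r) (hr : 0 < r)
    (hpos : ∀ e, 0 < y e) {U : Finset V} (hU : NT U) (ht : G.cut y U = r)
    {F : Type} [Field F] (h2 : (2 : F) ≠ 0) (π : V → F)
    (hπ : ∀ e, G.s e ∈ U → G.t e ∈ U → π (G.s e) + π (G.t e) = 0) : ∀ u ∈ U, π u = 0 := by
  intro u hu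
  by_contra hne
  have h1 := hc.tight_conn hK hpos hU ht (U.filter fun v => π v = π u ∨ π v = - π u)
    (filter_subset _ _) ⟨u, by simp [hu]⟩ (fun e hs ht => by
      have := hπ e hs ht
      simp only [mem_filter, hs, ht, true_and]
      constructor
      · rintro (h | h)
        · right; linear_combination this - h
        · left; linear_combination this - h
      · rintro (h | h)
        · right; linear_combination this - h
        · left; linear_combination this - h)
  refine hc.tight_nonbip hK hr hpos hU ht (fun v => π v = π u) (fun e hs ht => ?_)
  have h3 := hπ e hs ht
  have h4 : π (G.t e) = π u ∨ π (G.t e) = - π u := by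
    have : G.t e ∈ U.filter fun v => π v = π u ∨ π v = - π u := by rw [h1]; exact ht
    exact (mem_filter.1 this).2
  constructor
  · intro h h'
    apply hne
    rw [h, h'] at h3
    have : 2 * π u = 0 := by linear_combination h3
    exact (mul_eq_zero.1 this).resolve_left h2
  · intro h
    have := h4.resolve_left h
    linear_combination h3 - this
end
end DG

set_option linter.unusedSectionVars false
set_option linter.unusedVariables false
set_option linter.style.longLine false
set_option linter.unnecessarySeqFocus false
namespace DG
section
variable {V E : Type} [Fintype V] [Fintype E] {G : Gr V E} {x0 : E → ℤ} {r0 : ℤ}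

lemma two_ne {p : ℕ} (hp : p.Prime) (hp2 : p ≠ 2) : (2 : ZMod p) ≠ 0 := by
  intro h4
  have h5 : ((2 : ℕ) : ZMod p) = 0 := by exact_mod_cast h4
  rw [ZMod.natCast_eq_zero_iff] at h5
  exact hp2 ((Nat.prime_dvd_prime_iff_eq hp Nat.prime_two).1 h5)

lemma sum_cr_cast {R : Type} [CommRing R] (U : Finset V) (z : E → ℤ) :
    ∑ e, (G.cr U e : R) * (z e : R) = (G.cut z U : R) := by
  unfold Gr.cut; push_cast
  exact sum_congr rfl fun e _ => mul_comm _ _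

lemma Rdg.hK [Nonempty V] (hc : Ctx G x0 r0) {p : ℕ} {w : (E → ℤ) →+ ZMod p}
    {A B : Finset V} {y yA yB : E → ℤ} (R : Rdg G x0 w A B y yA yB) : G.InK y (rr G y) :=
  inK_of_phi hc.ev R.yreg R.ynn

lemma Rdg.tA [Nonempty V] {p : ℕ} {w : (E → ℤ) →+ ZMod p}
    {A B : Finset V} {y yA yB : E → ℤ} (R : Rdg G x0 w A B y yA yB) : G.cut y A = rr G y := by
  have := R.yA0; rw [sur_def] at this; linarith

/-- some vector has nonzero surplus mod p -/
lemma Rdg.nonzero [Nonempty V] (hc : Ctx G x0 r0) {p : ℕ} (hp : p.Prime) (hp2 : p ≠ 2)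
    {w : (E → ℤ) →+ ZMod p} {A B : Finset V} {y yA yB : E → ℤ} (R : Rdg G x0 w A B y yA yB)
    (hpos : ∀ e, 0 < y e) : ∃ z ∈ Reg G, (sur G A z : ZMod p) ≠ 0 := by
  have := Fact.mk hp
  by_contra hcon
  push Not at hcon
  obtain ⟨π, hπ⟩ := hc.potential (two_ne hp hp2) (fun e => (G.cr A e : ZMod p)) (fun z hz => by
    rw [sum_cr_cast]
    have := hcon z (reg_of hz)
    rw [sur_def, rr_eq hz, sub_zero] at this
    exact this)
  have h1 := hc.tight_zero (R.hK hc) R.rpos hpos R.ntA R.tA (two_ne hp hp2) π (fun e hs ht => by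
    rw [← hπ, cr_ind]; simp [hs, ht])
  have h2 := hc.tight_zero (R.hK hc) R.rpos hpos (R.ntA.compl hc.ev)
    (by rw [cut_compl]; exact R.tA) (two_ne hp hp2) π (fun e hs ht => by
    rw [mem_compl] at hs ht
    rw [← hπ, cr_ind]; simp [hs, ht])
  have h3 : ∀ v, π v = 0 := by
    intro v
    by_cases hv : v ∈ A
    · exact h1 v hv
    · exact h2 v (by simpa using hv)
  have h4 : ∀ e, G.cr A e = 0 := by
    intro e
    rcases cr_eq G A e with h | h
    · exact h
    · have := hπ e
      rw [h, h3, h3] at this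
      simp at this
  have h5 : G.cut y A = 0 := by unfold Gr.cut; simp [h4]
  have := R.tA
  have := R.rpos
  omega

lemma Rdg.pot [Nonempty V] (hc : Ctx G x0 r0) {p : ℕ} (hp : p.Prime) (hp2 : p ≠ 2)
    {w : (E → ℤ) →+ ZMod p} (hwn : ∃ z ∈ Reg G, w z ≠ 0)
    {A B : Finset V} {y yA yB : E → ℤ} (R : Rdg G x0 w A B y yA yB)
    (hpos : ∀ e, 0 < y e) : ∃ c : ZMod p, c ≠ 0 ∧ ∃ π : V → ZMod p,
      ∀ e, (G.cr A e : ZMod p) - c * G.cr B e = π (G.s e) + π (G.t e) := by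
  have := Fact.mk hp
  obtain ⟨z', hz', hw'⟩ := hwn
  obtain ⟨z1, hz1, h1⟩ := R.nonzero hc hp hp2 hpos
  obtain ⟨z2, hz2, h2⟩ := R.symm.nonzero hc hp hp2 hpos
  have ha : (sur G A z' : ZMod p) ≠ 0 := by
    intro h
    have := facet_prop R.wA hz1 hz'
    rw [h, zero_mul] at this
    exact mul_ne_zero h1 hw' this.symm
  have hb : (sur G B z' : ZMod p) ≠ 0 := by
    intro h
    have := facet_prop R.wB hz2 hz'
    rw [h, zero_mul] at this
    exact mul_ne_zero h2 hw' this.symm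
  refine ⟨(sur G A z' : ZMod p) / sur G B z', div_ne_zero ha hb, ?_⟩
  apply hc.potential (two_ne hp hp2)
  intro z hz
  have h3 := facet_prop R.wA (reg_of hz) hz'
  have h4 := facet_prop R.wB (reg_of hz) hz'
  have hA : (sur G A z : ZMod p) = G.cut z A := by rw [sur_def, rr_eq hz, sub_zero]
  have hB : (sur G B z : ZMod p) = G.cut z B := by rw [sur_def, rr_eq hz, sub_zero]
  have h5 : ∑ e, ((G.cr A e : ZMod p) - (sur G A z' : ZMod p) / sur G B z' * G.cr B e) * (z e : ZMod p)
      = G.cut z A - (sur G A z' : ZMod p) / sur G B z' * G.cut z B := by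
    rw [← sum_cr_cast A z, ← sum_cr_cast B z, mul_sum, ← sum_sub_distrib]
    exact sum_congr rfl fun e _ => by ring
  rw [h5, ← hA, ← hB]
  have h6 : ((sur G A z : ZMod p) * sur G B z' - sur G A z' * sur G B z) * w z' = 0 := by
    linear_combination (sur G A z' : ZMod p) * h4 - (sur G B z' : ZMod p) * h3
  have h7 := (mul_eq_zero.1 h6).resolve_right hw'
  field_simp
  linear_combination h7

lemma Rdg.unc [Nonempty V] (hc : Ctx G x0 r0) {p : ℕ}
    {w : (E → ℤ) →+ ZMod p} {A B : Finset V} {y yA yB : E → ℤ} (R : Rdg G x0 w A B y yA yB)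
    (hpos : ∀ e, 0 < y e) (hodd : Odd (A ∩ B).card) :
    Odd (A ∪ B)ᶜ.card ∧ G.cut y (A ∩ B) = rr G y ∧ G.cut y (A ∪ B)ᶜ = rr G y ∧
    (∀ e, ¬ (G.s e ∈ A ∧ G.s e ∉ B ∧ G.t e ∉ A ∧ G.t e ∈ B)) ∧
    (∀ e, ¬ (G.t e ∈ A ∧ G.t e ∉ B ∧ G.s e ∉ A ∧ G.s e ∈ B)) ∧
    (∀ z, sur G A z + sur G B z = sur G (A ∩ B) z + sur G (A ∪ B)ᶜ z) := by
  have hOodd : Odd (A ∪ B)ᶜ.card := by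
    have h1 := card_union_add_card_inter A B
    have h2 := card_add_card_compl (A ∪ B)
    have := hc.ev
    have := R.ntA.1
    have := R.ntB.1
    grind
  let q : E → ℤ := fun e => if (G.s e ∈ A ∧ G.s e ∉ B ∧ G.t e ∉ A ∧ G.t e ∈ B) ∨
    (G.t e ∈ A ∧ G.t e ∉ B ∧ G.s e ∉ A ∧ G.s e ∈ B) then 2 else 0
  have hq : ∀ e, 0 ≤ q e := fun e => by simp only [q]; split_ifs <;> simp
  have hcr : ∀ e, G.cr A e + G.cr B e = G.cr (A ∩ B) e + G.cr (A ∪ B)ᶜ e + q e := by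
    intro e
    simp only [cr_ind, q, mem_inter, mem_compl, mem_union]
    by_cases h1 : G.s e ∈ A <;> by_cases h2 : G.s e ∈ B <;> by_cases h3 : G.t e ∈ A <;>
      by_cases h4 : G.t e ∈ B <;> simp [h1, h2, h3, h4]
  have hcut : ∀ z, G.cut z A + G.cut z B = G.cut z (A ∩ B) + G.cut z (A ∪ B)ᶜ + ∑ e, z e * q e := by
    intro z
    unfold Gr.cut
    rw [← sum_add_distrib, ← sum_add_distrib, ← sum_add_distrib]
    refine sum_congr rfl fun e _ => ?_
    rw [← mul_add, hcr]; ring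
  have h1 := hcut y
  rw [R.tA, R.symm.tA] at h1
  have h2 := (R.hK hc).od _ hodd
  have h3 := (R.hK hc).od _ hOodd
  have h4 : 0 ≤ ∑ e, y e * q e := sum_nonneg fun e _ => mul_nonneg (hpos e).le (hq e)
  have h5 : ∑ e, y e * q e = 0 := by linarith
  have h6 := (sum_eq_zero_iff_of_nonneg (s := univ)
      (fun i _ => mul_nonneg (hpos i).le (hq i))).1 h5
  have h7 : ∀ e, q e = 0 := fun e =>
    (mul_eq_zero.1 (h6 e (mem_univ e))).resolve_left (hpos e).ne'
  refine ⟨hOodd, by linarith, by linarith, fun e h => ?_, fun e h => ?_, fun z => ?_⟩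
  · have := h7 e
    simp only [q] at this
    rw [if_pos (Or.inl h)] at this
    omega
  · have := h7 e
    simp only [q] at this
    rw [if_pos (Or.inr h)] at this
    omega
  · have := hcut z
    simp only [h7, mul_zero, sum_const_zero] at this
    simp only [sur_def]
    linarith

lemma NT_sub {U X : Finset V} (hX : NT X) (hUX : U ⊆ X) (ho : Odd U.card) (h1 : U.card ≠ 1) :
    NT U := by
  refine ⟨ho, by have := ho.pos; omega, ?_⟩
  have : Xᶜ ⊆ Uᶜ := compl_subset_compl.2 hUX
  exact lt_of_lt_of_le hX.2.2 (card_le_card this)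

lemma Rdg.caseJ [Nonempty V] (hc : Ctx G x0 r0) {p : ℕ} (hp : p.Prime) (hp2 : p ≠ 2)
    {w : (E → ℤ) →+ ZMod p} (hwn : ∃ z ∈ Reg G, w z ≠ 0)
    {A B : Finset V} {y yA yB : E → ℤ} (R : Rdg G x0 w A B y yA yB)
    (hpos : ∀ e, 0 < y e) (hodd : Odd (A ∩ B).card) (hI : (A ∩ B).card ≠ 1)
    (hO : (A ∪ B)ᶜ.card = 1) (hJ : ¬ A ⊆ B) : False := by
  have := Fact.mk hp
  obtain ⟨hOo, htI, htO, hJK, hKJ, -⟩ := R.unc hc hpos hodd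
  obtain ⟨c, hc0, π, hπ⟩ := R.pot hc hp hp2 hwn hpos
  have hIz := hc.tight_zero (R.hK hc) R.rpos hpos (NT_sub R.ntA inter_subset_left hodd hI)
    htI (two_ne hp hp2) π (fun e hs ht => by
      rw [mem_inter] at hs ht
      rw [← hπ, cr_ind, cr_ind]; simp [hs, ht])
  obtain ⟨o, ho⟩ := card_eq_one.1 hO
  have hom : ∀ v, (v ∉ A ∧ v ∉ B) ↔ v = o := by
    intro v
    have : v ∈ (A ∪ B)ᶜ ↔ v = o := by rw [ho]; simp
    rw [← this]; simp
  have hJz := hc.tight_zero (R.hK hc) R.rpos hpos (R.ntB.compl hc.ev)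
    (by rw [cut_compl]; exact R.symm.tA) (two_ne hp hp2) (Function.update π o (π o - 1))
    (fun e hs ht => by
      rw [mem_compl] at hs ht
      have h1 := hπ e
      have h2 := G.ne e
      have h3 := hom (G.s e)
      have h4 := hom (G.t e)
      rw [cr_ind, cr_ind] at h1
      simp only [Function.update_apply]
      by_cases ha : G.s e ∈ A <;> by_cases hb : G.t e ∈ A
      · have : G.s e ≠ o := fun h => (h3.2 h).1 ha
        have : G.t e ≠ o := fun h => (h4.2 h).1 hb
        simp_all
      · have : G.s e ≠ o := fun h => (h3.2 h).1 ha
        have : G.t e = o := h4.1 ⟨hb, ht⟩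
        simp_all
      · have : G.t e ≠ o := fun h => (h4.2 h).1 hb
        have : G.s e = o := h3.1 ⟨ha, hs⟩
        simp_all
      · exact absurd ((h3.1 ⟨ha, hs⟩).trans (h4.1 ⟨hb, ht⟩).symm) h2)
  have hJz' : ∀ v ∈ A, v ∉ B → π v = 0 := by
    intro v hv hv'
    have h1 := hJz v (by simpa using hv')
    have : v ≠ o := fun h => ((hom v).2 h).1 hv
    rwa [Function.update_of_ne this] at h1
  have hAz : ∀ v ∈ A, π v = 0 := by
    intro v hv
    by_cases hb : v ∈ B
    · exact hIz v (by simp [hv, hb])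
    · exact hJz' v hv hb
  have h1 := hc.tight_conn (R.hK hc) hpos R.ntA R.tA (A ∩ B) inter_subset_left
    (card_pos.1 hodd.pos) (fun e hs ht => by
      have h1 := hπ e
      rw [hAz _ hs, hAz _ ht, cr_ind, cr_ind] at h1
      by_contra hcon
      have h3 : ¬ (G.s e ∈ B ↔ G.t e ∈ B) := by simpa [hs, ht] using hcon
      simp [hs, ht, h3] at h1
      exact hc0 h1)
  exact hJ (fun v hv => by rw [← h1] at hv; exact (mem_inter.1 hv).2)

lemma Rdg.caseO [Nonempty V] (hc : Ctx G x0 r0) {p : ℕ} (hp : p.Prime) (hp2 : p ≠ 2)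
    {w : (E → ℤ) →+ ZMod p} (hwn : ∃ z ∈ Reg G, w z ≠ 0)
    {A B : Finset V} {y yA yB : E → ℤ} (R : Rdg G x0 w A B y yA yB)
    (hpos : ∀ e, 0 < y e) (hodd : Odd (A ∩ B).card)
    (hO : (A ∪ B)ᶜ.card = 1) : False := by
  obtain ⟨hOo, htI, htO, hJK, hKJ, hsum⟩ := R.unc hc hpos hodd
  by_cases hI : (A ∩ B).card = 1
  · obtain ⟨o, ho⟩ := card_eq_one.1 hO
    obtain ⟨i, hi⟩ := card_eq_one.1 hI
    have h1 := hsum x0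
    rw [ho, hi] at h1
    have h2 : sur G A x0 + sur G B x0 = 0 := by
      rw [h1, sur_def, sur_def, hc.st, hc.st, rr_eq hc.st]; ring
    have h3 : 0 < sur G A x0 := hc.phi_pos (Sum.inr ⟨A, R.ntA⟩)
    have h4 : 0 < sur G B x0 := hc.phi_pos (Sum.inr ⟨B, R.ntB⟩)
    omega
  · by_cases hJ : A ⊆ B
    · by_cases hK : B ⊆ A
      · obtain ⟨z, hz, hne⟩ := R.np
        rw [subset_antisymm hJ hK] at hne
        exact hne rfl
      · refine R.symm.caseJ hc hp hp2 hwn hpos ?_ ?_ ?_ hK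
        · rwa [inter_comm]
        · rwa [inter_comm]
        · rwa [union_comm]
    · exact R.caseJ hc hp hp2 hwn hpos hodd hI hO hJ

lemma sign_lift {F : Type} [Field F] {p : ℕ} (h3 : 3 ≤ p) {w : ℤ} (h1 : (p : ℤ) ∣ w) (h2 : |w| ≤ 2) : w = 0 := by
  apply Int.eq_zero_of_abs_lt_dvd h1
  have : (3 : ℤ) ≤ p := by exact_mod_cast h3
  omega

lemma Rdg.vals [Nonempty V] (hc : Ctx G x0 r0) {p : ℕ} (hp : p.Prime)
    {w : (E → ℤ) →+ ZMod p}
    {A B : Finset V} {y yA yB : E → ℤ} (R : Rdg G x0 w A B y yA yB)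
    (hpos : ∀ e, 0 < y e) (hodd : Odd (A ∩ B).card) {κ : ZMod p} {π : V → ZMod p}
    (hI : ∀ v, v ∈ A → v ∈ B → π v = 0)
    (h1 : ∀ e, G.s e ∈ A → G.t e ∈ A → π (G.s e) + π (G.t e) = if (G.s e ∈ B ↔ G.t e ∈ B) then 0 else κ) :
    ∀ v ∈ A, v ∉ B → π v = κ ∨ π v = -κ := by
  have := Fact.mk hp
  have h2 := hc.tight_conn (R.hK hc) hpos R.ntA R.tA
    (A.filter fun v => v ∈ B ∨ (π v = κ ∨ π v = -κ)) (filter_subset _ _)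
    (by
      obtain ⟨v, hv⟩ := card_pos.1 hodd.pos
      rw [mem_inter] at hv
      exact ⟨v, by simp [hv]⟩)
    (fun e hs ht => by
      have h3 := h1 e hs ht
      have h4 := hI (G.s e) hs
      have h5 := hI (G.t e) ht
      simp only [mem_filter, hs, ht, true_and]
      by_cases hsB : G.s e ∈ B <;> by_cases htB : G.t e ∈ B
      · simp [hsB, htB]
      · simp only [hsB, htB, true_or, false_or, true_iff]
        left
        rw [h4 hsB] at h3
        simpa [hsB, htB] using h3
      · simp only [hsB, htB, true_or, false_or, iff_true]
        left
        rw [h5 htB] at h3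
        simpa [hsB, htB] using h3
      · simp only [hsB, htB, false_or]
        simp only [hsB, htB, iff_true, if_true] at h3
        constructor
        · rintro (h | h)
          · right; linear_combination h3 - h
          · left; linear_combination h3 - h
        · rintro (h | h)
          · right; linear_combination h3 - h
          · left; linear_combination h3 - h)
  intro v hv hvB
  rw [← h2, mem_filter] at hv
  exact hv.2.resolve_left hvB

lemma Rdg.caseBoth [Nonempty V] (hc : Ctx G x0 r0) {p : ℕ} (hp : p.Prime) (hp2 : p ≠ 2)
    {w : (E → ℤ) →+ ZMod p} (hwn : ∃ z ∈ Reg G, w z ≠ 0)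
    {A B : Finset V} {y yA yB : E → ℤ} (R : Rdg G x0 w A B y yA yB)
    (hpos : ∀ e, 0 < y e) (hodd : Odd (A ∩ B).card) (hI : (A ∩ B).card ≠ 1)
    (hO : (A ∪ B)ᶜ.card ≠ 1) : False := by
  have := Fact.mk hp
  have hev := hc.ev
  obtain ⟨hOo, htI, htO, hJK, hKJ, -⟩ := R.unc hc hpos hodd
  obtain ⟨c, hc0, π, hπ⟩ := R.pot hc hp hp2 hwn hpos
  have hOo' : (A ∪ B)ᶜ = Aᶜ ∩ Bᶜ := by ext v; simp
  have RA : Rdg G x0 w Aᶜ B y yA yB := (R.symm.complB hev).symm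
  have RAB : Rdg G x0 w Aᶜ Bᶜ y yA yB := RA.complB hev
  have hIz' := hc.tight_zero (R.hK hc) R.rpos hpos (NT_sub R.ntA inter_subset_left hodd hI)
    htI (two_ne hp hp2) π (fun e hs ht => by
      rw [mem_inter] at hs ht
      rw [← hπ, cr_ind, cr_ind]; simp [hs, ht])
  have hIz : ∀ v, v ∈ A → v ∈ B → π v = 0 := fun v h1 h2 => hIz' v (by simp [h1, h2])
  have hOz' := hc.tight_zero (R.hK hc) R.rpos hpos (NT_sub RA.ntA (by rw [hOo']; exact inter_subset_left) hOo hO)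
    htO (two_ne hp hp2) π (fun e hs ht => by
      rw [mem_compl, mem_union] at hs ht
      push Not at hs ht
      rw [← hπ, cr_ind, cr_ind]; simp [hs, ht])
  have hOz : ∀ v, v ∉ A → v ∉ B → π v = 0 := fun v h1 h2 => hOz' v (by simp [h1, h2])
  have hJc : ∀ v ∈ A, v ∉ B → π v = c ∨ π v = -c := by
    intro v hv hvB
    have := R.vals hc hp hpos hodd (κ := -c) hIz (fun e hs ht => by
      rw [← hπ, cr_ind, cr_ind]; by_cases h : (G.s e ∈ B ↔ G.t e ∈ B) <;> simp [hs, ht, h]) v hv hvB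
    rw [neg_neg] at this
    exact this.symm
  have hK1 : ∀ v ∈ B, v ∉ A → π v = 1 ∨ π v = -1 :=
    R.symm.vals hc hp hpos (by rwa [inter_comm]) (κ := 1) (fun v h1 h2 => hIz v h2 h1) (fun e hs ht => by
      rw [← hπ, cr_ind, cr_ind]; by_cases h : (G.s e ∈ A ↔ G.t e ∈ A) <;> simp [hs, ht, h])
  have hodd' : Odd (Aᶜ ∩ Bᶜ).card := by rwa [← hOo']
  have hKc : ∀ v ∈ B, v ∉ A → π v = c ∨ π v = -c := by
    intro v hvB hv
    have := RAB.vals hc hp hpos hodd' (κ := -c) (fun v h1 h2 => hOz v (by simpa using h1) (by simpa using h2)) (fun e hs ht => by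
      rw [mem_compl] at hs ht
      rw [← hπ, cr_ind, cr_ind]
      simp only [mem_compl, not_iff_not]
      by_cases h : (G.s e ∈ B ↔ G.t e ∈ B) <;> simp [hs, ht, h]) v (by simpa using hv) (by simpa using hvB)
    rw [neg_neg] at this
    exact this.symm
  have hJ1 : ∀ v ∈ A, v ∉ B → π v = 1 ∨ π v = -1 := by
    intro v hv hvB
    exact RAB.symm.vals hc hp hpos (by rwa [inter_comm]) (κ := 1) (fun v h1 h2 => hOz v (by simpa using h2) (by simpa using h1)) (fun e hs ht => by
      rw [mem_compl] at hs ht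
      rw [← hπ, cr_ind, cr_ind]
      simp only [mem_compl, not_iff_not]
      by_cases h : (G.s e ∈ A ↔ G.t e ∈ A) <;> simp [hs, ht, h]) v (by simpa using hvB) (by simpa using hv)
  have hcc : c = 1 ∨ c = -1 := by
    have aux : ∀ x : ZMod p, (x = c ∨ x = -c) → (x = 1 ∨ x = -1) → (c = 1 ∨ c = -1) := by
      rintro x (h | h) (h' | h')
      · left; rw [← h, h']
      · right; rw [← h, h']
      · right; rw [← h', h, neg_neg]
      · left; rw [h] at h'; exact neg_injective h'
    by_cases hJ : A ⊆ B
    · by_cases hK : B ⊆ A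
      · obtain ⟨z, hz, hne⟩ := R.np
        rw [subset_antisymm hJ hK] at hne
        exact absurd rfl hne
      · obtain ⟨v, h1, h2⟩ := not_subset.1 hK
        exact aux _ (hKc v h1 h2) (hK1 v h1 h2)
    · obtain ⟨v, h1, h2⟩ := not_subset.1 hJ
      exact aux _ (hJc v h1 h2) (hJ1 v h1 h2)
  obtain ⟨c', hc', hcast⟩ : ∃ c' : ℤ, (c' = 1 ∨ c' = -1) ∧ (c' : ZMod p) = c := by
    rcases hcc with h | h
    · exact ⟨1, Or.inl rfl, by simp [h]⟩
    · exact ⟨-1, Or.inr rfl, by simp [h]⟩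
  have hρ : ∀ v, ∃ ρ : ℤ, (ρ : ZMod p) = π v ∧ (-1 ≤ ρ ∧ ρ ≤ 1) ∧ ((v ∈ A ↔ v ∈ B) → ρ = 0) := by
    intro v
    have aux : (π v = 1 ∨ π v = -1) → ∃ ρ : ℤ, (ρ : ZMod p) = π v ∧ (-1 ≤ ρ ∧ ρ ≤ 1) := by
      rintro (h | h)
      · exact ⟨1, by simp [h], by norm_num⟩
      · exact ⟨-1, by simp [h], by norm_num⟩
    by_cases hA : v ∈ A <;> by_cases hB : v ∈ B
    · exact ⟨0, by simp [hIz v hA hB], by norm_num, fun _ => rfl⟩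
    · obtain ⟨ρ, h1, h2⟩ := aux (hJ1 v hA hB)
      exact ⟨ρ, h1, h2, fun h => absurd (h.1 hA) hB⟩
    · obtain ⟨ρ, h1, h2⟩ := aux (hK1 v hB hA)
      exact ⟨ρ, h1, h2, fun h => absurd (h.2 hB) hA⟩
    · exact ⟨0, by simp [hOz v hA hB], by norm_num, fun _ => rfl⟩
  choose ρ hρc hρb hρ0 using hρ
  have h3p : 3 ≤ p := by have := hp.two_le; omega
  have hedge : ∀ e, G.cr A e - c' * G.cr B e = ρ (G.s e) + ρ (G.t e) := by
    intro e
    have h1 : (p : ℤ) ∣ G.cr A e - c' * G.cr B e - (ρ (G.s e) + ρ (G.t e)) := by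
      rw [← ZMod.intCast_zmod_eq_zero_iff_dvd]
      push_cast
      rw [hρc, hρc, hcast, hπ, sub_self]
    have h2 : |G.cr A e - c' * G.cr B e - (ρ (G.s e) + ρ (G.t e))| ≤ 2 := by
      have a1 := hJK e
      have a2 := hKJ e
      have b1 := hρb (G.s e)
      have b2 := hρb (G.t e)
      have d1 := hρ0 (G.s e)
      have d2 := hρ0 (G.t e)
      rw [cr_ind, cr_ind, abs_le]
      by_cases h1 : G.s e ∈ A <;> by_cases h2 : G.s e ∈ B <;> by_cases h3 : G.t e ∈ A <;>
        by_cases h4 : G.t e ∈ B <;> simp [h1, h2, h3, h4] at a1 a2 d1 d2 ⊢ <;> omega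
    have := sign_lift (F := ℚ) h3p h1 h2
    linarith
  have hz : ∀ z ∈ Reg G, sur G A z - c' * sur G B z = rr G z * (∑ v, ρ v - 1 + c') := by
    intro z hz
    have h1 := pair_reg G hz ρ
    simp only [Int.cast_id] at h1
    have h2 : G.cut z A - c' * G.cut z B = ∑ e, z e * (ρ (G.s e) + ρ (G.t e)) := by
      unfold Gr.cut
      rw [mul_sum, ← sum_sub_distrib]
      refine sum_congr rfl fun e _ => ?_
      rw [← hedge]; ring
    rw [sur_def, sur_def]
    linear_combination h2 - h1
  have h4 : ∑ v, ρ v - 1 + c' = 0 := by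
    have := hz y R.yreg
    rw [R.yA0, R.yB0] at this
    have h5 : rr G y * (∑ v, ρ v - 1 + c') = 0 := by rw [← this]; ring
    exact (mul_eq_zero.1 h5).resolve_left R.rpos.ne'
  have h5 : ∀ z ∈ Reg G, sur G A z = c' * sur G B z := by
    intro z h
    have := hz z h
    rw [h4, mul_zero] at this
    linarith
  rcases hc' with h | h
  · obtain ⟨z, hz, hne⟩ := R.np
    apply hne
    rw [h5 z hz, h5 x0 (reg_of hc.st), h]
    ring
  · have h3 : 0 < sur G A x0 := hc.phi_pos (Sum.inr ⟨A, R.ntA⟩)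
    have h4 : 0 < sur G B x0 := hc.phi_pos (Sum.inr ⟨B, R.ntB⟩)
    have := h5 x0 (reg_of hc.st)
    rw [h] at this
    omega

lemma Rdg.case_pos [Nonempty V] (hc : Ctx G x0 r0) {p : ℕ} (hp : p.Prime) (hp2 : p ≠ 2)
    {w : (E → ℤ) →+ ZMod p} (hwn : ∃ z ∈ Reg G, w z ≠ 0)
    {A B : Finset V} {y yA yB : E → ℤ} (R : Rdg G x0 w A B y yA yB)
    (hpos : ∀ e, 0 < y e) : False := by
  have hev := hc.ev
  have main : ∀ B, Rdg G x0 w A B y yA yB → Odd (A ∩ B).card → False := by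
    intro B R hodd
    by_cases hO : (A ∪ B)ᶜ.card = 1
    · exact R.caseO hc hp hp2 hwn hpos hodd hO
    by_cases hI : (A ∩ B).card = 1
    · have R' : Rdg G x0 w Aᶜ Bᶜ y yA yB := ((R.symm.complB hev).symm).complB hev
      refine R'.caseO hc hp hp2 hwn hpos ?_ ?_
      · rw [← compl_union]; exact (R.unc hc hpos hodd).1
      · rw [← compl_inter, compl_compl]; exact hI
    · exact R.caseBoth hc hp hp2 hwn hpos hodd hI hO
  rcases Nat.even_or_odd (A ∩ B).card with h | h
  · refine main Bᶜ (R.complB hev) ?_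
    have h1 := card_inter_add_card_sdiff A B
    have : A ∩ Bᶜ = A \ B := by ext v; simp
    rw [this]
    have := R.ntA.1
    grind
  · exact main B R h
end
end DG

set_option linter.unusedSectionVars false
set_option linter.unusedVariables false
set_option linter.style.longLine false
set_option linter.unnecessarySeqFocus false
namespace DG
section
variable {V E : Type} [Fintype V] [Fintype E] {G : Gr V E} {x0 : E → ℤ} {r0 : ℤ}

lemma exists_PM_sur [Nonempty V] (hc : Ctx G x0 r0) {A B : Finset V} (hA : NT A) (hB : NT B)
    {yA : E → ℤ} (hr : yA ∈ Reg G) (hn : ∀ k, 0 ≤ phi G k yA) (hA0 : sur G A yA = 0)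
    (hB0 : 0 < sur G B yA) : ∃ m, G.PM m ∧ sur G A m = 0 ∧ 0 < sur G B m := by
  obtain ⟨k, hk⟩ := hc.dy hr hn (Sum.inr ⟨A, hA⟩) hA0
  obtain ⟨L, hL, hsum⟩ := (C_iff G).1 hk
  have h1 : (L.map (sur G A)).sum = 0 := by
    rw [← map_multiset_sum, hsum, map_nsmul, hA0, smul_zero]
  have h2 : (L.map (sur G B)).sum ≠ 0 := by
    rw [← map_multiset_sum, hsum, map_nsmul]
    exact (nsmul_pos hB0 (by positivity)).ne'
  have h3 : ∀ m ∈ L, sur G A m = 0 := by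
    intro m hm
    have hnn : ∀ x ∈ L.map (sur G A), 0 ≤ x := by
      intro x hx
      obtain ⟨m', hm', rfl⟩ := Multiset.mem_map.1 hx
      exact PM.phi_nonneg (hL m' hm') (Sum.inr ⟨A, hA⟩)
    exact Multiset.all_zero_of_le_zero_le_of_sum_eq_zero hnn h1 _ (Multiset.mem_map_of_mem _ hm)
  by_contra hcon
  push Not at hcon
  apply h2
  apply Multiset.sum_eq_zero
  intro x hx
  obtain ⟨m, hm, rfl⟩ := Multiset.mem_map.1 hx
  exact le_antisymm (hcon m (hL m hm) (h3 m hm)) (PM.phi_nonneg (hL m hm) (Sum.inr ⟨B, hB⟩))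

/-- uniform coefficient -/
lemma Rdg.coefB [Nonempty V] (hc : Ctx G x0 r0) {p : ℕ} (hp : p.Prime) (hp2 : p ≠ 2)
    {w : (E → ℤ) →+ ZMod p} (hw : ∀ m, G.PM m → w m = 0) (hwn : ∃ z ∈ Reg G, w z ≠ 0)
    {A B : Finset V} {y yA yB : E → ℤ} (R : Rdg G x0 w A B y yA yB) :
    ∃ β0 : ℚ, 0 < β0 ∧ β0 ≤ 1 / 6 ∧ ∀ f : E, ∀ α β : ℚ, 
      (∀ z ∈ Reg G, (z f : ℚ) = α * sur G A z + β * sur G B z) → β = β0 := by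
  obtain ⟨m, hm, hmA, hmB⟩ := exists_PM_sur hc R.ntA R.ntB R.yAreg R.yAnn R.yAA R.yAB
  have h6 := facet_six hp hp2 hw hwn R.ntB R.wB hm hmB.ne'
  have h6' : (6 : ℚ) ≤ sur G B m := by exact_mod_cast h6
  refine ⟨1 / sur G B m, by positivity, one_div_le_one_div_of_le (by norm_num) h6', ?_⟩
  intro f α β hz
  have h1 := hz m (PM.reg hm)
  rw [hmA] at h1
  have hne : β ≠ 0 := by
    rintro rfl
    obtain ⟨z0, hz0, hw0⟩ := hwn
    refine hw0 (hc.noedge hw f (fun z hz' hzf => R.wA z hz' ?_) hz0)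
    have hα : α ≠ 0 := by
      rintro rfl
      have := hz x0 (reg_of hc.st)
      simp at this
      exact (hc.pos f).ne' this
    have h2 := hz z hz'
    rw [hzf] at h2
    simp at h2
    exact h2.resolve_left hα
  have h0 := hm.nn f
  have h01 := PM.le_one hm f
  have h3 : m f = 0 ∨ m f = 1 := by omega
  rcases h3 with h3 | h3
  · rw [h3] at h1
    simp at h1
    rcases h1 with h1 | h1
    · exact absurd h1 hne
    · omega
  · rw [h3] at h1
    rw [eq_div_iff (by linarith)]
    push_cast at h1
    linarith

lemma Rdg.coef [Nonempty V] (hc : Ctx G x0 r0) {p : ℕ} (hp : p.Prime) (hp2 : p ≠ 2)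
    {w : (E → ℤ) →+ ZMod p} (hw : ∀ m, G.PM m → w m = 0) (hwn : ∃ z ∈ Reg G, w z ≠ 0)
    {A B : Finset V} {y yA yB : E → ℤ} (R : Rdg G x0 w A B y yA yB) :
    ∃ α β : ℚ, 0 < α ∧ α ≤ 1 / 6 ∧ 0 < β ∧ β ≤ 1 / 6 ∧
      ∀ f, y f = 0 → ∀ z ∈ Reg G, (z f : ℚ) = α * sur G A z + β * sur G B z := by
  obtain ⟨β, hb1, hb2, hb⟩ := R.coefB hc hp hp2 hw hwn
  obtain ⟨α, ha1, ha2, ha⟩ := R.symm.coefB hc hp hp2 hw hwn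
  refine ⟨α, β, ha1, ha2, hb1, hb2, fun f hf => ?_⟩
  obtain ⟨a, b, h1, h2, h3⟩ := R.comb (Sum.inl f) hf
  have h4 := hb f a b h3
  have h5 := ha f b a (fun z hz => by rw [add_comm]; exact h3 z hz)
  subst h4 h5
  exact h3

lemma sum_nu (P N : Finset V) :
    ∑ v, ((if v ∈ N then (1 : ℤ) else 0) - (if v ∈ P then 1 else 0)) = N.card - P.card := by
  simp

lemma Ctx.C1 (hc : Ctx G x0 r0) {P N : Finset V} (hd : ∀ v ∈ P, v ∉ N)
    (hE : ∀ f, (G.s f ∈ P → G.t f ∈ N) ∧ (G.t f ∈ P → G.s f ∈ N)) (hP : P.Nonempty) :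
    P.card < N.card := by
  let ν : V → ℤ := fun v => (if v ∈ N then (1 : ℤ) else 0) - (if v ∈ P then 1 else 0)
  have hν : ∀ f, 0 ≤ ν (G.s f) + ν (G.t f) := by
    intro f
    have h1 := hE f
    have h2 := hd (G.s f)
    have h3 := hd (G.t f)
    simp only [ν]
    split_ifs <;> simp_all
  have hp := pair_reg G hc.st ν
  rw [sum_nu] at hp
  simp only [Int.cast_id] at hp
  have h0 : 0 ≤ ∑ e, x0 e * (ν (G.s e) + ν (G.t e)) :=
    sum_nonneg fun e _ => mul_nonneg (hc.pos e).le (hν e)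
  have hr := hc.rpos
  by_contra hcon
  have h4 : (N.card : ℤ) - P.card = 0 := by
    have : (N.card : ℤ) ≤ P.card := by exact_mod_cast not_lt.1 hcon
    by_contra hne
    have : (N.card : ℤ) - P.card < 0 := by omega
    nlinarith
  rw [h4, mul_zero] at hp
  have h5 := (sum_eq_zero_iff_of_nonneg (s := univ)
      (fun i _ => mul_nonneg (hc.pos i).le (hν i))).1 hp.symm
  have h6 : ∀ f, ν (G.s f) + ν (G.t f) = 0 := fun f =>
    (mul_eq_zero.1 (h5 f (mem_univ f))).resolve_left (hc.pos f).ne'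
  have h7 : ∀ f, (G.s f ∈ N → G.t f ∈ P) ∧ (G.t f ∈ N → G.s f ∈ P) := by
    intro f
    have h1 := h6 f
    have h2 := hd (G.s f)
    have h3 := hd (G.t f)
    simp only [ν] at h1
    by_cases c1 : G.s f ∈ N <;> by_cases c2 : G.t f ∈ N <;> by_cases c3 : G.s f ∈ P <;>
      by_cases c4 : G.t f ∈ P <;> simp [c1, c2, c3, c4] at h1 h2 h3 ⊢
  have h8 := hc.conn (P ∪ N) (hP.mono subset_union_left) (fun f => by
    have := hE f
    have := h7 f
    simp only [mem_union]; tauto)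
  apply hc.nb
  refine ⟨fun v => v ∈ P, fun f => ?_⟩
  have h9 : G.t f ∈ P ∪ N := by rw [h8]; simp
  rw [mem_union] at h9
  have := hE f
  have := h7 f
  have := hd (G.t f)
  have := hd (G.s f)
  tauto

lemma card_le_of_y {y : E → ℤ} {r : ℤ} (hK : G.InK y r) (hr : 0 < r) {e : E} (he : y e = 0)
    {P N : Finset V} (hd : ∀ v ∈ P, v ∉ N)
    (hE : ∀ f, f ≠ e → (G.s f ∈ P → G.t f ∈ N) ∧ (G.t f ∈ P → G.s f ∈ N)) :
    P.card ≤ N.card := by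
  let ν : V → ℤ := fun v => (if v ∈ N then (1 : ℤ) else 0) - (if v ∈ P then 1 else 0)
  have hν : ∀ f, f ≠ e → 0 ≤ ν (G.s f) + ν (G.t f) := by
    intro f hf
    have h1 := hE f hf
    have h2 := hd (G.s f)
    have h3 := hd (G.t f)
    simp only [ν]
    split_ifs <;> simp_all
  have hp := pair_reg G hK.st ν
  rw [sum_nu] at hp
  simp only [Int.cast_id] at hp
  have h0 : 0 ≤ ∑ e, y e * (ν (G.s e) + ν (G.t e)) :=
    sum_nonneg fun f _ => by
      by_cases hf : f = e
      · rw [hf, he, zero_mul]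
      · exact mul_nonneg (hK.nn f) (hν f hf)
  by_contra hcon
  have : (N.card : ℤ) - P.card < 0 := by
    have : (N.card : ℤ) < P.card := by exact_mod_cast not_le.1 hcon
    omega
  nlinarith

/-- a potential bounding a cut -/
lemma cut_le_of_pot {x : E → ℤ} {r : ℤ} (hn : ∀ e, 0 ≤ x e) (hst : ∀ v, G.cut x {v} = r)
    (U : Finset V) (κ : V → ℤ) (hκ : ∀ f, G.cr U f ≤ κ (G.s f) + κ (G.t f)) :
    G.cut x U ≤ r * ∑ v, κ v := by
  have hp := pair_reg G hst κ
  simp only [Int.cast_id] at hp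
  rw [hp]
  exact sum_le_sum fun e _ => mul_le_mul_of_nonneg_left (hκ e) (hn e)

lemma Ctx.C2 (hc : Ctx G x0 r0) {y : E → ℤ} {r : ℤ} (hK : G.InK y r) (hr : 0 < r) {e : E}
    (he : y e = 0) {u v : V} (huv : (G.s e = u ∧ G.t e = v) ∨ (G.s e = v ∧ G.t e = u))
    {P N : Finset V} (hd : ∀ v ∈ P, v ∉ N)
    (hE : ∀ f, f ≠ e → (G.s f ∈ P → G.t f ∈ N) ∧ (G.t f ∈ P → G.s f ∈ N))
    (hu : u ∈ P) (hvP : v ∉ P) (hvN : v ∉ N) : P.card < N.card := by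
  refine lt_of_le_of_ne (card_le_of_y hK hr he hd hE) fun hcard => ?_
  have huN : u ∉ N := hd u hu
  have huv' : u ≠ v := by rintro rfl; exact hvP hu
  -- first set
  set U := P.erase u ∪ N with hU
  have hUc : U.card = 2 * P.card - 1 := by
    rw [hU, card_union_of_disjoint, card_erase_of_mem hu]
    · have := card_pos.2 ⟨u, hu⟩; omega
    · rw [disjoint_left]; intro a ha; exact hd a (mem_of_mem_erase ha)
  have hPpos := card_pos.2 ⟨u, hu⟩
  let κ : V → ℤ := fun a => (if a = u then 1 else 0) + ((if a ∈ N then (1 : ℤ) else 0) - (if a ∈ P then 1 else 0))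
  have hκs : ∑ a, κ a = 1 := by
    simp only [κ]
    rw [sum_add_distrib, sum_nu, hcard]; simp
  have h1 := cut_le_of_pot (fun e => (hc.pos e).le) hc.st U κ (fun f => by
    have a1 := hd (G.s f)
    have a2 := hd (G.t f)
    have a3 := G.ne f
    rw [cr_ind]
    simp only [κ, hU, mem_union, mem_erase]
    by_cases hf : f = e
    · subst hf
      rcases huv with ⟨b1, b2⟩ | ⟨b1, b2⟩ <;> simp [b1, b2, hu, hvP, hvN, huN, huv', huv'.symm]
    · have a4 := hE f hf
      by_cases b1 : G.s f ∈ P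
      · have c1 := a4.1 b1
        have c2 := a1 b1
        have c3 : G.t f ∉ P := fun h => a2 h c1
        have c4 : G.t f ≠ u := fun h => huN (h ▸ c1)
        by_cases c5 : G.s f = u <;> simp [b1, c1, c2, c3, c4, c5, hu, huN]
      · by_cases b2 : G.t f ∈ P
        · have c1 := a4.2 b2
          have c2 := a2 b2
          have c3 : G.s f ∉ P := fun h => a1 h c1
          have c4 : G.s f ≠ u := fun h => huN (h ▸ c1)
          by_cases c5 : G.t f = u <;> simp [b2, c1, c2, c3, c4, c5, hu, huN]
        · have c1 : G.s f ≠ u := fun h => b1 (h ▸ hu)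
          have c2 : G.t f ≠ u := fun h => b2 (h ▸ hu)
          by_cases c3 : G.s f ∈ N <;> by_cases c4 : G.t f ∈ N <;> simp [b1, b2, c1, c2, c3, c4])
  rw [hκs, mul_one] at h1
  have hP1 : P.card = 1 := by
    by_contra hne
    have : NT U := by
      refine ⟨by rw [hUc]; grind, by omega, ?_⟩
      rw [one_lt_card]
      exact ⟨u, by simp [hU, huN], v, by simp [hU, hvP, hvN], huv'⟩
    have := hc.od U this
    omega
  obtain ⟨u', hPu⟩ := card_eq_one.1 hP1
  have : u' = u := by rw [hPu, mem_singleton] at hu; exact hu.symm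
  subst this
  obtain ⟨n, hNn⟩ := card_eq_one.1 (hcard ▸ hP1)
  subst hPu hNn
  simp only [mem_singleton] at hd hE hvP hvN huN
  have hun : u' ≠ n := huN
  have hvn : v ≠ n := hvN
  let κ2 : V → ℤ := fun a => (if a = n then 1 else 0) + (if a = v then 1 else 0) - (if a = u' then 1 else 0)
  have hksum2 : ∑ a, κ2 a = 1 := by
    simp only [κ2]
    rw [sum_sub_distrib, sum_add_distrib]; simp
  have hκ2 : ∀ f, G.cr {u', n, v} f ≤ κ2 (G.s f) + κ2 (G.t f) := fun f => by
    have a3 := G.ne f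
    rw [cr_ind]
    simp only [κ2, mem_insert, mem_singleton]
    by_cases hf : f = e
    · subst hf
      rcases huv with ⟨b1, b2⟩ | ⟨b1, b2⟩ <;> simp [b1, b2, hvn, hun, huv', huv'.symm]
    · have a4 := hE f hf
      by_cases b1 : G.s f = u'
      · have c1 := a4.1 b1
        simp [b1, c1, hun, hun.symm, huv', hvn.symm]
      · by_cases b2 : G.t f = u'
        · have c1 := a4.2 b2
          simp [b2, c1, hun, hun.symm, huv', hvn.symm]
        · by_cases c1 : G.s f = n <;> by_cases c2 : G.t f = n <;> by_cases c3 : G.s f = v <;>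
            by_cases c4 : G.t f = v <;> simp_all
  have h2 := cut_le_of_pot (fun e => (hc.pos e).le) hc.st {u', n, v} κ2 hκ2
  rw [hksum2, mul_one] at h2
  have hc3 : ({u', n, v} : Finset V).card = 3 := by
    rw [card_eq_three]; exact ⟨u', n, v, hun, huv', hvn.symm, rfl⟩
  have hcc := card_add_card_compl ({u', n, v} : Finset V)
  have hVev := hc.ev
  have hcc1 : ({u', n, v} : Finset V)ᶜ.card = 1 := by
    by_contra hne
    have : NT ({u', n, v} : Finset V) := by
      refine ⟨by rw [hc3]; decide, by omega, ?_⟩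
      by_contra h
      have h0 : ({u', n, v} : Finset V)ᶜ.card = 0 := by omega
      rw [hc3, h0] at hcc
      rw [← hcc] at hVev
      exact absurd hVev (by decide)
    have := hc.od _ this
    omega
  obtain ⟨q, hq⟩ := card_eq_one.1 hcc1
  have hcutq : G.cut x0 {u', n, v} = r0 := by rw [← cut_compl, hq, hc.st]
  have hp := pair_reg G hc.st κ2
  simp only [Int.cast_id] at hp
  rw [hksum2, mul_one] at hp
  have hz : ∑ f, x0 f * (κ2 (G.s f) + κ2 (G.t f) - G.cr {u', n, v} f) = 0 := by
    simp only [mul_sub, sum_sub_distrib]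
    rw [← hp, ← hcutq]
    exact sub_self _
  have h5 := (sum_eq_zero_iff_of_nonneg (s := univ)
      (fun i _ => mul_nonneg (hc.pos i).le (by have := hκ2 i; linarith))).1 hz
  have h6 : ∀ f, κ2 (G.s f) + κ2 (G.t f) = G.cr {u', n, v} f := fun f => by
    have := (mul_eq_zero.1 (h5 f (mem_univ f))).resolve_left (hc.pos f).ne'
    linarith
  have hall : ∀ a, a = u' ∨ a = n ∨ a = v ∨ a = q := by
    intro a
    by_contra hcon
    push Not at hcon
    have : a ∈ ({u', n, v} : Finset V)ᶜ := by simp [hcon]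
    rw [hq, mem_singleton] at this
    exact hcon.2.2.2 this
  have hq' : q ≠ u' ∧ q ≠ n ∧ q ≠ v := by
    have : q ∈ ({u', n, v} : Finset V)ᶜ := by rw [hq]; simp
    simpa using this
  apply hc.nb
  refine ⟨fun a => a = u' ∨ a = q, fun f => ?_⟩
  have a3 := G.ne f
  have h7 := h6 f
  rw [cr_ind] at h7
  simp only [κ2, mem_insert, mem_singleton] at h7
  obtain ⟨q1, q2, q3⟩ := hq'
  by_cases hf : f = e
  · subst hf
    rcases huv with ⟨b1, b2⟩ | ⟨b1, b2⟩ <;> simp [b1, b2, huv'.symm, q3.symm]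
  · have a4 := hE f hf
    rcases hall (G.s f) with b | b | b | b
    · have c1 := a4.1 b
      simp [b, c1, hun.symm, q2.symm]
    · rcases hall (G.t f) with c | c | c | c
      · simp [b, c, hun.symm, q2.symm]
      · exact absurd (b.trans c.symm) a3
      · exfalso; simp [b, c, hvn, hvn.symm, hun.symm, huv'.symm] at h7
      · simp [b, c, hun.symm, q2.symm]
    · rcases hall (G.t f) with c | c | c | c
      · simp [b, c, huv'.symm, q3.symm]
      · exfalso; simp [b, c, hvn, hvn.symm, hun.symm, huv'.symm] at h7
      · exact absurd (b.trans c.symm) a3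
      · simp [b, c, huv'.symm, q3.symm]
    · rcases hall (G.t f) with c | c | c | c
      · exfalso; exact q2 (b ▸ a4.2 c)
      · simp [b, c, hun.symm, q2.symm]
      · simp [b, c, huv'.symm, q3.symm]
      · exact absurd (b.trans c.symm) a3
end
end DG

set_option linter.unusedSectionVars false
set_option linter.unusedVariables false
set_option linter.style.longLine false
set_option linter.unnecessarySeqFocus false
namespace DG
section
variable {V E : Type} [Fintype V] [Fintype E] {G : Gr V E} {x0 : E → ℤ} {r0 : ℤ}

set_option maxHeartbeats 1000000 in
lemma Ctx.C3 [Nonempty V] (hc : Ctx G x0 r0) {p : ℕ} (hp : p.Prime) (hp2 : p ≠ 2)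
    {w : (E → ℤ) →+ ZMod p} (hw : ∀ m, G.PM m → w m = 0) (hwn : ∃ z ∈ Reg G, w z ≠ 0)
    {y : E → ℤ} {r : ℤ} (hK : G.InK y r) (hr : 0 < r) {e : E}
    (he : y e = 0) {u v : V} (huv : (G.s e = u ∧ G.t e = v) ∨ (G.s e = v ∧ G.t e = u))
    (hz : ∀ f, y f = 0 → ∀ z ∈ Reg G, z f = z e)
    {P N : Finset V} (hd : ∀ v ∈ P, v ∉ N)
    (hE : ∀ f, f ≠ e → (G.s f ∈ P → G.t f ∈ N) ∧ (G.t f ∈ P → G.s f ∈ N))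
    (hu : u ∈ P) (hv : v ∈ P) : P.card < N.card := by
  refine lt_of_le_of_ne (card_le_of_y hK hr he hd hE) fun hcard => ?_
  have huN : u ∉ N := hd u hu
  have hvN : v ∉ N := hd v hv
  have huv' : u ≠ v := by
    rcases huv with ⟨b1, b2⟩ | ⟨b1, b2⟩
    · rw [← b1, ← b2]; exact G.ne e
    · rw [← b1, ← b2]; exact (G.ne e).symm
  have hsP : G.s e ∈ P ∧ G.t e ∈ P := by
    rcases huv with ⟨b1, b2⟩ | ⟨b1, b2⟩ <;> rw [b1, b2] <;> exact ⟨by assumption, by assumption⟩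
  let ν : V → ℤ := fun v => (if v ∈ N then (1 : ℤ) else 0) - (if v ∈ P then 1 else 0)
  have hν : ∀ f, f ≠ e → 0 ≤ ν (G.s f) + ν (G.t f) := by
    intro f hf
    have h1 := hE f hf
    have h2 := hd (G.s f)
    have h3 := hd (G.t f)
    simp only [ν]
    split_ifs <;> simp_all
  have hy0 : ∀ f, f ≠ e → ν (G.s f) + ν (G.t f) ≠ 0 → y f = 0 := by
    have hp := pair_reg G hK.st ν
    rw [sum_nu, hcard, sub_self, mul_zero] at hp
    simp only [Int.cast_id] at hp
    have h5 := (sum_eq_zero_iff_of_nonneg (s := univ)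
      (fun f _ => by
        by_cases hf : f = e
        · rw [hf, he, zero_mul]
        · exact mul_nonneg (hK.nn f) (hν f hf))).1 hp.symm
    intro f hf hne
    exact (mul_eq_zero.1 (h5 f (mem_univ f))).resolve_right hne
  by_cases hall : P ∪ N = univ
  · obtain ⟨z0, hz0, hwz⟩ := hwn
    have hyD : G.Dy y := hc.bd y r hK (Or.inl ⟨e, he⟩)
    refine hwz (hc.noedge hw e (fun z hzr hze => ?_) hz0)
    obtain ⟨k, hk⟩ := dominate2 (G := G) z y
    have hcol : ∀ f, y f ≠ 0 → (G.s f ∈ P ↔ ¬ G.t f ∈ P) := by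
      intro f hf
      have hfe : f ≠ e := by rintro rfl; exact hf he
      have h1 := hE f hfe
      have h2 := hd (G.s f)
      have h3 := hd (G.t f)
      have h4 : G.s f ∈ P ∨ G.s f ∈ N := by rw [← mem_union, hall]; simp
      have h5 : G.t f ∈ P ∨ G.t f ∈ N := by rw [← mem_union, hall]; simp
      have h6 : ν (G.s f) + ν (G.t f) = 0 := by
        by_contra h; exact hf (hy0 f hfe h)
      simp only [ν] at h6
      by_cases c1 : G.s f ∈ N <;> by_cases c2 : G.t f ∈ N <;> by_cases c3 : G.s f ∈ P <;>
        by_cases c4 : G.t f ∈ P <;> simp_all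
    have hz' : ∀ f, y f = 0 → (z + k • y) f = 0 := by
      intro f hf
      have := hz f hf z hzr
      simp [this, hze, hf]
    have hC : z + k • y ∈ G.C := by
      refine bip_C' G (c := fun a => a ∈ P) (r := rr G (z + k • y)) (fun f hf => hcol f fun h => hf (hz' f h)) (fun f => ?_) ?_
      · by_cases hf : y f = 0
        · exact (hz' f hf).ge
        · exact (hk (Sum.inl f) (lt_of_le_of_ne (hK.nn f) (Ne.symm hf))).le
      · exact (Reg G).add_mem hzr (nsmul_mem (reg_of hK.st) k)
    have h1 : w (z + k • y) = 0 := w_Dy hp hp2 hw ⟨0, by simpa using hC⟩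
    rw [map_add, map_nsmul, w_Dy hp hp2 hw hyD, smul_zero, add_zero] at h1
    exact h1
  · have hf1 : ∃ f1 n1 w1, ((G.s f1 = n1 ∧ G.t f1 = w1) ∨ (G.s f1 = w1 ∧ G.t f1 = n1)) ∧ n1 ∈ N ∧
        w1 ∉ P ∧ w1 ∉ N := by
      by_contra hcon
      push Not at hcon
      apply hall
      refine hc.conn _ ⟨u, mem_union_left _ hu⟩ fun f => ?_
      rw [mem_union, mem_union]
      by_cases hfe : f = e
      · subst hfe; exact ⟨fun _ => Or.inl hsP.2, fun _ => Or.inl hsP.1⟩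
      · have h1 := hE f hfe
        have h2 := hcon f (G.s f) (G.t f) (Or.inl ⟨rfl, rfl⟩)
        have h3 := hcon f (G.t f) (G.s f) (Or.inr ⟨rfl, rfl⟩)
        clear hcon hν hy0
        clear ν
        constructor
        · rintro (h | h)
          · exact Or.inr (h1.1 h)
          · by_contra hh
            push Not at hh
            exact hh.2 (h2 h hh.1)
        · rintro (h | h)
          · exact Or.inr (h1.2 h)
          · by_contra hh
            push Not at hh
            exact hh.2 (h3 h hh.1)
    obtain ⟨f1, n1, w1, hfe, hn1, hw1P, hw1N⟩ := hf1
    have hn1P : n1 ∉ P := fun h => hd _ h hn1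
    have hnw : n1 ≠ w1 := by rintro rfl; exact hw1N hn1
    have hf1e : f1 ≠ e := by
      rintro rfl
      rcases hfe with ⟨b1, b2⟩ | ⟨b1, b2⟩ <;> rw [b1, b2] at hsP
      · exact hn1P hsP.1
      · exact hn1P hsP.2
    have hxe : x0 f1 = x0 e := by
      refine hz f1 (hy0 f1 hf1e ?_) x0 (reg_of hc.st)
      rcases hfe with ⟨b1, b2⟩ | ⟨b1, b2⟩ <;> rw [b1, b2] <;> simp [ν, hn1, hn1P, hw1N, hw1P]
    set U := (P ∪ N).erase n1 with hU
    have hUc : U.card = 2 * P.card - 1 := by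
      rw [hU, card_erase_of_mem (mem_union_right _ hn1), card_union_of_disjoint]
      · omega
      · rw [disjoint_left]; exact hd
    have hP2 : 1 < P.card := one_lt_card.2 ⟨u, hu, v, hv, huv'⟩
    have hNT : NT U := by
      refine ⟨by rw [hUc]; grind, by omega, ?_⟩
      rw [one_lt_card]
      exact ⟨n1, by simp [hU], w1, by simp [hU, hw1P, hw1N], hnw⟩
    have hcut := hc.od U hNT
    let κ : V → ℤ := fun a => (if a = n1 then 1 else 0) + ν a
    have hκs : ∑ a, κ a = 1 := by
      simp only [κ, ν]
      rw [sum_add_distrib, sum_nu, hcard]; simp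
    have hκ : ∀ f, G.cr U f ≤ κ (G.s f) + κ (G.t f) + 2 * (if f = e then 1 else 0)
        - 2 * (if f = f1 then 1 else 0) := by
      intro f
      have a1 := hd (G.s f)
      have a2 := hd (G.t f)
      have a3 := G.ne f
      rw [cr_ind]
      simp only [κ, ν, hU, mem_union, mem_erase]
      by_cases hf : f = e
      · subst hf
        have b1 : G.s f ≠ n1 := fun h => hn1P (h ▸ hsP.1)
        have b2 : G.t f ≠ n1 := fun h => hn1P (h ▸ hsP.2)
        simp [hsP.1, hsP.2, a1 hsP.1, a2 hsP.2, b1, b2, hf1e.symm]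
      · by_cases hff : f = f1
        · subst hff
          rcases hfe with ⟨b1, b2⟩ | ⟨b1, b2⟩ <;> simp [b1, b2, hf, hn1, hn1P, hw1N, hw1P, hnw.symm]
        · have a4 := hE f hf
          by_cases b1 : G.s f ∈ P
          · have c1 := a4.1 b1
            have c2 := a1 b1
            have c3 : G.t f ∉ P := fun h => a2 h c1
            have c4 : G.s f ≠ n1 := fun h => hn1P (h ▸ b1)
            by_cases c5 : G.t f = n1 <;> simp [b1, c1, c2, c3, c4, c5, hf, hff, hn1, hn1P]
          · by_cases b2 : G.t f ∈ P
            · have c1 := a4.2 b2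
              have c2 := a2 b2
              have c3 : G.s f ∉ P := fun h => a1 h c1
              have c4 : G.t f ≠ n1 := fun h => hn1P (h ▸ b2)
              by_cases c5 : G.s f = n1 <;> simp [b2, c1, c2, c3, c4, c5, hf, hff, hn1, hn1P]
            · by_cases c1 : G.s f = n1
              · have c2 : G.t f ≠ n1 := fun h => a3 (c1.trans h.symm)
                by_cases c4 : G.t f ∈ N <;> simp [c1, c2, b2, c4, hf, hff, hn1, hn1P]
              · by_cases c2 : G.t f = n1
                · by_cases c4 : G.s f ∈ N <;> simp [c1, c2, b1, c4, hf, hff, hn1, hn1P]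
                · by_cases c3 : G.s f ∈ N <;> by_cases c4 : G.t f ∈ N <;>
                    simp [b1, b2, c1, c2, c3, c4, hf, hff]
    have hsum : G.cut x0 U ≤ ∑ f, x0 f * (κ (G.s f) + κ (G.t f) + 2 * (if f = e then 1 else 0)
        - 2 * (if f = f1 then 1 else 0)) :=
      sum_le_sum fun f _ => mul_le_mul_of_nonneg_left (hκ f) (hc.pos f).le
    have hpr := pair_reg G hc.st κ
    simp only [Int.cast_id] at hpr
    rw [hκs, mul_one] at hpr
    simp only [mul_sub, mul_add, sum_sub_distrib, sum_add_distrib] at hsum hpr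
    simp at hsum
    linarith
end
end DG

set_option linter.unusedSectionVars false
set_option linter.unusedVariables false
set_option linter.style.longLine false
set_option linter.unnecessarySeqFocus false
namespace DG
section
variable {V E : Type} [Fintype V] [Fintype E] {G : Gr V E} {x0 : E → ℤ} {r0 : ℤ}

lemma lvl_pt (k : ℤ) (L : ℕ) : ∑ j ∈ range L, (if (j : ℤ) + 1 ≤ k then (1 : ℤ) else 0) = min (max k 0) L := by
  induction L with
  | zero => simp
  | succ n ih =>
    rw [sum_range_succ, ih]
    split_ifs <;> push_cast <;> omega

lemma lvl_sum (k : V → ℤ) (L : ℕ) (hL : ∀ v, (k v).natAbs ≤ L) :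
    ∑ v, k v = ∑ j ∈ range L, (((univ.filter fun v => (j : ℤ) + 1 ≤ k v).card : ℤ)
      - ((univ.filter fun v => k v ≤ -((j : ℤ) + 1)).card : ℤ)) := by
  have h1 : ∀ v, k v = ∑ j ∈ range L, ((if (j : ℤ) + 1 ≤ k v then (1 : ℤ) else 0)
      - (if (j : ℤ) + 1 ≤ - k v then (1 : ℤ) else 0)) := by
    intro v
    have := hL v
    rw [sum_sub_distrib, lvl_pt, lvl_pt]
    omega
  rw [sum_congr rfl fun v _ => h1 v, sum_comm]
  refine sum_congr rfl fun j _ => ?_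
  rw [sum_sub_distrib]
  simp only [card_filter]
  push_cast
  congr 1
  refine sum_congr rfl fun v _ => ?_
  congr 1
  exact propext ⟨fun h => by omega, fun h => by omega⟩

lemma lvl_bound (k : V → ℤ) (a j0 c : ℤ) (ha : 0 ≤ a) (hj0 : 1 ≤ j0)
    (h : ∀ j : ℤ, 1 ≤ j → (if j ≤ a then 1 else 0) + (if j = j0 then c else 0) ≤
      ((univ.filter fun v => k v ≤ -j).card : ℤ) - ((univ.filter fun v => j ≤ k v).card : ℤ)) :
    ∑ v, k v ≤ - a - c := by
  set L := ∑ v, (k v).natAbs + a.natAbs + j0.natAbs with hL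
  have hL1 : ∀ v, (k v).natAbs ≤ L := fun v => by
    have := single_le_sum (f := fun v => (k v).natAbs) (fun _ _ => Nat.zero_le _) (mem_univ v)
    omega
  rw [lvl_sum k L hL1]
  have h2 : ∑ j ∈ range L, ((if (j : ℤ) + 1 ≤ a then (1 : ℤ) else 0) + (if (j : ℤ) + 1 = j0 then c else 0)) = a + c := by
    rw [sum_add_distrib, lvl_pt]
    have h3 : ∑ j ∈ range L, (if (j : ℤ) + 1 = j0 then c else 0) = c := by
      rw [sum_eq_single (j0 - 1).toNat]
      · rw [if_pos]; omega
      · intro b _ hb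
        rw [if_neg]; omega
      · intro hb
        rw [mem_range] at hb
        omega
    rw [h3]
    have : a ≤ L := by omega
    omega
  have h4 : ∑ j ∈ range L, ((if (j : ℤ) + 1 ≤ a then (1 : ℤ) else 0) + (if (j : ℤ) + 1 = j0 then c else 0))
     ≤ ∑ j ∈ range L, (((univ.filter fun v => k v ≤ -((j : ℤ) + 1)).card : ℤ) - ((univ.filter fun v => (j : ℤ) + 1 ≤ k v).card : ℤ)) :=
    sum_le_sum fun j _ => h ((j : ℤ) + 1) (by omega)
  rw [h2] at h4
  rw [sum_sub_distrib] at h4 ⊢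
  linarith

lemma scale_int (ρ : V → ℚ) : ∃ D : ℕ, 0 < D ∧ ∃ k : V → ℤ, ∀ v, (k v : ℚ) = D * ρ v := by
  refine ⟨∏ v, (ρ v).den, prod_pos fun v _ => (ρ v).den_pos, 
    fun v => (∏ w ∈ univ.erase v, ((ρ w).den : ℤ)) * (ρ v).num, fun v => ?_⟩
  rw [← mul_prod_erase univ _ (mem_univ v)]
  push_cast
  have := Rat.mul_den_eq_num (ρ v)
  linear_combination -(∏ w ∈ univ.erase v, ((ρ w).den : ℚ)) * this

set_option maxHeartbeats 1000000 in
lemma Rdg.case_zero [Nonempty V] (hc : Ctx G x0 r0) {p : ℕ} (hp : p.Prime) (hp2 : p ≠ 2)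
    {w : (E → ℤ) →+ ZMod p} (hw : ∀ m, G.PM m → w m = 0) (hwn : ∃ z ∈ Reg G, w z ≠ 0)
    {A B : Finset V} {y yA yB : E → ℤ} (R : Rdg G x0 w A B y yA yB) (e : E) (he : y e = 0) :
    False := by
  obtain ⟨α, β, hα, hα6, hβ, hβ6, hco⟩ := R.coef hc hp hp2 hw hwn
  have hK := R.hK hc
  have hr := R.rpos
  have hz : ∀ f, y f = 0 → ∀ z ∈ Reg G, z f = z e := by
    intro f hf z hzr
    have h1 := hco f hf z hzr
    have h2 := hco e he z hzr
    have : (z f : ℚ) = z e := by rw [h1, h2]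
    exact_mod_cast this
  obtain ⟨ρ, hρ⟩ := hc.potential (F := ℚ) (by norm_num)
    (fun f => (if f = e then 1 else 0) - α * (G.cr A f : ℚ) - β * (G.cr B f : ℚ)) (fun z hz0 => by
      have h1 := hco e he z (reg_of hz0)
      rw [sur_def, sur_def, rr_eq hz0, sub_zero, sub_zero, ← sum_cr_cast, ← sum_cr_cast] at h1
      simp only [sub_mul, sum_sub_distrib, mul_assoc, ← mul_sum]
      simp
      linarith)
  have hsum : ∑ v, ρ v = -(α + β) := by
    have h1 := pair_reg G hK.st ρ
    have h2 : ∑ f, (y f : ℚ) * (ρ (G.s f) + ρ (G.t f)) = - α * (G.cut y A : ℚ) - β * (G.cut y B : ℚ) := by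
      rw [← sum_cr_cast, ← sum_cr_cast, mul_sum, mul_sum, ← sum_sub_distrib]
      refine sum_congr rfl fun f _ => ?_
      rw [← hρ]
      by_cases hf : f = e
      · subst hf; simp [he]
      · simp [hf]; ring
    have h3 := R.yA0
    have h4 := R.yB0
    rw [sur_def] at h3 h4
    rw [h2, show G.cut y A = rr G y by linarith, show G.cut y B = rr G y by linarith] at h1
    have h5 : (rr G y : ℚ) ≠ 0 := by exact_mod_cast hr.ne'
    apply mul_left_cancel₀ h5
    linarith
  have hcA : ∀ f, (0 : ℚ) ≤ G.cr A f ∧ (G.cr A f : ℚ) ≤ 1 := fun f =>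
    ⟨by exact_mod_cast cr_nonneg G A f, by exact_mod_cast cr_le_one G A f⟩
  have hcB : ∀ f, (0 : ℚ) ≤ G.cr B f ∧ (G.cr B f : ℚ) ≤ 1 := fun f =>
    ⟨by exact_mod_cast cr_nonneg G B f, by exact_mod_cast cr_le_one G B f⟩
  have hne : ∀ f, f ≠ e → ρ (G.s f) + ρ (G.t f) = - α * (G.cr A f : ℚ) - β * (G.cr B f : ℚ) := by
    intro f hf
    rw [← hρ]; simp [hf]
  have heq : ρ (G.s e) + ρ (G.t e) = 1 - α * (G.cr A e : ℚ) - β * (G.cr B e : ℚ) := by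
    rw [← hρ]; simp
  obtain ⟨u, v, huv, hle⟩ : ∃ u v, ((G.s e = u ∧ G.t e = v) ∨ (G.s e = v ∧ G.t e = u)) ∧ ρ v ≤ ρ u := by
    rcases le_total (ρ (G.s e)) (ρ (G.t e)) with h | h
    · exact ⟨G.t e, G.s e, Or.inr ⟨rfl, rfl⟩, h⟩
    · exact ⟨G.s e, G.t e, Or.inl ⟨rfl, rfl⟩, h⟩
  have heq' : ρ u + ρ v = 1 - α * (G.cr A e : ℚ) - β * (G.cr B e : ℚ) := by
    rcases huv with ⟨b1, b2⟩ | ⟨b1, b2⟩ <;> rw [← heq, b1, b2]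
    rw [add_comm]
  obtain ⟨D, hD, k, hk⟩ := scale_int ρ
  have hDq : (0 : ℚ) < D := by exact_mod_cast hD
  have hkle : k v ≤ k u := by
    have : (k v : ℚ) ≤ k u := by rw [hk, hk]; exact mul_le_mul_of_nonneg_left hle hDq.le
    exact_mod_cast this
  have hkne : ∀ f, f ≠ e → k (G.s f) + k (G.t f) ≤ 0 := by
    intro f hf
    have h1 := hne f hf
    have h2 := mul_nonneg hα.le (hcA f).1
    have h3 := mul_nonneg hβ.le (hcB f).1
    have h4 : ρ (G.s f) + ρ (G.t f) ≤ 0 := by linarith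
    have : ((k (G.s f) + k (G.t f) : ℤ) : ℚ) ≤ 0 := by
      push_cast
      rw [hk, hk, ← mul_add]
      exact mul_nonpos_of_nonneg_of_nonpos hDq.le h4
    exact_mod_cast this
  have hksum : ((∑ a, k a : ℤ) : ℚ) = - D * (α + β) := by
    push_cast
    rw [sum_congr rfl fun a _ => hk a, ← mul_sum, hsum]; ring
  -- levels
  have hlev : ∀ j : ℤ, 1 ≤ j → (univ.filter fun a => j ≤ k a).Nonempty →
      (univ.filter fun a => j ≤ k a).card < (univ.filter fun a => k a ≤ -j).card := by
    intro j hj hPn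
    set P := univ.filter fun a => j ≤ k a with hPdef
    set N := univ.filter fun a => k a ≤ -j with hNdef
    have mP : ∀ a, a ∈ P ↔ j ≤ k a := fun a => by simp [hPdef]
    have mN : ∀ a, a ∈ N ↔ k a ≤ -j := fun a => by simp [hNdef]
    have hd : ∀ a ∈ P, a ∉ N := fun a h1 h2 => by
      rw [mP] at h1; rw [mN] at h2; omega
    have hE : ∀ f, f ≠ e → (G.s f ∈ P → G.t f ∈ N) ∧ (G.t f ∈ P → G.s f ∈ N) := by
      intro f hf
      have := hkne f hf
      simp only [mP, mN]
      constructor <;> intro h <;> omega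
    by_cases hu : u ∈ P
    · by_cases hv : v ∈ P
      · exact hc.C3 hp hp2 hw hwn hK hr he huv hz hd hE hu hv
      · by_cases hvN : v ∈ N
        · refine hc.C1 hd (fun f => ?_) hPn
          by_cases hf : f = e
          · subst hf
            rcases huv with ⟨b1, b2⟩ | ⟨b1, b2⟩ <;> rw [b1, b2]
            · exact ⟨fun _ => hvN, fun h => absurd h hv⟩
            · exact ⟨fun h => absurd h hv, fun _ => hvN⟩
          · exact hE f hf
        · exact hc.C2 hK hr he huv hd hE hu hv hvN
    · have hv : v ∉ P := by rw [mP] at hu ⊢; omega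
      refine hc.C1 hd (fun f => ?_) hPn
      by_cases hf : f = e
      · subst hf
        rcases huv with ⟨b1, b2⟩ | ⟨b1, b2⟩ <;> rw [b1, b2]
        · exact ⟨fun h => absurd h hu, fun h => absurd h hv⟩
        · exact ⟨fun h => absurd h hv, fun h => absurd h hu⟩
      · exact hE f hf
  have hlev' : ∀ j : ℤ, 1 ≤ j → (if j ≤ k u then (1 : ℤ) else 0) ≤ 
      ((univ.filter fun v => k v ≤ -j).card : ℤ) - ((univ.filter fun v => j ≤ k v).card : ℤ) := by
    intro j hj
    by_cases hPn : (univ.filter fun a => j ≤ k a).Nonempty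
    · have := hlev j hj hPn
      split_ifs <;> omega
    · have h2 : ¬ j ≤ k u := fun h => hPn ⟨u, by simp [h]⟩
      rw [not_nonempty_iff_eq_empty] at hPn
      rw [hPn, if_neg h2]
      simp
  have b1 := mul_le_of_le_one_right hα.le (hcA e).2
  have b2 := mul_le_of_le_one_right hβ.le (hcB e).2
  have hku : 0 < k u := by
    have : (0 : ℚ) < k u := by rw [hk]; apply mul_pos hDq; linarith
    exact_mod_cast this
  have hbd := lvl_bound k (k u) 1 0 hku.le le_rfl (fun j hj => by
    have := hlev' j hj
    split_ifs at this ⊢ <;> omega)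
  have hbd' : ρ u ≤ α + β := by
    have h1 : ((∑ a, k a : ℤ) : ℚ) ≤ - k u := by
      have : ∑ a, k a ≤ - k u := by linarith
      exact_mod_cast this
    rw [hksum, hk] at h1
    by_contra hcon
    push Not at hcon
    have := mul_lt_mul_of_pos_left hcon hDq
    linarith
  have hα' : α = 1 / 6 := by linarith
  have hβ' : β = 1 / 6 := by linarith
  have hρu : ρ u = 1 / 3 := by linarith
  have hρv : ρ v = 1 / 3 := by linarith
  have hcre : G.cr A e ≠ 0 := by
    intro h
    rw [h] at heq'
    push_cast at heq'
    linarith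
  have hkuv : k v = k u := by
    have : (k v : ℚ) = k u := by rw [hk, hk, hρu, hρv]
    exact_mod_cast this
  have hks : ∑ a, k a = - k u := by
    have : ((∑ a, k a : ℤ) : ℚ) = ((- k u : ℤ) : ℚ) := by
      rw [hksum]; push_cast; rw [hk, hρu, hα', hβ']; ring
    exact_mod_cast this
  by_cases hq : ∃ q, k q < - k u
  · obtain ⟨q, hq⟩ := hq
    have := lvl_bound k (k u) (k u + 1) 1 hku.le (by omega) (fun j hj => by
      have h1 := hlev' j hj
      by_cases hj' : j = k u + 1
      · subst hj'
        rw [if_neg (by omega), if_pos rfl]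
        by_cases hPn : (univ.filter fun a => k u + 1 ≤ k a).Nonempty
        · have := hlev _ hj hPn
          omega
        · rw [not_nonempty_iff_eq_empty] at hPn
          rw [hPn]
          have : 0 < (univ.filter fun a => k a ≤ -(k u + 1)).card :=
            card_pos.2 ⟨q, by rw [mem_filter]; exact ⟨mem_univ _, by omega⟩⟩
          simp only [card_empty]
          omega
      · rw [if_neg hj', add_zero]; exact h1)
    omega
  · push Not at hq
    have := lvl_bound k (k u) (k u) 1 hku.le (by omega) (fun j hj => by
      have h1 := hlev' j hj
      by_cases hj' : j = k u
      · subst hj'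
        rw [if_pos le_rfl, if_pos rfl]
        set P := univ.filter fun a => k u ≤ k a with hPdef
        set N := univ.filter fun a => k a ≤ -k u with hNdef
        have mP : ∀ a, a ∈ P ↔ k u ≤ k a := fun a => by simp [hPdef]
        have mN : ∀ a, a ∈ N ↔ k a ≤ -k u := fun a => by simp [hNdef]
        have hcr : ∀ f, f ≠ e → 0 ≤ k (G.s f) + k (G.t f) → (G.s f ∈ A ↔ G.t f ∈ A) := by
          intro f hf h0
          by_contra hcon
          have hcrf : G.cr A f = 1 := by rw [cr_ind, if_neg hcon]
          have h1 := hne f hf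
          rw [hcrf] at h1
          have h3 := mul_nonneg hβ.le (hcB f).1
          have h4 : ρ (G.s f) + ρ (G.t f) < 0 := by push_cast at h1; linarith
          have h5 : (0 : ℚ) ≤ ((k (G.s f) + k (G.t f) : ℤ) : ℚ) := by exact_mod_cast h0
          push_cast at h5
          rw [hk, hk, ← mul_add] at h5
          have := mul_neg_of_pos_of_neg hDq h4
          linarith
        have key : ∀ S : Finset V, (∀ f, f ≠ e → 0 ≤ k (G.s f) + k (G.t f) → (G.s f ∈ S ↔ G.t f ∈ S)) →
            ∀ u' v', ((G.s e = u' ∧ G.t e = v') ∨ (G.s e = v' ∧ G.t e = u')) → u' ∈ S → v' ∉ S → u' ∈ P →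
            (P ∩ S).card < (N ∩ S).card := by
          intro S hS u' v' huv' hu' hv' hu'P
          refine hc.C2 hK hr he huv' (fun a h1 h2 => ?_) (fun f hf => ?_) (mem_inter.2 ⟨hu'P, hu'⟩)
            (fun h => hv' (mem_inter.1 h).2) (fun h => hv' (mem_inter.1 h).2)
          · rw [mem_inter, mP] at h1
            rw [mem_inter, mN] at h2
            omega
          · have h2 := hkne f hf
            have h3 := hS f hf
            have h4 := hq (G.s f)
            have h5 := hq (G.t f)
            simp only [mem_inter, mP, mN]
            exact ⟨fun h => ⟨by omega, (h3 (by omega)).1 h.2⟩, fun h => ⟨by omega, (h3 (by omega)).2 h.2⟩⟩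
        have hcrc : ∀ f, f ≠ e → 0 ≤ k (G.s f) + k (G.t f) → (G.s f ∈ Aᶜ ↔ G.t f ∈ Aᶜ) := by
          intro f hf h0
          rw [mem_compl, mem_compl, hcr f hf h0]
        have huP : u ∈ P := by rw [mP]
        have hvP : v ∈ P := by rw [mP]; omega
        have hvu := huv.symm
        have hcross : ¬ (G.s e ∈ A ↔ G.t e ∈ A) := by
          intro h; apply hcre; rw [cr_ind, if_pos h]
        have hcross' : (u ∈ A ∧ v ∉ A) ∨ (v ∈ A ∧ u ∉ A) := by
          rcases huv with ⟨c1, c2⟩ | ⟨c1, c2⟩ <;> rw [c1, c2] at hcross <;> 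
            by_cases d1 : u ∈ A <;> by_cases d2 : v ∈ A <;> simp [d1, d2] at hcross ⊢
        have hs : ∀ S : Finset V, S.card = (S ∩ A).card + (S ∩ Aᶜ).card := by
          intro S
          rw [← card_union_of_disjoint, ← inter_union_distrib_left, union_compl, inter_univ]
          exact disjoint_compl_right.mono inter_subset_right inter_subset_right
        have hP1 := hs P
        have hN1 := hs N
        rcases hcross' with ⟨c1, c2⟩ | ⟨c1, c2⟩
        · have g1 := key A hcr u v huv c1 c2 huP
          have g2 := key Aᶜ hcrc v u hvu (by simpa using c2) (by simpa using c1) hvP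
          omega
        · have g1 := key A hcr v u hvu c1 c2 hvP
          have g2 := key Aᶜ hcrc u v huv (by simpa using c2) (by simpa using c1) huP
          omega
      · rw [if_neg hj', add_zero]; exact h1)
    omega
end
end DG

set_option linter.unusedSectionVars false
set_option linter.unusedVariables false
set_option linter.style.longLine false
set_option linter.unnecessarySeqFocus false
namespace DG

lemma main_step {V E : Type} [Fintype V] [Fintype E] (G : Gr V E)
    (IH : IHyp (Fintype.card V + Fintype.card E)) {x : E → ℤ} {r : ℤ} (hK : G.InK x r) : G.Dy x := by
  rcases isEmpty_or_nonempty V with hV | hV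
  · have : x = 0 := by funext e; exact hV.elim (G.s e)
    rw [this]; exact zero_Dy G
  rcases (InK.r_nonneg G hK).eq_or_lt with hr | hr
  · rw [zero_of_r_zero G hK.nn (by rw [hr]; exact hK.st)]
    exact zero_Dy G
  by_cases h1 : ∃ e, x e = 0
  · obtain ⟨e, he⟩ := h1
    exact zero_case G IH hK e he
  by_cases h2 : ∃ U, NT U ∧ G.cut x U = r
  · obtain ⟨U, ⟨a, b, c⟩, ht⟩ := h2
    exact tight_case G IH hK U a b c ht
  by_cases h3 : ∃ c : V → Prop, ∀ e, (c (G.s e) ↔ ¬ c (G.t e))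
  · obtain ⟨c, hc⟩ := h3
    exact ⟨0, by simpa using bip_C' G (c := c) (fun e _ => hc e) hK.nn hK.st⟩
  push Not at h1 h2
  have hc : Ctx G x r :=
    { pos := fun e => lt_of_le_of_ne (hK.nn e) (h1 e).symm
      st := hK.st
      od := fun U hU => lt_of_le_of_ne (hK.od U hU.1) (h2 U hU).symm
      rpos := hr
      ev := InK.even G hK hr
      ne := hV
      nb := h3
      bd := fun z r hz h => by
        rcases h with ⟨e, he⟩ | ⟨U, ⟨a, b, c⟩, ht⟩
        · exact zero_case G IH hz e he
        · exact tight_case G IH hz U a b c ht }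
  by_contra hnd
  obtain ⟨p, hp, hp2, w, hw, hwn⟩ := hc.exists_w hnd
  obtain ⟨A, B, y, yA, yB, R⟩ := hc.exists_rdg hp hp2 hw hwn
  by_cases hy : ∃ e, y e = 0
  · obtain ⟨e, he⟩ := hy
    exact R.case_zero hc hp hp2 hw hwn e he
  · push Not at hy
    exact R.case_pos hc hp hp2 hwn (fun e => lt_of_le_of_ne (R.ynn (Sum.inl e)) (hy e).symm)

lemma main_ind : ∀ n, IHyp n := by
  intro n
  induction n with
  | zero => intro V E _ _ G h; omega
  | succ n ih =>
    intro V E _ _ G h x r hK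
    refine main_step G (fun V' E' _ _ G' h' => ih V' E' G' (by omega)) hK

lemma main {V E : Type} [Fintype V] [Fintype E] (G : Gr V E) {x : E → ℤ} {r : ℤ}
    (hK : G.InK x r) : G.Dy x :=
  main_ind _ V E G (Nat.lt_succ_self _) x r hK

lemma mult_coef {ι E : Type} [Fintype ι] (a : ι → E → ℤ) (L : Multiset (E → ℤ))
    (h : ∀ m ∈ L, ∃ i, m = a i) : ∃ c : ι → ℕ, ∀ j, ∑ i, (c i : ℤ) * a i j = L.sum j := by
  induction L using Multiset.induction_on with
  | empty => exact ⟨0, by simp⟩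
  | cons m L ih =>
    obtain ⟨c, hc⟩ := ih fun m hm => h m (Multiset.mem_cons_of_mem hm)
    obtain ⟨i0, rfl⟩ := h m (Multiset.mem_cons_self m L)
    refine ⟨fun i => c i + if i = i0 then 1 else 0, fun j => ?_⟩
    simp only [Nat.cast_add, add_mul, sum_add_distrib, hc, Multiset.sum_cons, Pi.add_apply]
    simp [add_comm]

end DG

open DG in
theorem perfect_matchings_form_DGSC {V E : Type} [Fintype V] [Fintype E]
    (ends : E → Sym2 V) (hloopless : ∀ e, ¬ (ends e).IsDiag)
    (hVeven : Even (Fintype.card V)) :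
    IsPGSC 2 (fun M : {M : Finset E // IsPerfectMatchingSet ends M} => fun e : E =>
      if e ∈ M.1 then (1 : ℤ) else 0) := by
  intro w hw
  obtain ⟨lam, hl0, hl⟩ := hw
  rcases isEmpty_or_nonempty V with hV | ⟨⟨v0⟩⟩
  · refine ⟨fun _ => 0, fun _ => le_rfl, fun _ => ⟨0, 0, by simp⟩, fun j => ?_⟩
    exact hV.elim (Quot.out (ends j)).1
  have hends : ∀ e, ends e = s((Quot.out (ends e)).1, (Quot.out (ends e)).2) := fun e =>
    (Quot.out_eq (ends e)).symm
  let G : Gr V E :=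
    { s := fun e => (Quot.out (ends e)).1
      t := fun e => (Quot.out (ends e)).2
      ne := fun e h => by
        apply hloopless e
        rw [hends e]
        exact Sym2.mk_isDiag_iff.2 h }
  have hmem : ∀ v e, v ∈ ends e ↔ (G.s e = v ∨ G.t e = v) := by
    intro v e
    rw [hends e, Sym2.mem_iff]
    exact or_congr eq_comm eq_comm
  let a : {M : Finset E // IsPerfectMatchingSet ends M} → E → ℤ :=
    fun M e => if e ∈ M.1 then (1 : ℤ) else 0
  have hcard : ∀ (M : Finset E) (v : V), G.cut (fun e => if e ∈ M then (1 : ℤ) else 0) {v}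
      = ((Finset.univ.filter (fun e => e ∈ M ∧ v ∈ ends e)).card : ℤ) := by
    intro M v
    rw [card_filter]
    push_cast
    refine sum_congr rfl fun e _ => ?_
    have h1 := hmem v e
    have h2 := G.ne e
    rw [cr_single]
    by_cases c1 : e ∈ M <;> by_cases c2 : G.s e = v <;> by_cases c3 : G.t e = v
    · exact absurd (c2.trans c3.symm) h2
    all_goals simp [c1, c2, c3, h1]
  have hPM : ∀ M, G.PM (a M) := by
    intro M
    refine ⟨fun e => ?_, fun v => ?_⟩
    · simp only [a]; split_ifs <;> simp
    · have := hcard M.1 v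
      rw [M.2 v, Nat.cast_one] at this
      exact this
  have hPM' : ∀ m, G.PM m → ∃ M, m = a M := by
    intro m hm
    have h1 : m = fun e => if e ∈ (univ.filter fun e => m e = 1) then (1 : ℤ) else 0 := by
      funext e
      have h2 := hm.nn e
      have h3 := PM.le_one hm e
      by_cases h4 : m e = 1
      · simp [h4]
      · simp [h4]; omega
    refine ⟨⟨univ.filter fun e => m e = 1, fun v => ?_⟩, h1⟩
    have h2 := hcard (univ.filter fun e => m e = 1) v
    rw [← h1, hm.st] at h2
    exact_mod_cast h2.symm
  have hcut : ∀ U, (G.cut w U : ℝ) = ∑ M, lam M * (G.cut (a M) U : ℝ) := by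
    intro U
    simp only [Gr.cut, Int.cast_sum, Int.cast_mul, mul_sum]
    rw [sum_comm]
    refine sum_congr rfl fun e _ => ?_
    rw [← hl e, sum_mul]
    exact sum_congr rfl fun M _ => by rw [mul_assoc]
  have hst : ∀ v, (G.cut w {v} : ℝ) = ∑ M, lam M := by
    intro v
    rw [hcut]
    exact sum_congr rfl fun M _ => by rw [(hPM M).st]; simp
  have hK : G.InK w (G.cut w {v0}) := by
    refine ⟨fun e => ?_, fun v => ?_, fun U hU => ?_⟩
    · have : (0 : ℝ) ≤ w e := by
        rw [← hl e]
        exact sum_nonneg fun M _ => mul_nonneg (hl0 M) (Int.cast_nonneg ((hPM M).nn e))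
      exact_mod_cast this
    · have : (G.cut w {v} : ℝ) = G.cut w {v0} := by rw [hst, hst]
      exact_mod_cast this
    · have : (G.cut w {v0} : ℝ) ≤ G.cut w U := by
        rw [hst, hcut]
        refine sum_le_sum fun M _ => le_mul_of_one_le_right (hl0 M) ?_
        exact_mod_cast (PM.inK G (hPM M)).od U hU
      exact_mod_cast this
  obtain ⟨k, hk⟩ := DG.main G hK
  obtain ⟨L, hL, hLs⟩ := (C_iff G).1 hk
  obtain ⟨c, hc⟩ := mult_coef a L (fun m hm => hPM' m (hL m hm))
  refine ⟨fun M => (c M : ℝ) / 2 ^ k, fun M => by positivity, fun M => ⟨c M, k, by simp⟩, fun j => ?_⟩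
  have h1 := hc j
  rw [hLs] at h1
  have h2 : ∑ i, (c i : ℝ) * (a i j : ℝ) = 2 ^ k * (w j : ℝ) := by
    have h3 : ((∑ i, (c i : ℤ) * a i j : ℤ) : ℝ) = (((2 ^ k : ℕ) • w) j : ℤ) := by rw [h1]
    rw [Pi.smul_apply, nsmul_eq_mul] at h3
    push_cast at h3
    exact h3
  have h4 : (2 : ℝ) ^ k ≠ 0 := by positivity
  have h5 : ∀ i, (c i : ℝ) / 2 ^ k * (a i j : ℝ) = (c i : ℝ) * (a i j : ℝ) / 2 ^ k := fun i => by ring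
  refine (sum_congr rfl fun i _ => h5 i).trans ?_
  rw [← sum_div, h2]
  field_simp
end

section
/- Let p be a prime, A ∈ ℤ^{m×n}, and b ∈ ℤ^m. If the affine subspace {x ∈ ℝ^n : Ax = b} contains a p-adic point, then the set of p-adic points in {x : Ax = b} is dense in {x : Ax = b}. Consequently, a nonempty rational polyhedron contains a p-adic point if, and only if, its affine hull contains a p-adic point. -/
open Finset

theorem IsPadic.add' {p : ℕ} (hp : p.Prime) {r s : ℝ} (hr : IsPadic p r) (hs : IsPadic p s) :
    IsPadic p (r + s) := by
  obtain ⟨a, k, rfl⟩ := hr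
  obtain ⟨b, l, rfl⟩ := hs
  have h0 : (p : ℝ) ≠ 0 := by exact_mod_cast hp.ne_zero
  refine ⟨a * p ^ l + b * p ^ k, k + l, ?_⟩
  push_cast
  rw [pow_add]
  field_simp

theorem IsPadic.mul_int {p : ℕ} {r : ℝ} (hr : IsPadic p r) (z : ℤ) :
    IsPadic p (r * z) := by
  obtain ⟨a, k, rfl⟩ := hr
  exact ⟨a * z, k, by push_cast; ring⟩

theorem IsPadic.sum_mul_int {p : ℕ} (hp : p.Prime) {ι : Type*} (s : Finset ι) (c : ι → ℝ)
    (z : ι → ℤ) (hc : ∀ k, IsPadic p (c k)) : IsPadic p (∑ k ∈ s, c k * z k) := by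
  classical
  induction s using Finset.induction_on with
  | empty => exact ⟨0, 0, by simp⟩
  | insert a s ha ih =>
    rw [Finset.sum_insert ha]
    exact ((hc a).mul_int _).add' hp ih

theorem dense_isPadic {p : ℕ} (hp : p.Prime) : Dense {r : ℝ | IsPadic p r} := by
  refine dense_of_exists_between fun {x y} hxy => ?_
  have h1 : (1 : ℝ) < p := by exact_mod_cast hp.one_lt
  obtain ⟨k, hk⟩ := pow_unbounded_of_one_lt (1 / (y - x)) h1
  have hpk : (0 : ℝ) < (p : ℝ) ^ k := by positivity
  have hd : 0 < y - x := sub_pos.2 hxy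
  rw [div_lt_iff₀ hd] at hk
  refine ⟨((⌊x * p ^ k⌋ + 1 : ℤ) : ℝ) / (p : ℝ) ^ k, ⟨_, k, rfl⟩, ?_, ?_⟩
  · rw [lt_div_iff₀ hpk]
    push_cast
    exact Int.lt_floor_add_one _
  · rw [div_lt_iff₀ hpk]
    push_cast
    have := Int.floor_le (x * (p : ℝ) ^ k)
    nlinarith

theorem exists_int_kernel {m n : ℕ} (A : Matrix (Fin m) (Fin n) ℤ) (d : Fin n → ℝ)
    (hd : ∀ i, ∑ j, (A i j : ℝ) * d j = 0) :
    ∃ (r : ℕ) (v : Fin r → ℝ) (z : Fin r → Fin n → ℤ),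
      (∀ k i, ∑ j, A i j * z k j = 0) ∧ ∀ j, d j = ∑ k, v k * z k j := by
  let N : Submodule ℤ ℝ := Submodule.span ℤ (Set.range d)
  haveI : Module.Finite ℤ N := Module.Finite.span_of_finite ℤ (Set.finite_range d)
  haveI : Module.Free ℤ N := inferInstance
  let B := Module.finBasis ℤ N
  let e : Fin n → N := fun j => ⟨d j, Submodule.subset_span ⟨j, rfl⟩⟩
  refine ⟨_, fun k => (B k : ℝ), fun k j => B.repr (e j) k, ?_, ?_⟩
  · intro k i
    have h : ∑ j, A i j • e j = 0 := by
      apply Subtype.ext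
      simpa [e] using hd i
    have h2 := congrArg (fun t => B.repr t k) h
    simpa using h2
  · intro j
    have h := congrArg (Subtype.val) (B.sum_repr (e j))
    simp only [Submodule.coe_sum, Submodule.coe_smul, zsmul_eq_mul] at h
    rw [show d j = (e j : ℝ) from rfl, ← h]
    exact Finset.sum_congr rfl fun k _ => mul_comm _ _

theorem density_part {m n : ℕ} (p : ℕ) (hp : p.Prime)
    (A : Matrix (Fin m) (Fin n) ℤ) (b : Fin m → ℤ)
    (hx : ∃ x : Fin n → ℝ, (∀ j, IsPadic p (x j)) ∧
        ∀ i, ∑ j, (A i j : ℝ) * x j = (b i : ℝ)) :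
      {x : Fin n → ℝ | ∀ i, ∑ j, (A i j : ℝ) * x j = (b i : ℝ)} ⊆
        closure {x : Fin n → ℝ | (∀ j, IsPadic p (x j)) ∧
          ∀ i, ∑ j, (A i j : ℝ) * x j = (b i : ℝ)} := by
  obtain ⟨x0, hx0, hA0⟩ := hx
  intro x hx
  obtain ⟨r, v, z, hz, hv⟩ := exists_int_kernel A (fun j => x j - x0 j) (by
    intro i
    simp only [mul_sub, Finset.sum_sub_distrib]
    rw [hx i, hA0 i, sub_self])
  let f : (Fin r → ℝ) → (Fin n → ℝ) := fun c j => x0 j + ∑ k, c k * z k j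
  have hf : Continuous f := by fun_prop
  have hxf : f v = x := by
    funext j
    have := hv j
    simp only [f]
    linarith
  have hD : Dense (Set.pi Set.univ fun _ : Fin r => {r : ℝ | IsPadic p r}) :=
    dense_pi Set.univ fun _ _ => dense_isPadic hp
  rw [← hxf]
  refine map_mem_closure hf (hD v) ?_
  intro c hc
  have hc' : ∀ k, IsPadic p (c k) := fun k => hc k (Set.mem_univ k)
  refine ⟨fun j => (hx0 j).add' hp (IsPadic.sum_mul_int hp _ _ _ hc'), fun i => ?_⟩
  simp only [f, mul_add, Finset.sum_add_distrib, hA0 i, Finset.mul_sum]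
  rw [Finset.sum_comm, add_eq_left]
  refine Finset.sum_eq_zero fun k _ => ?_
  have h : ((∑ j, A i j * z k j : ℤ) : ℝ) = 0 := by rw [hz k i]; simp
  push_cast at h
  calc ∑ j, (A i j : ℝ) * (c k * z k j) = c k * ∑ j, (A i j : ℝ) * z k j := by
        rw [Finset.mul_sum]; exact Finset.sum_congr rfl fun j _ => by ring
    _ = 0 := by rw [h, mul_zero]

theorem exists_strict {m n : ℕ} (A : Matrix (Fin m) (Fin n) ℤ) (b : Fin m → ℤ)
    (hP : ∃ x : Fin n → ℝ, ∀ i, ∑ j, (A i j : ℝ) * x j ≤ (b i : ℝ)) (s : Finset (Fin m)) :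
    ∃ x : Fin n → ℝ, (∀ i, ∑ j, (A i j : ℝ) * x j ≤ (b i : ℝ)) ∧
      ∀ i ∈ s, (∃ y : Fin n → ℝ, (∀ i, ∑ j, (A i j : ℝ) * y j ≤ (b i : ℝ)) ∧
        ∑ j, (A i j : ℝ) * y j ≠ b i) → ∑ j, (A i j : ℝ) * x j < (b i : ℝ) := by
  induction s using Finset.induction_on with
  | empty => obtain ⟨x, hx⟩ := hP; exact ⟨x, hx, by simp⟩
  | insert a s ha ih =>
    obtain ⟨x, hx, hs⟩ := ih
    by_cases h : ∃ y : Fin n → ℝ, (∀ i, ∑ j, (A i j : ℝ) * y j ≤ (b i : ℝ)) ∧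
        ∑ j, (A a j : ℝ) * y j ≠ b a
    · obtain ⟨y, hy, hya⟩ := h
      have hya := lt_of_le_of_ne (hy a) hya
      have key : ∀ i, ∑ j, (A i j : ℝ) * ((x j + y j) / 2) =
          (∑ j, (A i j : ℝ) * x j + ∑ j, (A i j : ℝ) * y j) / 2 := by
        intro i
        rw [← Finset.sum_add_distrib, Finset.sum_div]
        exact Finset.sum_congr rfl fun j _ => by ring
      refine ⟨fun j => (x j + y j) / 2, fun i => ?_, fun i hi hiy => ?_⟩
      · rw [key]; linarith [hx i, hy i]
      · rw [key]
        rcases Finset.mem_insert.1 hi with rfl | hi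
        · linarith [hx i]
        · linarith [hs i hi hiy, hy i]
    · refine ⟨x, hx, fun i hi hiy => ?_⟩
      rcases Finset.mem_insert.1 hi with rfl | hi
      · exact absurd hiy h
      · exact hs i hi hiy

/-- **Density Lemma.** If `{x : Ax = b}` (with `A, b` integral) contains a
`p`-adic point, then the `p`-adic points of `{x : Ax = b}` are dense in it. Consequently, a
nonempty rational polyhedron `{x : Ax ≤ b}` contains a `p`-adic point iff its affine hull
contains a `p`-adic point. -/
theorem density_lemma {m n : ℕ} (p : ℕ) (hp : p.Prime) :
    (∀ (A : Matrix (Fin m) (Fin n) ℤ) (b : Fin m → ℤ),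
      (∃ x : Fin n → ℝ, (∀ j, IsPadic p (x j)) ∧
        ∀ i, ∑ j, (A i j : ℝ) * x j = (b i : ℝ)) →
      {x : Fin n → ℝ | ∀ i, ∑ j, (A i j : ℝ) * x j = (b i : ℝ)} ⊆
        closure {x : Fin n → ℝ | (∀ j, IsPadic p (x j)) ∧
          ∀ i, ∑ j, (A i j : ℝ) * x j = (b i : ℝ)}) ∧
    (∀ (A : Matrix (Fin m) (Fin n) ℤ) (b : Fin m → ℤ),
      {x : Fin n → ℝ | ∀ i, ∑ j, (A i j : ℝ) * x j ≤ (b i : ℝ)}.Nonempty →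
      ((∃ x ∈ {x : Fin n → ℝ | ∀ i, ∑ j, (A i j : ℝ) * x j ≤ (b i : ℝ)},
          ∀ j, IsPadic p (x j)) ↔
        (∃ x ∈ (affineSpan ℝ
            {x : Fin n → ℝ | ∀ i, ∑ j, (A i j : ℝ) * x j ≤ (b i : ℝ)} :
              AffineSubspace ℝ (Fin n → ℝ)),
          ∀ j, IsPadic p (x j)))) := by
  refine ⟨density_part p hp, fun A b hP => ⟨?_, ?_⟩⟩
  · rintro ⟨x, hx, hxp⟩
    exact ⟨x, subset_affineSpan ℝ _ hx, hxp⟩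
  · rintro ⟨y, hy, hyp⟩
    classical
    let S : Fin m → Prop := fun i => ∃ y : Fin n → ℝ,
      (∀ i, ∑ j, (A i j : ℝ) * y j ≤ (b i : ℝ)) ∧ ∑ j, (A i j : ℝ) * y j ≠ b i
    obtain ⟨x, hx, hs⟩ := exists_strict A b hP Finset.univ
    let A' : Matrix (Fin m) (Fin n) ℤ := fun i j => if S i then 0 else A i j
    let b' : Fin m → ℤ := fun i => if S i then 0 else b i
    have hAb : ∀ w : Fin n → ℝ, (∀ i, ∑ j, (A' i j : ℝ) * w j = (b' i : ℝ)) ↔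
        ∀ i, ¬ S i → ∑ j, (A i j : ℝ) * w j = (b i : ℝ) := by
      intro w
      refine forall_congr' fun i => ?_
      by_cases h : S i <;> simp [A', b', h]
    have hPE : ∀ w : Fin n → ℝ, (∀ i, ∑ j, (A i j : ℝ) * w j ≤ (b i : ℝ)) →
        ∀ i, ¬ S i → ∑ j, (A i j : ℝ) * w j = (b i : ℝ) := by
      intro w hw i hi
      by_contra hne
      exact hi ⟨w, hw, hne⟩
    have hyE : ∀ i, ¬ S i → ∑ j, (A i j : ℝ) * y j = (b i : ℝ) := by
      intro i hi
      refine affineSpan_induction (p := fun w : Fin n → ℝ => ∑ j, (A i j : ℝ) * w j = (b i : ℝ))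
        hy (fun w hw => hPE w hw i hi) ?_
      intro c u v w hu hv hw
      have : ∑ j, (A i j : ℝ) * (c • (u -ᵥ v) +ᵥ w) j =
          c * (∑ j, (A i j : ℝ) * u j - ∑ j, (A i j : ℝ) * v j) + ∑ j, (A i j : ℝ) * w j := by
        rw [← Finset.sum_sub_distrib, Finset.mul_sum, ← Finset.sum_add_distrib]
        refine Finset.sum_congr rfl fun j _ => ?_
        simp only [vsub_eq_sub, vadd_eq_add, Pi.add_apply, Pi.smul_apply, Pi.sub_apply,
          smul_eq_mul]
        ring
      rw [this, hu, hv, hw]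
      ring
    have hcl := density_part p hp A' b' ⟨y, hyp, (hAb y).2 hyE⟩ ((hAb x).2 (hPE x hx))
    have hopen : IsOpen {w : Fin n → ℝ | ∀ i, S i → ∑ j, (A i j : ℝ) * w j < (b i : ℝ)} := by
      simp only [Set.setOf_forall]
      refine isOpen_iInter_of_finite fun i => isOpen_iInter_of_finite fun _ => ?_
      exact isOpen_lt (by fun_prop) continuous_const
    obtain ⟨w, hw1, hwp, hw2⟩ := mem_closure_iff.1 hcl _ hopen
      (fun i hi => hs i (Finset.mem_univ i) hi)
    refine ⟨w, fun i => ?_, hwp⟩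
    by_cases h : S i
    · exact (hw1 i h).le
    · exact ((hAb w).1 hw2 i h).le
end
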